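/- arXiv:math/0703569 — 2 statements merged into one kernel-verified Lean document; each statement's English description precedes it below -/
import Mathlib

section
/- Let m ≥ 2 and let p be a positive even integer. Suppose x_1, …, x_n are points on the unit sphere S^{m-1} ⊂ ℝ^m, pairwise projectively distinct (x_i ≠ ±x_j for i ≠ j), and ρ_1, …, ρ_n are positive real weights such that ∫_{S^{m-1}} ψ dσ = Σ_{i=1}^n ρ_i ψ(x_i) for every homogeneous polynomial ψ of degree p in m real variables. Let Q be a nonzero real polynomial of degree p+1 satisfying ∫_{-1}^{1} Q(s) s^j (1-s²)^{(m-1)/2} ds = 0 for all integers 0 ≤ j ≤ p, and let η be the largest real root of Q (all roots of such Q are real, simple and lie in (-1,1)). Then n ≥ (∫_0^1 (1-s²)^{(m-3)/2} ds) / (∫_η^1 (1-s²)^{(m-3)/2} ds). -/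
open MeasureTheory Polynomial

section Divergence

variable {E : Type*} [NormedAddCommGroup E] [InnerProductSpace ℝ E]

/-- The rotation by the angle `θ` in the plane spanned by the orthonormal pair `a`, `e`, as a
linear map. -/
noncomputable def planeRotationLinear (a e : E) (θ : ℝ) : E →ₗ[ℝ] E :=
  LinearMap.id
    + ((Real.cos θ - 1) • (innerₗ E a) - Real.sin θ • (innerₗ E e)).smulRight a
    + (Real.sin θ • (innerₗ E a) + (Real.cos θ - 1) • (innerₗ E e)).smulRight e

lemma planeRotationLinear_apply (a e : E) (θ : ℝ) (z : E) :
    planeRotationLinear a e θ z = z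
      + ((Real.cos θ - 1) * inner ℝ a z - Real.sin θ * inner ℝ e z) • a
      + (Real.sin θ * inner ℝ a z + (Real.cos θ - 1) * inner ℝ e z) • e := by
  simp [planeRotationLinear]

lemma norm_planeRotationLinear {a e : E} (ha : ‖a‖ = 1) (he : ‖e‖ = 1)
    (hae : inner ℝ a e = 0) (θ : ℝ) (z : E) : ‖planeRotationLinear a e θ z‖ = ‖z‖ := by
  rw [← sq_eq_sq₀ (norm_nonneg _) (norm_nonneg _), planeRotationLinear_apply]
  simp only [← real_inner_self_eq_norm_sq]
  have ha' : inner ℝ a a = 1 := by rw [real_inner_self_eq_norm_sq, ha]; norm_num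
  have he' : inner ℝ e e = 1 := by rw [real_inner_self_eq_norm_sq, he]; norm_num
  have hea : inner ℝ e a = 0 := by rw [real_inner_comm, hae]
  simp only [inner_add_left, inner_add_right, real_inner_smul_left, real_inner_smul_right,
    ha', he', hae, hea, real_inner_comm a z, real_inner_comm e z]
  linear_combination ((inner ℝ a z) ^ 2 + (inner ℝ e z) ^ 2) * Real.sin_sq_add_cos_sq θ

lemma norm_planeRotationLinear_sub_le {a e : E} (ha : ‖a‖ = 1) (he : ‖e‖ = 1) {z : E}
    (hz : ‖z‖ = 1) (θ φ : ℝ) :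
    ‖planeRotationLinear a e θ z - planeRotationLinear a e φ z‖ ≤ 4 * |θ - φ| := by
  have hs : |inner ℝ a z| ≤ 1 := by simpa [ha, hz] using abs_real_inner_le_norm a z
  have ht : |inner ℝ e z| ≤ 1 := by simpa [he, hz] using abs_real_inner_le_norm e z
  have hc : |Real.cos θ - Real.cos φ| ≤ |θ - φ| := by
    simpa [Real.dist_eq] using Real.lipschitzWith_cos.dist_le_mul θ φ
  have hd : |Real.sin θ - Real.sin φ| ≤ |θ - φ| := by
    simpa [Real.dist_eq] using Real.lipschitzWith_sin.dist_le_mul θ φ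
  have key : planeRotationLinear a e θ z - planeRotationLinear a e φ z =
      ((Real.cos θ - Real.cos φ) * inner ℝ a z) • a - ((Real.sin θ - Real.sin φ) * inner ℝ e z) • a
      + ((Real.sin θ - Real.sin φ) * inner ℝ a z) • e
      + ((Real.cos θ - Real.cos φ) * inner ℝ e z) • e := by
    simp only [planeRotationLinear_apply]
    module
  have bound : ∀ (x y : ℝ) (v : E), |x| ≤ |θ - φ| → |y| ≤ 1 → ‖v‖ = 1 →
      ‖(x * y) • v‖ ≤ |θ - φ| := by
    intro x y v hx hy hv
    rw [norm_smul, hv, mul_one, Real.norm_eq_abs, abs_mul]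
    calc |x| * |y| ≤ |θ - φ| * 1 := by gcongr
      _ = _ := mul_one _
  rw [key]
  refine (norm_add_le _ _).trans ?_
  have h1 := norm_add_le (((Real.cos θ - Real.cos φ) * inner ℝ a z) • a
    - ((Real.sin θ - Real.sin φ) * inner ℝ e z) • a) (((Real.sin θ - Real.sin φ) * inner ℝ a z) • e)
  have h2 := norm_sub_le (((Real.cos θ - Real.cos φ) * inner ℝ a z) • a)
    (((Real.sin θ - Real.sin φ) * inner ℝ e z) • a)
  have b1 := bound _ _ a hc hs ha
  have b2 := bound _ _ a hd ht ha
  have b3 := bound _ _ e hd hs he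
  have b4 := bound _ _ e hc ht he
  linarith

lemma hasDerivAt_planeRotationLinear (a e z : E) :
    HasDerivAt (fun θ => planeRotationLinear a e θ z)
      (inner ℝ a z • e - inner ℝ e z • a) 0 := by
  simp only [planeRotationLinear_apply]
  have hc := (Real.hasDerivAt_cos 0).sub_const 1
  have hs := Real.hasDerivAt_sin 0
  have := (((hc.mul_const (inner ℝ a z)).sub (hs.mul_const (inner ℝ e z))).smul_const a).const_add z
    |>.add (((hs.mul_const (inner ℝ a z)).add (hc.mul_const (inner ℝ e z))).smul_const e)
  refine this.congr_deriv ?_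
  simp only [Real.sin_zero, Real.cos_zero]
  module

variable [FiniteDimensional ℝ E] [MeasurableSpace E]

lemma map_planeRotationLinear {σ : Measure E}
    (hσinv : ∀ g : E ≃ₗᵢ[ℝ] E, Measure.map g σ = σ) {a e : E} (ha : ‖a‖ = 1) (he : ‖e‖ = 1)
    (hae : inner ℝ a e = 0) (θ : ℝ) : σ.map (planeRotationLinear a e θ) = σ :=
  hσinv (LinearIsometry.toLinearIsometryEquiv
    ⟨planeRotationLinear a e θ, norm_planeRotationLinear ha he hae θ⟩ rfl)

variable [BorelSpace E]

/-- The infinitesimal form of invariance under the rotations of the plane spanned by `a`, `e`. -/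
lemma integral_infinitesimal_rotation {σ : Measure E} [IsProbabilityMeasure σ]
    (hσsupp : ∀ᵐ z ∂σ, ‖z‖ = 1) (hσinv : ∀ g : E ≃ₗᵢ[ℝ] E, Measure.map g σ = σ)
    {a e : E} (ha : ‖a‖ = 1) (he : ‖e‖ = 1) (hae : inner ℝ a e = 0)
    {H : E → ℝ} {H' : E → E →L[ℝ] ℝ} (hH : Continuous H) {C : ℝ}
    (hlip : ∀ y z : E, ‖y‖ = 1 → ‖z‖ = 1 → |H y - H z| ≤ C * ‖y - z‖)
    (hmeas : ∀ v, AEStronglyMeasurable (fun z => H' z v) σ)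
    (hderiv : ∀ᵐ z ∂σ, HasFDerivAt H (H' z) z) :
    Integrable (fun z => H' z (inner ℝ a z • e - inner ℝ e z • a)) σ ∧
      ∫ z, H' z (inner ℝ a z • e - inner ℝ e z • a) ∂σ = 0 := by
  have hrot : ∀ θ, Continuous (planeRotationLinear a e θ) := fun θ =>
    LinearMap.continuous_of_finiteDimensional _
  have hzero : ∀ z, planeRotationLinear a e 0 z = z := by
    intro z; simp [planeRotationLinear_apply]
  obtain ⟨K, hK⟩ : ∃ K, ∀ z : E, ‖z‖ = 1 → |H z| ≤ K := by
    obtain ⟨K, hK⟩ := (isCompact_sphere (0 : E) 1).exists_bound_of_continuousOn hH.continuousOn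
    exact ⟨K, fun z hz => hK z (by simpa using hz)⟩
  have hC : 0 ≤ C := by
    have h := hlip a (-a) ha (by simpa using ha)
    have h1 : ‖a - -a‖ = 2 := by
      rw [sub_neg_eq_add, ← two_smul ℝ a, norm_smul, ha]; norm_num
    rw [h1] at h
    linarith [abs_nonneg (H a - H (-a))]
  have hmain := hasDerivAt_integral_of_dominated_loc_of_lip (μ := σ) (x₀ := (0 : ℝ))
    (s := Set.univ)
    (F := fun θ z => H (planeRotationLinear a e θ z))
    (F' := fun z => H' z (inner ℝ a z • e - inner ℝ e z • a)) (bound := fun _ => C * 4)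
    Filter.univ_mem
    (Filter.Eventually.of_forall fun θ => (hH.comp (hrot θ)).aestronglyMeasurable)
    (by
      refine Integrable.of_bound (hH.comp (hrot 0)).aestronglyMeasurable K ?_
      filter_upwards [hσsupp] with z hz
      rw [hzero]; exact hK z hz)
    (by
      simp only [map_sub, map_smul, smul_eq_mul]
      exact (((innerSL ℝ a).continuous.aestronglyMeasurable).mul (hmeas e)).sub
        (((innerSL ℝ e).continuous.aestronglyMeasurable).mul (hmeas a)))
    (by
      filter_upwards [hσsupp] with z hz
      refine LipschitzOnWith.of_dist_le_mul fun θ _ φ _ => ?_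
      have h4 := norm_planeRotationLinear_sub_le ha he hz θ φ
      have hn : ∀ θ, ‖planeRotationLinear a e θ z‖ = 1 := fun θ => by
        rw [norm_planeRotationLinear ha he hae, hz]
      rw [Real.dist_eq, Real.dist_eq, Real.coe_nnabs, abs_of_nonneg (show 0 ≤ C * 4 by positivity)]
      refine (hlip _ _ (hn θ) (hn φ)).trans ?_
      rw [mul_assoc]
      gcongr)
    (integrable_const _)
    (by
      filter_upwards [hderiv] with z hz
      refine HasFDerivAt.comp_hasDerivAt (0 : ℝ) ?_ (hasDerivAt_planeRotationLinear a e z)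
      simpa [hzero] using hz)
  refine ⟨hmain.1, hmain.2.unique ?_⟩
  have hconst : (fun θ => ∫ z, H (planeRotationLinear a e θ z) ∂σ) = fun _ => ∫ z, H z ∂σ := by
    funext θ
    rw [← integral_map (φ := planeRotationLinear a e θ) (hrot θ).aemeasurable
      hH.aestronglyMeasurable, map_planeRotationLinear hσinv ha he hae]
  rw [hconst]
  exact hasDerivAt_const _ _

/-- The divergence theorem on the sphere for the tangential part of the constant field `a`. -/
lemma integral_divergence {σ : Measure E} [IsProbabilityMeasure σ]
    (hσsupp : ∀ᵐ z ∂σ, ‖z‖ = 1) (hσinv : ∀ g : E ≃ₗᵢ[ℝ] E, Measure.map g σ = σ)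
    {a : E} (ha : ‖a‖ = 1)
    {F : E → ℝ} {F' : E → E →L[ℝ] ℝ} (hF : Continuous F) {C : ℝ}
    (hlip : ∀ y z : E, ‖y‖ = 1 → ‖z‖ = 1 → |F y - F z| ≤ C * ‖y - z‖)
    (hmeas : ∀ v, AEStronglyMeasurable (fun z => F' z v) σ)
    (hderiv : ∀ᵐ z ∂σ, HasFDerivAt F (F' z) z) :
    ∫ z, (F' z a - inner ℝ a z * F' z z
      - ((Module.finrank ℝ E : ℝ) - 1) * inner ℝ a z * F z) ∂σ = 0 := by
  obtain ⟨K, hK⟩ : ∃ K, ∀ z : E, ‖z‖ = 1 → |F z| ≤ K := by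
    obtain ⟨K, hK⟩ := (isCompact_sphere (0 : E) 1).exists_bound_of_continuousOn hF.continuousOn
    exact ⟨K, fun z hz => hK z (by simpa using hz)⟩
  obtain ⟨b, i₀, hb⟩ : ∃ (b : OrthonormalBasis (Fin (Module.finrank ℝ E)) ℝ E)
      (i₀ : Fin (Module.finrank ℝ E)), b i₀ = a := by
    have hpos : 0 < Module.finrank ℝ E := by
      have : Nontrivial E := ⟨a, 0, by rintro rfl; simp at ha⟩
      exact Module.finrank_pos
    obtain ⟨b, hb⟩ := Orthonormal.exists_orthonormalBasis_extension_of_card_eq (𝕜 := ℝ) (E := E)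
      (ι := Fin (Module.finrank ℝ E)) (by simp) (v := fun _ => a) (s := {⟨0, hpos⟩})
      (by
        rw [orthonormal_iff_ite]
        rintro ⟨i, hi⟩ ⟨j, hj⟩
        simp only [Set.mem_singleton_iff] at hi hj
        subst hi hj
        simp [ha])
    exact ⟨b, ⟨0, hpos⟩, hb _ rfl⟩
  have hrot : ∀ i, Integrable (fun z =>
        (F z • innerSL ℝ (b i) + inner ℝ (b i) z • F' z)
          (inner ℝ a z • b i - inner ℝ (b i) z • a)) σ ∧
      ∫ z, (F z • innerSL ℝ (b i) + inner ℝ (b i) z • F' z)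
        (inner ℝ a z • b i - inner ℝ (b i) z • a) ∂σ = 0 := by
    intro i
    by_cases hi : i = i₀
    · subst hi; simp [hb]
    · have hbi : ‖b i‖ = 1 := b.orthonormal.1 i
      refine integral_infinitesimal_rotation (H := fun z => F z * inner ℝ (b i) z)
        (C := K + C) hσsupp hσinv ha hbi ?_ ?_ ?_ ?_ ?_
      · rw [← hb]; exact b.orthonormal.2 (Ne.symm hi)
      · exact hF.mul (innerSL ℝ (b i)).continuous
      · intro y z hy hz
        have h1 : |inner ℝ (b i) y - inner ℝ (b i) z| ≤ ‖y - z‖ := by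
          rw [← inner_sub_right]; simpa [hbi] using abs_real_inner_le_norm (b i) (y - z)
        have h2 : |inner ℝ (b i) z| ≤ 1 := by
          simpa [hbi, hz] using abs_real_inner_le_norm (b i) z
        have h3 : F y * inner ℝ (b i) y - F z * inner ℝ (b i) z =
          F y * (inner ℝ (b i) y - inner ℝ (b i) z) + (F y - F z) * inner ℝ (b i) z := by ring
        rw [h3]
        refine (abs_add_le _ _).trans ?_
        rw [abs_mul, abs_mul]
        have hK0 : 0 ≤ K := (abs_nonneg _).trans (hK y hy)
        have h4 := mul_le_mul (hK y hy) h1 (abs_nonneg _) hK0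
        have h5 := mul_le_mul (hlip y z hy hz) h2 (abs_nonneg _)
          ((abs_nonneg _).trans (hlip y z hy hz))
        linarith
      · intro v
        simp only [add_apply, smul_apply, smul_eq_mul]
        exact (hF.aestronglyMeasurable.mul aestronglyMeasurable_const).add
          (((innerSL ℝ (b i)).continuous.aestronglyMeasurable).mul (hmeas v))
      · filter_upwards [hderiv] with z hz
        exact hz.mul (innerSL ℝ (b i)).hasFDerivAt
  have hsum : ∫ z, ∑ i, (F z • innerSL ℝ (b i) + inner ℝ (b i) z • F' z)
        (inner ℝ a z • b i - inner ℝ (b i) z • a) ∂σ = 0 := by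
    rw [integral_finsetSum _ fun i _ => (hrot i).1]
    exact Finset.sum_eq_zero fun i _ => (hrot i).2
  rw [← neg_eq_zero, ← integral_neg, ← hsum]
  refine integral_congr_ae ?_
  filter_upwards [hσsupp] with z hz
  have e2 : ∑ i, inner ℝ (b i) z * inner ℝ (b i) a = inner ℝ a z := by
    rw [← b.sum_inner_mul_inner a z]
    exact Finset.sum_congr rfl fun i _ => by rw [real_inner_comm a (b i)]; ring
  have e3 : ∑ i, inner ℝ (b i) z * inner ℝ (b i) z = (1 : ℝ) := by
    have := b.sum_inner_mul_inner z z
    rw [real_inner_self_eq_norm_sq, hz] at this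
    rw [← one_pow 2, ← this]
    exact Finset.sum_congr rfl fun i _ => by rw [real_inner_comm z (b i)]
  have e4 : ∑ i, inner ℝ (b i) z * F' z (b i) = F' z z := by
    have h := congrArg (F' z) (b.sum_repr' z)
    simpa using h
  have e5 : ∀ i, (F z • innerSL ℝ (b i) + inner ℝ (b i) z • F' z)
        (inner ℝ a z • b i - inner ℝ (b i) z • a) =
      F z * inner ℝ a z - F z * (inner ℝ (b i) z * inner ℝ (b i) a)
        + inner ℝ a z * (inner ℝ (b i) z * F' z (b i))
        - (inner ℝ (b i) z * inner ℝ (b i) z) * F' z a := by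
    intro i
    simp [inner_sub_right, real_inner_smul_right]
    ring
  simp only [e5]
  rw [Finset.sum_sub_distrib, Finset.sum_add_distrib, Finset.sum_sub_distrib, ← Finset.mul_sum,
    ← Finset.mul_sum, ← Finset.mul_sum, ← Finset.sum_mul, e2, e3, e4, Finset.sum_const,
    Finset.card_univ, Fintype.card_fin, nsmul_eq_mul]
  ring

end Divergence

section Zonal

/-- `g` is continuous, Lipschitz on `[-1, 1]`, and has the measurable derivative `g'` almost
everywhere for `μ`. -/
structure IsZonalProfile (μ : Measure ℝ) (g g' : ℝ → ℝ) : Prop where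
  continuous : Continuous g
  lipschitz : ∃ C, ∀ s ∈ Set.Icc (-1 : ℝ) 1, ∀ t ∈ Set.Icc (-1 : ℝ) 1, |g s - g t| ≤ C * |s - t|
  measurable : Measurable g'
  hasDerivAt : ∀ᵐ s ∂μ, HasDerivAt g (g' s) s

lemma exists_lipschitz_eval (r : ℝ[X]) : ∃ C, 0 ≤ C ∧ ∀ s ∈ Set.Icc (-1 : ℝ) 1,
    ∀ t ∈ Set.Icc (-1 : ℝ) 1, |r.eval s - r.eval t| ≤ C * |s - t| := by
  obtain ⟨C, hC⟩ := (isCompact_Icc (a := (-1 : ℝ)) (b := 1)).exists_bound_of_continuousOn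
    r.derivative.continuous.continuousOn
  refine ⟨C, (norm_nonneg _).trans (hC 0 (by norm_num)), fun s hs t ht => ?_⟩
  exact (convex_Icc (-1 : ℝ) 1).norm_image_sub_le_of_norm_hasDerivWithin_le
    (fun x _ => (r.hasDerivAt x).hasDerivWithinAt) hC ht hs

lemma isZonalProfile_eval (μ : Measure ℝ) (r : ℝ[X]) :
    IsZonalProfile μ (fun s => r.eval s) (fun s => r.derivative.eval s) where
  continuous := r.continuous
  lipschitz := let ⟨C, _, h⟩ := exists_lipschitz_eval r; ⟨C, h⟩
  measurable := r.derivative.continuous.measurable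
  hasDerivAt := Filter.Eventually.of_forall r.hasDerivAt

variable {E : Type*} [NormedAddCommGroup E] [InnerProductSpace ℝ E]

lemma inner_mem_Icc {a z : E} (ha : ‖a‖ = 1) (hz : ‖z‖ = 1) :
    inner ℝ a z ∈ Set.Icc (-1 : ℝ) 1 :=
  abs_le.1 (by simpa [ha, hz] using abs_real_inner_le_norm a z)

lemma IsZonalProfile.exists_lipschitz_inner {μ : Measure ℝ} {g g' : ℝ → ℝ}
    (hg : IsZonalProfile μ g g') {a : E} (ha : ‖a‖ = 1) :
    ∃ C, 0 ≤ C ∧ ∀ y z : E, ‖y‖ = 1 → ‖z‖ = 1 →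
      |g (inner ℝ a y) - g (inner ℝ a z)| ≤ C * ‖y - z‖ := by
  obtain ⟨C, hC⟩ := hg.lipschitz
  have hC0 : 0 ≤ C := by
    have h := (abs_nonneg _).trans (hC 1 (by norm_num) 0 (by norm_num))
    simpa using h
  refine ⟨C, hC0, fun y z hy hz => (hC _ (inner_mem_Icc ha hy) _ (inner_mem_Icc ha hz)).trans ?_⟩
  gcongr
  rw [← inner_sub_right]
  simpa [ha] using abs_real_inner_le_norm a (y - z)

lemma exists_bound_inner {g : ℝ → ℝ} (hg : Continuous g) {a : E} (ha : ‖a‖ = 1) :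
    ∃ K, 0 ≤ K ∧ ∀ z : E, ‖z‖ = 1 → |g (inner ℝ a z)| ≤ K := by
  obtain ⟨K, hK⟩ := (isCompact_Icc (a := (-1 : ℝ)) (b := 1)).exists_bound_of_continuousOn
    hg.continuousOn
  exact ⟨K, (norm_nonneg _).trans (hK 0 (by norm_num)), fun z hz => hK _ (inner_mem_Icc ha hz)⟩

variable [FiniteDimensional ℝ E] [MeasurableSpace E] [BorelSpace E]

/-- The divergence theorem for a product of two zonal functions. -/
lemma integral_zonal_divergence {σ : Measure E} [IsProbabilityMeasure σ]
    (hσsupp : ∀ᵐ z ∂σ, ‖z‖ = 1) (hσinv : ∀ g : E ≃ₗᵢ[ℝ] E, Measure.map g σ = σ)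
    {a b : E} (ha : ‖a‖ = 1) (hb : ‖b‖ = 1) {g g' h h' : ℝ → ℝ}
    (hg : IsZonalProfile (σ.map (inner ℝ a)) g g')
    (hh : IsZonalProfile (σ.map (inner ℝ b)) h h') :
    ∫ z, (((1 - inner ℝ a z ^ 2) * g' (inner ℝ a z)
        - ((Module.finrank ℝ E : ℝ) - 1) * inner ℝ a z * g (inner ℝ a z)) * h (inner ℝ b z)
      + g (inner ℝ a z) * h' (inner ℝ b z) * (inner ℝ a b - inner ℝ a z * inner ℝ b z)) ∂σ = 0 := by
  have hca : Continuous (fun z : E => inner ℝ a z) := (innerSL ℝ a).continuous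
  have hcb : Continuous (fun z : E => inner ℝ b z) := (innerSL ℝ b).continuous
  obtain ⟨C, hC0, hC⟩ := hg.exists_lipschitz_inner ha
  obtain ⟨D, hD0, hD⟩ := hh.exists_lipschitz_inner hb
  obtain ⟨K, hK0, hK⟩ := exists_bound_inner hg.continuous ha
  obtain ⟨M, hM0, hM⟩ := exists_bound_inner hh.continuous hb
  have hdiv := integral_divergence hσsupp hσinv ha (C := K * D + C * M)
    (F := fun z => g (inner ℝ a z) * h (inner ℝ b z))
    (F' := fun z => g (inner ℝ a z) • h' (inner ℝ b z) • innerSL ℝ b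
      + h (inner ℝ b z) • g' (inner ℝ a z) • innerSL ℝ a)
    ((hg.continuous.comp hca).mul (hh.continuous.comp hcb))
    (by
      intro y z hy hz
      have e : g (inner ℝ a y) * h (inner ℝ b y) - g (inner ℝ a z) * h (inner ℝ b z) =
        g (inner ℝ a y) * (h (inner ℝ b y) - h (inner ℝ b z))
          + (g (inner ℝ a y) - g (inner ℝ a z)) * h (inner ℝ b z) := by ring
      rw [e]
      refine (abs_add_le _ _).trans ?_
      rw [abs_mul, abs_mul]
      have h4 := mul_le_mul (hK y hy) (hD y z hy hz) (abs_nonneg _) hK0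
      have h5 := mul_le_mul (hC y z hy hz) (hM z hz) (abs_nonneg _) (by positivity)
      linarith)
    (by
      intro v
      have m1 := (hg.continuous.comp hca).measurable
      have m2 := (hh.continuous.comp hcb).measurable
      have m3 := hg.measurable.comp hca.measurable
      have m4 := hh.measurable.comp hcb.measurable
      simp only [add_apply, smul_apply, smul_eq_mul]
      exact ((m1.mul (m4.mul_const _)).add (m2.mul (m3.mul_const _))).aestronglyMeasurable)
    (by
      filter_upwards [ae_of_ae_map hca.aemeasurable hg.hasDerivAt,
        ae_of_ae_map hcb.aemeasurable hh.hasDerivAt] with z hz1 hz2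
      exact (hz1.comp_hasFDerivAt z (innerSL ℝ a).hasFDerivAt).mul
        (hz2.comp_hasFDerivAt z (innerSL ℝ b).hasFDerivAt))
  rw [← hdiv]
  refine integral_congr_ae (Filter.Eventually.of_forall fun z => ?_)
  have haa : inner ℝ a a = (1 : ℝ) := by rw [real_inner_self_eq_norm_sq, ha]; norm_num
  simp only [add_apply, smul_apply, smul_eq_mul, innerSL_apply_apply, haa, real_inner_comm a b]
  ring

end Zonal

section Weight

lemma integrableOn_one_sub_sq_rpow {α : ℝ} (hα : -(1 / 2) ≤ α) :
    IntegrableOn (fun s : ℝ => (1 - s ^ 2) ^ α) (Set.Ioc (-1) 1) := by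
  have h0 : IntegrableOn (fun s : ℝ => 1 / √(1 - s ^ 2)) (Set.Ioc (-1) 1) :=
    intervalIntegral.integrableOn_deriv_of_nonneg Real.continuous_arcsin.continuousOn
      (fun x hx => Real.hasDerivAt_arcsin hx.1.ne' hx.2.ne) (fun x _ => by positivity)
  rw [integrableOn_Ioc_iff_integrableOn_Ioo] at h0 ⊢
  have hm : Measurable fun s : ℝ => (1 - s ^ 2) ^ α :=
    (measurable_const.sub (measurable_id.pow_const 2)).pow_const α
  refine Integrable.mono' h0 hm.aestronglyMeasurable ?_
  filter_upwards [ae_restrict_mem measurableSet_Ioo] with s hs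
  have h1 : 0 < 1 - s ^ 2 := by nlinarith [hs.1, hs.2]
  rw [Real.norm_of_nonneg (by positivity), Real.sqrt_eq_rpow, one_div, ← Real.rpow_neg h1.le]
  exact Real.rpow_le_rpow_of_exponent_ge h1 (by nlinarith) (by simpa using hα)

lemma intervalIntegrable_eval_mul_one_sub_sq_rpow {α : ℝ} (hα : -(1 / 2) ≤ α) (r : ℝ[X]) :
    IntervalIntegrable (fun s : ℝ => r.eval s * (1 - s ^ 2) ^ α) volume (-1) 1 := by
  have h := (intervalIntegrable_iff_integrableOn_Ioc_of_le (by norm_num : (-1 : ℝ) ≤ 1)).2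
    (integrableOn_one_sub_sq_rpow hα)
  exact h.continuousOn_mul r.continuous.continuousOn

/-- Integration by parts against the Gegenbauer weight. -/
lemma integral_gegenbauer_divergence {α : ℝ} (hα : -(1 / 2) ≤ α) (r : ℝ[X]) :
    ∫ s in (-1 : ℝ)..1, ((1 - s ^ 2) * r.derivative.eval s - 2 * (α + 1) * s * r.eval s)
      * (1 - s ^ 2) ^ α = 0 := by
  have h := intervalIntegral.integral_eq_sub_of_hasDerivAt_of_le (a := (-1 : ℝ)) (b := 1)
    (f := fun s => (1 - s ^ 2) ^ (α + 1) * r.eval s)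
    (f' := fun s => ((1 - s ^ 2) * r.derivative.eval s - 2 * (α + 1) * s * r.eval s)
      * (1 - s ^ 2) ^ α) (by norm_num)
    (((continuous_const.sub (continuous_id.pow 2)).rpow_const
      (fun _ => Or.inr (by linarith))).mul r.continuous).continuousOn
    (by
      intro s hs
      have h1 : 0 < 1 - s ^ 2 := by nlinarith [hs.1, hs.2]
      have h2 := ((((hasDerivAt_id s).pow 2).const_sub 1).rpow_const (p := α + 1)
        (Or.inl h1.ne')).mul (r.hasDerivAt s)
      refine h2.congr_deriv ?_
      simp only [Pi.pow_apply, id, add_sub_cancel_right]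
      rw [Real.rpow_add_one h1.ne']
      ring)
    (by
      have := intervalIntegrable_eval_mul_one_sub_sq_rpow hα
        ((1 - X ^ 2) * derivative r - C (2 * (α + 1)) * X * r)
      simpa using this)
  rw [h]
  have h0 : α + 1 ≠ 0 := by linarith
  simp [Real.zero_rpow h0]

/-- The measure with density `(1 - s²)^α` on `(-1, 1]`. -/
noncomputable def gegenbauerMeasure (α : ℝ) : Measure ℝ :=
  (volume.restrict (Set.Ioc (-1) 1)).withDensity fun s => ENNReal.ofReal ((1 - s ^ 2) ^ α)

lemma isFiniteMeasure_gegenbauerMeasure {α : ℝ} (hα : -(1 / 2) ≤ α) :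
    IsFiniteMeasure (gegenbauerMeasure α) :=
  isFiniteMeasure_withDensity_ofReal (integrableOn_one_sub_sq_rpow hα).2

lemma gegenbauerMeasure_absolutelyContinuous (α : ℝ) : gegenbauerMeasure α ≪ volume :=
  (withDensity_absolutelyContinuous _ _).trans Measure.restrict_le_self.absolutelyContinuous

lemma ae_gegenbauerMeasure_mem (α : ℝ) :
    ∀ᵐ s ∂gegenbauerMeasure α, s ∈ Set.Icc (-1 : ℝ) 1 := by
  refine (withDensity_absolutelyContinuous _ _).ae_le ?_
  filter_upwards [ae_restrict_mem measurableSet_Ioc] with s hs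
  exact Set.Ioc_subset_Icc_self hs

lemma integral_gegenbauerMeasure (α : ℝ) (f : ℝ → ℝ) :
    ∫ s, f s ∂gegenbauerMeasure α = ∫ s in (-1 : ℝ)..1, f s * (1 - s ^ 2) ^ α := by
  rw [gegenbauerMeasure, integral_withDensity_eq_integral_toReal_smul (by fun_prop)
    (Filter.Eventually.of_forall fun _ => ENNReal.ofReal_lt_top),
    intervalIntegral.integral_of_le (by norm_num)]
  refine setIntegral_congr_fun measurableSet_Ioc fun s hs => ?_
  have h1 : 0 ≤ 1 - s ^ 2 := by nlinarith [hs.1, hs.2]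
  simp only [smul_eq_mul]
  rw [ENNReal.toReal_ofReal (by positivity), mul_comm]

lemma integrable_eval_of_ae_mem {μ : Measure ℝ} [IsFiniteMeasure μ]
    (hμ : ∀ᵐ s ∂μ, s ∈ Set.Icc (-1 : ℝ) 1) {f : ℝ → ℝ} (hf : Continuous f) : Integrable f μ := by
  obtain ⟨K, hK⟩ := (isCompact_Icc (a := (-1 : ℝ)) (b := 1)).exists_bound_of_continuousOn
    hf.continuousOn
  refine Integrable.of_bound hf.aestronglyMeasurable K ?_
  filter_upwards [hμ] with s hs using hK s hs

/-- A finite measure on `[-1, 1]` is determined by its mass and the divergence identity. -/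
lemma measure_eq_of_divergence {μ ν : Measure ℝ} [IsFiniteMeasure μ] [IsFiniteMeasure ν]
    (hμ : ∀ᵐ s ∂μ, s ∈ Set.Icc (-1 : ℝ) 1) (hν : ∀ᵐ s ∂ν, s ∈ Set.Icc (-1 : ℝ) 1)
    {d : ℝ} (hd : 0 < d)
    (hμd : ∀ r : ℝ[X], ∫ s, ((1 - s ^ 2) * r.derivative.eval s - d * s * r.eval s) ∂μ = 0)
    (hνd : ∀ r : ℝ[X], ∫ s, ((1 - s ^ 2) * r.derivative.eval s - d * s * r.eval s) ∂ν = 0)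
    (hmass : μ.real Set.univ = ν.real Set.univ) : μ = ν := by
  have hrec : ∀ (κ : Measure ℝ) [IsFiniteMeasure κ], (∀ᵐ s ∂κ, s ∈ Set.Icc (-1 : ℝ) 1) →
      (∀ r : ℝ[X], ∫ s, ((1 - s ^ 2) * r.derivative.eval s - d * s * r.eval s) ∂κ = 0) →
      ∀ k : ℕ, (k + d) * ∫ s, s ^ (k + 1) ∂κ = k * ∫ s, s ^ (k - 1) ∂κ := by
    intro κ _ hκ hκd k
    have h := hκd (X ^ k)
    have h2 : ∀ s : ℝ, (1 - s ^ 2) * (derivative (X ^ k : ℝ[X])).eval s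
        - d * s * (X ^ k : ℝ[X]).eval s = k * s ^ (k - 1) - (k + d) * s ^ (k + 1) := by
      intro s
      rcases k with _ | k
      · simp
      · simp
        ring
    simp only [h2] at h
    rw [integral_sub ((integrable_eval_of_ae_mem hκ (by fun_prop)).const_mul _)
      ((integrable_eval_of_ae_mem hκ (by fun_prop)).const_mul _), integral_const_mul,
      integral_const_mul] at h
    linarith
  have hmom : ∀ k : ℕ, ∫ s, s ^ k ∂μ = ∫ s, s ^ k ∂ν := by
    intro k
    induction k using Nat.strong_induction_on with
    | _ k ih =>
      rcases k with _ | k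
      · simp [hmass]
      · have h1 := hrec μ hμ hμd k
        have h2 := hrec ν hν hνd k
        have hk : (k : ℝ) + d ≠ 0 := by positivity
        refine mul_left_cancel₀ hk ?_
        rw [h1, h2, ih (k - 1) (by omega)]
  have hpoly : ∀ r : ℝ[X], ∫ s, r.eval s ∂μ = ∫ s, r.eval s ∂ν := by
    intro r
    induction r using Polynomial.induction_on' with
    | add p q hp hq =>
      simp only [eval_add]
      rw [integral_add (μ := μ) (integrable_eval_of_ae_mem hμ p.continuous)
        (integrable_eval_of_ae_mem hμ q.continuous),
        integral_add (μ := ν) (integrable_eval_of_ae_mem hν p.continuous)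
        (integrable_eval_of_ae_mem hν q.continuous), hp, hq]
    | monomial k c =>
      simp only [eval_monomial, integral_const_mul, hmom]
  refine ext_of_forall_integral_eq_of_IsFiniteMeasure fun f => ?_
  have hbound : ∀ ε > 0, |∫ s, f s ∂μ - ∫ s, f s ∂ν| ≤
      ε * (μ.real Set.univ + ν.real Set.univ) := by
    intro ε hε
    obtain ⟨r, hr⟩ := exists_polynomial_near_of_continuousOn (-1) 1 f f.continuous.continuousOn ε hε
    have hdist : ∀ (κ : Measure ℝ) [IsFiniteMeasure κ], (∀ᵐ s ∂κ, s ∈ Set.Icc (-1 : ℝ) 1) →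
        |∫ s, r.eval s ∂κ - ∫ s, f s ∂κ| ≤ ε * κ.real Set.univ := by
      intro κ _ hκ
      rw [← integral_sub (integrable_eval_of_ae_mem hκ r.continuous)
        (integrable_eval_of_ae_mem hκ f.continuous), ← Real.norm_eq_abs]
      refine norm_integral_le_of_norm_le_const (μ := κ) ?_
      filter_upwards [hκ] with s hs using (hr s hs).le
    have h1 := abs_le.1 (hdist μ hμ)
    have h2 := abs_le.1 (hdist ν hν)
    rw [hpoly] at h1
    rw [abs_le]
    constructor <;> linarith [h1.1, h1.2, h2.1, h2.2]
  by_contra hne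
  have hpos : 0 < |∫ s, f s ∂μ - ∫ s, f s ∂ν| := abs_pos.2 (sub_ne_zero.2 hne)
  set M := μ.real Set.univ + ν.real Set.univ with hM
  have hM0 : 0 ≤ M := by positivity
  have h := hbound (|∫ s, f s ∂μ - ∫ s, f s ∂ν| / (2 * (M + 1))) (by positivity)
  rw [div_mul_eq_mul_div, le_div_iff₀ (by positivity)] at h
  nlinarith

end Weight

section ZonalLaw

variable {E : Type*} [NormedAddCommGroup E] [InnerProductSpace ℝ E]
  [FiniteDimensional ℝ E] [MeasurableSpace E] [BorelSpace E]

/-- The law of a coordinate under the invariant probability measure of the sphere. -/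
lemma map_inner_eq_gegenbauerMeasure {σ : Measure E} [IsProbabilityMeasure σ]
    (hσsupp : ∀ᵐ z ∂σ, ‖z‖ = 1) (hσinv : ∀ g : E ≃ₗᵢ[ℝ] E, Measure.map g σ = σ)
    (hE : 2 ≤ Module.finrank ℝ E) {a : E} (ha : ‖a‖ = 1) :
    gegenbauerMeasure (((Module.finrank ℝ E : ℝ) - 3) / 2) =
      (gegenbauerMeasure (((Module.finrank ℝ E : ℝ) - 3) / 2) Set.univ) • σ.map (inner ℝ a) := by
  set d : ℝ := (Module.finrank ℝ E : ℝ) with hd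
  have hd2 : (2 : ℝ) ≤ d := by rw [hd]; exact_mod_cast hE
  have hα : -(1 / 2) ≤ (d - 3) / 2 := by linarith
  have hca : Continuous (fun z : E => inner ℝ a z) := (innerSL ℝ a).continuous
  have := isFiniteMeasure_gegenbauerMeasure hα
  have : IsProbabilityMeasure (σ.map (inner ℝ a)) :=
    Measure.isProbabilityMeasure_map hca.aemeasurable
  have : IsFiniteMeasure
      ((gegenbauerMeasure ((d - 3) / 2) Set.univ) • σ.map (inner ℝ a)) :=
    Measure.smul_finite _ (measure_ne_top _ _)
  have hsupp : ∀ᵐ s ∂σ.map (inner ℝ a), s ∈ Set.Icc (-1 : ℝ) 1 := by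
    refine (ae_map_iff hca.aemeasurable measurableSet_Icc).2 ?_
    filter_upwards [hσsupp] with z hz using inner_mem_Icc ha hz
  refine measure_eq_of_divergence (d := d - 1) (ae_gegenbauerMeasure_mem _)
    (Measure.ae_smul_measure hsupp _) (by linarith) ?_ ?_ ?_
  · intro r
    rw [integral_gegenbauerMeasure, ← integral_gegenbauer_divergence hα r]
    congr 1
    funext s
    ring
  · intro r
    rw [integral_smul_measure, integral_map hca.aemeasurable (by fun_prop)]
    have h := integral_zonal_divergence hσsupp hσinv ha ha (isZonalProfile_eval _ r)
      (isZonalProfile_eval _ 1)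
    simp only [eval_one, derivative_one, eval_zero, mul_zero, zero_mul, add_zero, mul_one] at h
    rw [h, smul_zero]
  · simp [Measure.real]

end ZonalLaw

section GegenbauerOperator

/-- The operator `r ↦ (1 - s²) r'' - d s r'`. -/
noncomputable def gegenbauerOp (d : ℝ) (r : ℝ[X]) : ℝ[X] :=
  (1 - X ^ 2) * derivative (derivative r) - C d * X * derivative r

lemma gegenbauerOp_add (d : ℝ) (r q : ℝ[X]) :
    gegenbauerOp d (r + q) = gegenbauerOp d r + gegenbauerOp d q := by
  simp only [gegenbauerOp, derivative_add]; ring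

lemma gegenbauerOp_sub (d : ℝ) (r q : ℝ[X]) :
    gegenbauerOp d (r - q) = gegenbauerOp d r - gegenbauerOp d q := by
  simp only [gegenbauerOp, derivative_sub]; ring

lemma eval_gegenbauerOp (d : ℝ) (r : ℝ[X]) (s : ℝ) : (gegenbauerOp d r).eval s =
    (1 - s ^ 2) * (derivative (derivative r)).eval s - d * s * (derivative r).eval s := by
  simp [gegenbauerOp]

lemma coeff_gegenbauerOp (d : ℝ) (r : ℝ[X]) (j : ℕ) : (gegenbauerOp d r).coeff j =
    (j + 2) * (j + 1) * r.coeff (j + 2) - j * (j + d - 1) * r.coeff j := by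
  have e : gegenbauerOp d r = derivative (derivative r) - X ^ 2 * derivative (derivative r)
      - C d * (X * derivative r) := by rw [gegenbauerOp]; ring
  rw [e, coeff_sub, coeff_sub, coeff_C_mul, coeff_X_pow_mul']
  rcases j with _ | _ | j
  · simp [coeff_derivative]; ring
  · simp [coeff_derivative]; ring
  · simp [coeff_derivative]; ring

lemma gegenbauer_eigenvalue_strictMono {d : ℝ} (hd : 0 < d) {j k : ℕ} (hjk : j < k) :
    (j : ℝ) * (j + d - 1) < k * (k + d - 1) := by
  have h : (j : ℝ) + 1 ≤ k := by exact_mod_cast hjk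
  have hj : (0 : ℝ) ≤ j := Nat.cast_nonneg j
  nlinarith

lemma exists_gegenbauerOp_add_eq {d μ : ℝ} (k : ℕ)
    (hμ : ∀ j < k, μ ≠ (j : ℝ) * (j + d - 1)) (g : ℝ[X]) (hg : ∀ j ≥ k, g.coeff j = 0) :
    ∃ r : ℝ[X], (∀ j ≥ k, r.coeff j = 0) ∧ gegenbauerOp d r + C μ * r = g := by
  induction k generalizing g with
  | zero =>
    refine ⟨0, by simp, ?_⟩
    have : g = 0 := by ext j; simpa using hg j (Nat.zero_le j)
    simp [this, gegenbauerOp]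
  | succ k ih =>
    have hne : μ - (k : ℝ) * (k + d - 1) ≠ 0 := sub_ne_zero.2 (hμ k (Nat.lt_succ_self k))
    set c := g.coeff k / (μ - (k : ℝ) * (k + d - 1)) with hc
    obtain ⟨r, hr, hrg⟩ := ih (fun j hj => hμ j (hj.trans (Nat.lt_succ_self k)))
      (g - (gegenbauerOp d (C c * X ^ k) + C μ * (C c * X ^ k))) (by
        intro j hj
        simp only [coeff_sub, coeff_add, coeff_gegenbauerOp, coeff_C_mul, coeff_X_pow]
        rw [if_neg (by omega : ¬ j + 2 = k)]
        rcases eq_or_lt_of_le hj with rfl | hlt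
        · rw [if_pos rfl]
          field_simp at hc
          linarith
        · rw [if_neg (by omega : ¬ j = k), hg j hlt]
          ring)
    refine ⟨r + C c * X ^ k, fun j hj => ?_, ?_⟩
    · rw [coeff_add, hr j (by omega), coeff_C_mul, coeff_X_pow, if_neg (by omega : ¬ j = k)]
      ring
    · rw [gegenbauerOp_add]
      linear_combination hrg

/-- The monic Gegenbauer polynomials exist. -/
lemma exists_gegenbauer {d : ℝ} (hd : 0 < d) (k : ℕ) : ∃ P : ℝ[X], P.Monic ∧ P.natDegree = k ∧
    gegenbauerOp d P = -C ((k : ℝ) * (k + d - 1)) * P := by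
  obtain ⟨r, hr, hrg⟩ := exists_gegenbauerOp_add_eq (d := d) (μ := (k : ℝ) * (k + d - 1)) k
    (fun j hj => (gegenbauer_eigenvalue_strictMono hd hj).ne')
    (gegenbauerOp d (X ^ k) + C ((k : ℝ) * (k + d - 1)) * X ^ k) (by
      intro j hj
      simp only [coeff_add, coeff_gegenbauerOp, coeff_C_mul, coeff_X_pow]
      rw [if_neg (by omega : ¬ j + 2 = k)]
      split_ifs with h
      · subst h; ring
      · ring)
  have hdeg : r.degree < k := (degree_lt_iff_coeff_zero _ _).2 hr
  refine ⟨X ^ k - r, monic_X_pow_sub hdeg, ?_, ?_⟩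
  · refine natDegree_eq_of_degree_eq_some ?_
    rw [degree_sub_eq_left_of_degree_lt (by rwa [degree_X_pow]), degree_X_pow]
  · rw [gegenbauerOp_sub]
    linear_combination -hrg

lemma integral_eval_mul_pos {α : ℝ} (hα : -(1 / 2) ≤ α) {f : ℝ[X]} (hf : f ≠ 0)
    (hnn : ∀ s ∈ Set.Ioo (-1 : ℝ) 1, 0 ≤ f.eval s) :
    0 < ∫ s in (-1 : ℝ)..1, f.eval s * (1 - s ^ 2) ^ α := by
  have hpos : ∀ s ∈ Set.Ioo (-1 : ℝ) 1, 0 < (1 - s ^ 2) ^ α := fun s hs =>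
    Real.rpow_pos_of_pos (by nlinarith [hs.1, hs.2]) α
  have hint := intervalIntegrable_eval_mul_one_sub_sq_rpow hα f
  rw [intervalIntegrable_iff_integrableOn_Ioo_of_le (by norm_num)] at hint
  rw [intervalIntegral.integral_of_le (by norm_num), integral_Ioc_eq_integral_Ioo,
    setIntegral_pos_iff_support_of_nonneg_ae _ hint]
  · have hsub : Set.Ioo (-1 : ℝ) 1 \ (f.roots.toFinset : Set ℝ) ⊆
        Function.support (fun s => f.eval s * (1 - s ^ 2) ^ α) ∩ Set.Ioo (-1) 1 := by
      rintro s ⟨hs, hs'⟩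
      refine ⟨mul_ne_zero ?_ (hpos s hs).ne', hs⟩
      simpa [hf] using hs'
    refine lt_of_lt_of_le ?_ (measure_mono hsub)
    rw [measure_sdiff_null (Finset.measure_zero _ _)]
    simp
  · filter_upwards [ae_restrict_mem measurableSet_Ioo] with s hs
    exact mul_nonneg (hnn s hs) (hpos s hs).le

variable {α : ℝ} {p : ℕ} {Q : ℝ[X]}

lemma integral_mul_eq_zero_of_orthogonal (hα : -(1 / 2) ≤ α)
    (hQorth : ∀ j : ℕ, j ≤ p → ∫ s in (-1 : ℝ)..1, Q.eval s * s ^ j * (1 - s ^ 2) ^ α = 0)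
    (r : ℝ[X]) (hr : ∀ j > p, r.coeff j = 0) :
    ∫ s in (-1 : ℝ)..1, (Q * r).eval s * (1 - s ^ 2) ^ α = 0 := by
  have hdeg : r.natDegree < p + 1 := by
    rw [Nat.lt_succ_iff, natDegree_le_iff_coeff_eq_zero]; exact hr
  have e : ∀ s : ℝ, (Q * r).eval s * (1 - s ^ 2) ^ α =
      ∑ j ∈ Finset.range (p + 1), r.coeff j * (Q.eval s * s ^ j * (1 - s ^ 2) ^ α) := by
    intro s
    rw [eval_mul, eval_eq_sum_range' hdeg, Finset.mul_sum, Finset.sum_mul]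
    exact Finset.sum_congr rfl fun j _ => by ring
  simp only [e]
  rw [intervalIntegral.integral_finsetSum]
  · refine Finset.sum_eq_zero fun j hj => ?_
    rw [intervalIntegral.integral_const_mul, hQorth j (by simpa [Nat.lt_succ_iff] using hj),
      mul_zero]
  · intro j _
    have := intervalIntegrable_eval_mul_one_sub_sq_rpow hα (Q * X ^ j)
    simp only [eval_mul, eval_pow, eval_X] at this
    exact this.const_mul _

/-- The largest root of an orthogonal polynomial lies in the open interval. -/
lemma root_mem_Ioo_of_orthogonal (hα : -(1 / 2) ≤ α) (hQ : Q ≠ 0) (hQdeg : Q.natDegree = p + 1)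
    (hQorth : ∀ j : ℕ, j ≤ p → ∫ s in (-1 : ℝ)..1, Q.eval s * s ^ j * (1 - s ^ 2) ^ α = 0)
    {η : ℝ} (hη : Q.eval η = 0) : η ∈ Set.Ioo (-1 : ℝ) 1 := by
  obtain ⟨R, hR⟩ : X - C η ∣ Q := dvd_iff_isRoot.2 hη
  have hR0 : R ≠ 0 := by rintro rfl; simp at hR; exact hQ hR
  have hRdeg : R.natDegree = p := by
    rw [hR, natDegree_mul (X_sub_C_ne_zero η) hR0, natDegree_X_sub_C] at hQdeg
    omega
  have hzero := integral_mul_eq_zero_of_orthogonal hα hQorth R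
    (fun j hj => coeff_eq_zero_of_natDegree_lt (by omega))
  have hQR : Q * R ≠ 0 := mul_ne_zero hQ hR0
  have hev : ∀ s, (Q * R).eval s = (s - η) * R.eval s ^ 2 := by
    intro s; rw [eval_mul, hR]; simp; ring
  by_contra hmem
  rw [Set.mem_Ioo, not_and_or, not_lt, not_lt] at hmem
  rcases hmem with h | h
  · have := integral_eval_mul_pos hα hQR (fun s hs => by
      rw [hev]; exact mul_nonneg (by linarith [hs.1]) (sq_nonneg _))
    exact this.ne' hzero
  · have := integral_eval_mul_pos hα (neg_ne_zero.2 hQR) (fun s hs => by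
      rw [eval_neg, hev]; nlinarith [hs.2, mul_nonneg (by linarith [hs.2] : 0 ≤ η - s)
        (sq_nonneg (R.eval s))])
    simp only [eval_neg, neg_mul, intervalIntegral.integral_neg, hzero] at this
    simp at this

/-- An orthogonal polynomial for the weight `(1 - s²)^α` satisfies the Gegenbauer equation. -/
lemma gegenbauerOp_eq_of_orthogonal (hα : -(1 / 2) ≤ α) (hQdeg : Q.natDegree = p + 1)
    (hQorth : ∀ j : ℕ, j ≤ p → ∫ s in (-1 : ℝ)..1, Q.eval s * s ^ j * (1 - s ^ 2) ^ α = 0) :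
    gegenbauerOp (2 * (α + 1)) Q = -C (((p + 1 : ℕ) : ℝ) * ((p + 1 : ℕ) + 2 * (α + 1) - 1)) * Q := by
  set d := 2 * (α + 1) with hd
  set κ := ((p + 1 : ℕ) : ℝ) * ((p + 1 : ℕ) + d - 1) with hκ
  set S := gegenbauerOp d Q + C κ * Q with hS
  have hScoeff : ∀ j > p, S.coeff j = 0 := by
    intro j hj
    rw [hS, coeff_add, coeff_gegenbauerOp, coeff_C_mul,
      coeff_eq_zero_of_natDegree_lt (by omega : Q.natDegree < j + 2)]
    rcases eq_or_lt_of_le (Nat.succ_le_of_lt hj) with rfl | hlt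
    · rw [hκ, Nat.succ_eq_add_one]; ring
    · rw [coeff_eq_zero_of_natDegree_lt (by omega : Q.natDegree < j)]; ring
  have h1 := integral_mul_eq_zero_of_orthogonal hα hQorth S hScoeff
  have h2 := integral_mul_eq_zero_of_orthogonal hα hQorth (gegenbauerOp d S) (fun j hj => by
    rw [coeff_gegenbauerOp, hScoeff j hj, hScoeff (j + 2) (by omega)]; ring)
  have h3 := integral_gegenbauer_divergence hα (derivative Q * S - Q * derivative S)
  have e : ∀ s : ℝ, (S * S).eval s * (1 - s ^ 2) ^ α =
      ((1 - s ^ 2) * (derivative (derivative Q * S - Q * derivative S)).eval s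
        - 2 * (α + 1) * s * (derivative Q * S - Q * derivative S).eval s) * (1 - s ^ 2) ^ α
      + (Q * gegenbauerOp d S).eval s * (1 - s ^ 2) ^ α
      + κ * ((Q * S).eval s * (1 - s ^ 2) ^ α) := by
    intro s
    have e1 : (S * S).eval s = (gegenbauerOp d Q + C κ * Q).eval s * S.eval s := by
      rw [eval_mul, ← hS]
    rw [e1]
    simp only [derivative_sub, derivative_mul, eval_add, eval_sub, eval_mul, eval_C,
      eval_gegenbauerOp, ← hd]
    ring
  by_contra hne
  have hS0 : S ≠ 0 := by
    intro h0
    apply hne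
    rw [hS] at h0
    linear_combination h0
  have hpos := integral_eval_mul_pos hα (mul_ne_zero hS0 hS0)
    (fun s _ => by rw [eval_mul]; exact mul_self_nonneg _)
  have i2 := intervalIntegrable_eval_mul_one_sub_sq_rpow hα (Q * gegenbauerOp d S)
  have i3 := (intervalIntegrable_eval_mul_one_sub_sq_rpow hα (Q * S)).const_mul κ
  have i1 : IntervalIntegrable (fun s : ℝ =>
      ((1 - s ^ 2) * (derivative (derivative Q * S - Q * derivative S)).eval s
        - 2 * (α + 1) * s * (derivative Q * S - Q * derivative S).eval s) * (1 - s ^ 2) ^ α)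
      volume (-1) 1 := by
    have := intervalIntegrable_eval_mul_one_sub_sq_rpow hα
      ((1 - X ^ 2) * derivative (derivative Q * S - Q * derivative S)
        - C (2 * (α + 1)) * X * (derivative Q * S - Q * derivative S))
    simpa only [eval_sub, eval_mul, eval_one, eval_pow, eval_X, eval_C] using this
  simp only [e] at hpos
  rw [intervalIntegral.integral_add (i1.add i2) i3, intervalIntegral.integral_add i1 i2,
    intervalIntegral.integral_const_mul, h1, h2, h3] at hpos
  simp at hpos

/-- The antiderivative, vanishing at `η`, of a solution of the Gegenbauer equation. -/
lemma exists_gegenbauer_antiderivative {d κ : ℝ} (hκ : κ + d ≠ 0)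
    (hQ : gegenbauerOp (d + 2) Q = -C κ * Q) (η : ℝ) :
    ∃ (P : ℝ[X]) (c : ℝ), derivative P = Q ∧ P.eval η = 0 ∧
      gegenbauerOp d P + C (κ + d) * P = C c := by
  set T := (1 - X ^ 2) * derivative Q - C d * X * Q with hT
  set P₀ := -C (κ + d)⁻¹ * T with hP₀
  have hCC : C (κ + d) * C (κ + d)⁻¹ = (1 : ℝ[X]) := by
    rw [← C_mul, mul_inv_cancel₀ hκ, C_1]
  have hderT : derivative T = -C (κ + d) * Q := by
    have e : derivative T = gegenbauerOp (d + 2) Q - C d * Q := by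
      rw [hT, gegenbauerOp]
      simp only [derivative_sub, derivative_mul, derivative_one, derivative_X_pow, derivative_C,
        derivative_X, C_add]
      simp
      ring
    rw [e, hQ, C_add]; ring
  have hder : derivative P₀ = Q := by
    rw [hP₀, derivative_mul, derivative_neg, derivative_C, hderT]
    linear_combination Q * hCC
  refine ⟨P₀ - C (P₀.eval η), -((κ + d) * P₀.eval η), ?_, by simp, ?_⟩
  · rw [derivative_sub, derivative_C, hder, sub_zero]
  · have hop : gegenbauerOp d (P₀ - C (P₀.eval η)) = T := by
      rw [gegenbauerOp, derivative_sub, derivative_C, hder, sub_zero]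
    rw [hop, C_neg, C_mul, mul_sub]
    linear_combination -T * hCC + C (κ + d) * hP₀

end GegenbauerOperator

section Core

/-- Termwise comparison of a scalar product along an orthogonal sequence. -/
lemma inner_le_of_orthogonal_sequence {H : Type*} [NormedAddCommGroup H] [InnerProductSpace ℝ H]
    {v : ℕ → H} (hv : ∀ j k, j ≠ k → inner ℝ (v j) (v k) = 0) (hv0 : ‖v 0‖ = 1) {U V : H}
    (hU : U ∈ closure (Submodule.span ℝ (Set.range v) : Set H))
    (hUV : ∀ k, k ≠ 0 → inner ℝ U (v k) * inner ℝ V (v k) ≤ 0) :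
    inner ℝ U V ≤ inner ℝ U (v 0) * inner ℝ V (v 0) := by
  refine le_of_forall_pos_le_add fun ε hε => ?_
  obtain ⟨R, hR, hdist⟩ := Metric.mem_closure_iff.1 hU (ε / (‖V‖ + 1)) (by positivity)
  obtain ⟨c, rfl⟩ := Finsupp.mem_span_range_iff_exists_finsupp.1 hR
  classical
  set S := insert 0 c.support with hS
  set Y := ∑ k ∈ S, (inner ℝ U (v k) / ‖v k‖ ^ 2) • v k with hY
  have hperp : ∀ k ∈ S, inner ℝ (U - Y) (v k) = 0 := by
    intro k hk
    rw [inner_sub_left, hY, sum_inner, Finset.sum_eq_single k]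
    · rw [real_inner_smul_left, real_inner_self_eq_norm_sq]
      by_cases h0 : v k = 0
      · simp [h0]
      · have : ‖v k‖ ≠ 0 := norm_ne_zero_iff.2 h0
        field_simp
        ring
    · intro j _ hjk
      rw [real_inner_smul_left, hv j k hjk, mul_zero]
    · exact fun h => absurd hk h
  have hcR : (c.sum fun i a => a • v i) = ∑ k ∈ S, c k • v k := by
    rw [Finsupp.sum]
    exact Finset.sum_subset (Finset.subset_insert _ _) fun k _ hk => by
      simp [Finsupp.notMem_support_iff.1 hk]
  have hpyth : ‖U - Y‖ ≤ ‖U - c.sum fun i a => a • v i‖ := by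
    have horth : inner ℝ (U - Y) (Y - c.sum fun i a => a • v i) = 0 := by
      rw [hcR, hY, ← Finset.sum_sub_distrib, inner_sum]
      refine Finset.sum_eq_zero fun k hk => ?_
      rw [← sub_smul, real_inner_smul_right, hperp k hk, mul_zero]
    have h := norm_add_sq_eq_norm_sq_add_norm_sq_of_inner_eq_zero _ _ horth
    rw [sub_add_sub_cancel] at h
    nlinarith [norm_nonneg (U - Y), norm_nonneg (U - c.sum fun i a => a • v i),
      mul_self_nonneg ‖Y - c.sum fun i a => a • v i‖]
  have hYV : inner ℝ Y V ≤ inner ℝ U (v 0) * inner ℝ V (v 0) := by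
    rw [hY, sum_inner, hS, ← Finset.insert_erase (Finset.mem_insert_self 0 c.support),
      Finset.sum_insert (Finset.notMem_erase _ _)]
    have h0 : inner ℝ ((inner ℝ U (v 0) / ‖v 0‖ ^ 2) • v 0) V
        = inner ℝ U (v 0) * inner ℝ V (v 0) := by
      rw [real_inner_smul_left, hv0, real_inner_comm V]; simp
    rw [h0]
    refine add_le_of_nonpos_right (Finset.sum_nonpos fun k hk => ?_)
    rw [real_inner_smul_left, real_inner_comm V, div_mul_eq_mul_div]
    exact div_nonpos_of_nonpos_of_nonneg (hUV k (Finset.ne_of_mem_erase hk)) (sq_nonneg _)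
  have hrest : inner ℝ (U - Y) V ≤ ε := by
    refine (real_inner_le_norm _ _).trans ?_
    rw [dist_eq_norm] at hdist
    have h := hpyth.trans hdist.le
    rw [le_div_iff₀ (by positivity)] at h
    nlinarith [norm_nonneg (U - Y)]
  rw [inner_sub_left] at hrest
  linarith

lemma inner_toLp_toLp {Ω : Type*} [MeasurableSpace Ω] {μ : Measure Ω} {f g : Ω → ℝ}
    (hf : MemLp f 2 μ) (hg : MemLp g 2 μ) :
    inner ℝ (hf.toLp f) (hg.toLp g) = ∫ z, f z * g z ∂μ := by
  rw [L2.inner_def]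
  refine integral_congr_ae ?_
  filter_upwards [hf.coeFn_toLp, hg.coeFn_toLp] with z h1 h2
  rw [h1, h2]
  simp [mul_comm]

/-- A measurable function bounded on `[-1, 1]`. -/
structure IsBoundedProfile (k : ℝ → ℝ) : Prop where
  measurable : Measurable k
  bounded : ∃ K, 0 ≤ K ∧ ∀ s ∈ Set.Icc (-1 : ℝ) 1, |k s| ≤ K

lemma Continuous.isBoundedProfile {k : ℝ → ℝ} (hk : Continuous k) : IsBoundedProfile k := by
  obtain ⟨K, hK⟩ := (isCompact_Icc (a := (-1 : ℝ)) (b := 1)).exists_bound_of_continuousOn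
    hk.continuousOn
  exact ⟨hk.measurable, K, (norm_nonneg _).trans (hK 0 (by norm_num)), hK⟩

lemma isBoundedProfile_indicator_Ioi (η : ℝ) :
    IsBoundedProfile ((Set.Ioi η).indicator fun _ => 1) := by
  refine ⟨measurable_const.indicator measurableSet_Ioi, 1, zero_le_one, fun s _ => ?_⟩
  by_cases h : s ∈ Set.Ioi η <;> simp [h]

lemma IsBoundedProfile.combination {k l : ℝ → ℝ} (hk : IsBoundedProfile k)
    (hl : IsBoundedProfile l) (c e : ℝ) : IsBoundedProfile fun s => c * k s - e * l s := by
  obtain ⟨K, hK0, hK⟩ := hk.bounded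
  obtain ⟨M, hM0, hM⟩ := hl.bounded
  refine ⟨(hk.measurable.const_mul c).sub (hl.measurable.const_mul e), |c| * K + |e| * M,
    by positivity, fun s hs => (abs_sub _ _).trans ?_⟩
  rw [abs_mul, abs_mul]
  gcongr
  exacts [hK s hs, hM s hs]

variable {E : Type*} [NormedAddCommGroup E] [InnerProductSpace ℝ E]
  [MeasurableSpace E] [BorelSpace E]

lemma measurable_inner_left (a : E) : Measurable (fun z : E => inner ℝ a z) :=
  (innerSL ℝ a).continuous.measurable

variable {σ : Measure E} [IsProbabilityMeasure σ]

lemma integrable_zonal_mul (hσsupp : ∀ᵐ z ∂σ, ‖z‖ = 1) {a b : E} (ha : ‖a‖ = 1) (hb : ‖b‖ = 1)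
    {k l : ℝ → ℝ} (hk : IsBoundedProfile k) (hl : IsBoundedProfile l) :
    Integrable (fun z => k (inner ℝ a z) * l (inner ℝ b z)) σ := by
  obtain ⟨K, hK0, hK⟩ := hk.bounded
  obtain ⟨M, hM0, hM⟩ := hl.bounded
  refine Integrable.of_bound ((hk.measurable.comp (measurable_inner_left a)).mul
    (hl.measurable.comp (measurable_inner_left b))).aestronglyMeasurable (K * M) ?_
  filter_upwards [hσsupp] with z hz
  rw [norm_mul]
  exact mul_le_mul (hK _ (inner_mem_Icc ha hz)) (hM _ (inner_mem_Icc hb hz)) (norm_nonneg _) hK0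

lemma integrable_zonal (hσsupp : ∀ᵐ z ∂σ, ‖z‖ = 1) {a : E} (ha : ‖a‖ = 1)
    {k : ℝ → ℝ} (hk : IsBoundedProfile k) : Integrable (fun z => k (inner ℝ a z)) σ := by
  simpa using integrable_zonal_mul hσsupp ha ha hk (continuous_const (y := (1 : ℝ))).isBoundedProfile

/-- Symmetry of the spherical Laplacian on zonal functions. -/
lemma integral_zonal_symm [FiniteDimensional ℝ E] (hσsupp : ∀ᵐ z ∂σ, ‖z‖ = 1)
    (hσinv : ∀ g : E ≃ₗᵢ[ℝ] E, Measure.map g σ = σ) {a b : E} (ha : ‖a‖ = 1) (hb : ‖b‖ = 1)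
    {g g' g'' k : ℝ → ℝ} (hg : IsZonalProfile (σ.map (inner ℝ a)) g g')
    (hg' : IsZonalProfile (σ.map (inner ℝ a)) g' g'') (hk : IsBoundedProfile k)
    (hkg : ∀ᵐ s ∂σ.map (inner ℝ a),
      k s = (1 - s ^ 2) * g'' s - ((Module.finrank ℝ E : ℝ) - 1) * s * g' s) (r : ℝ[X]) :
    ∫ z, k (inner ℝ a z) * r.eval (inner ℝ b z) ∂σ =
      ∫ z, g (inner ℝ a z) *
        (gegenbauerOp ((Module.finrank ℝ E : ℝ) - 1) r).eval (inner ℝ b z) ∂σ := by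
  have h1 := integral_zonal_divergence hσsupp hσinv ha hb hg' (isZonalProfile_eval _ r)
  have h2 := integral_zonal_divergence hσsupp hσinv hb ha (isZonalProfile_eval _ (derivative r)) hg
  have ik := integrable_zonal_mul hσsupp ha hb hk r.continuous.isBoundedProfile
  have ig := integrable_zonal_mul hσsupp ha hb hg.continuous.isBoundedProfile
    (gegenbauerOp ((Module.finrank ℝ E : ℝ) - 1) r).continuous.isBoundedProfile
  have iB : Integrable (fun z => g' (inner ℝ a z) * (derivative r).eval (inner ℝ b z) *
      (inner ℝ a b - inner ℝ a z * inner ℝ b z)) σ := by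
    have i1 := (integrable_zonal_mul hσsupp ha hb hg'.continuous.isBoundedProfile
      (derivative r).continuous.isBoundedProfile).mul_const (inner ℝ a b)
    have i2 := integrable_zonal_mul hσsupp ha hb
      (hg'.continuous.mul continuous_id).isBoundedProfile
      ((derivative r).continuous.mul continuous_id).isBoundedProfile
    refine (i1.sub i2).congr (Filter.Eventually.of_forall fun z => ?_)
    simp only [Pi.sub_apply, Pi.mul_apply, id]
    ring
  have e1 : ∫ z, (k (inner ℝ a z) * r.eval (inner ℝ b z)
      + g' (inner ℝ a z) * (derivative r).eval (inner ℝ b z) *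
      (inner ℝ a b - inner ℝ a z * inner ℝ b z)) ∂σ = 0 := by
    rw [← h1]
    refine integral_congr_ae ?_
    filter_upwards [ae_of_ae_map (measurable_inner_left a).aemeasurable hkg] with z hz
    rw [hz]
  have e2 : ∫ z, (g (inner ℝ a z) *
        (gegenbauerOp ((Module.finrank ℝ E : ℝ) - 1) r).eval (inner ℝ b z)
      + g' (inner ℝ a z) * (derivative r).eval (inner ℝ b z) *
      (inner ℝ a b - inner ℝ a z * inner ℝ b z)) ∂σ = 0 := by
    rw [← h2]
    refine integral_congr_ae (Filter.Eventually.of_forall fun z => ?_)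
    simp only [eval_gegenbauerOp, real_inner_comm a b]
    ring
  rw [integral_add ik iB] at e1
  rw [integral_add ig iB] at e2
  linarith

variable {ι : Type*} [Fintype ι]

/-- The weighted sum of the zonal functions with profile `k` and poles `y i`. -/
def zonalSum (w : ι → ℝ) (y : ι → E) (k : ℝ → ℝ) (z : E) : ℝ := ∑ i, w i * k (inner ℝ (y i) z)

lemma integral_zonalSum_mul (hσsupp : ∀ᵐ z ∂σ, ‖z‖ = 1) (w : ι → ℝ) {y : ι → E}
    (hy : ∀ i, ‖y i‖ = 1) {k l : ℝ → ℝ} (hk : IsBoundedProfile k) (hl : IsBoundedProfile l) :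
    ∫ z, zonalSum w y k z * zonalSum w y l z ∂σ =
      ∑ i, ∑ j, w i * w j * ∫ z, k (inner ℝ (y i) z) * l (inner ℝ (y j) z) ∂σ := by
  have e : ∀ z, zonalSum w y k z * zonalSum w y l z =
      ∑ i, ∑ j, w i * w j * (k (inner ℝ (y i) z) * l (inner ℝ (y j) z)) := by
    intro z
    rw [zonalSum, zonalSum, Finset.sum_mul_sum]
    exact Finset.sum_congr rfl fun i _ => Finset.sum_congr rfl fun j _ => by ring
  have hint : ∀ i j, Integrable
      (fun z => w i * w j * (k (inner ℝ (y i) z) * l (inner ℝ (y j) z))) σ := fun i j =>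
    (integrable_zonal_mul hσsupp (hy i) (hy j) hk hl).const_mul _
  simp only [e]
  rw [integral_finsetSum _ fun i _ => integrable_finsetSum _ fun j _ => hint i j]
  refine Finset.sum_congr rfl fun i _ => ?_
  rw [integral_finsetSum _ fun j _ => hint i j]
  exact Finset.sum_congr rfl fun j _ => integral_const_mul _ _

lemma memLp_zonalSum (hσsupp : ∀ᵐ z ∂σ, ‖z‖ = 1) (w : ι → ℝ) {y : ι → E}
    (hy : ∀ i, ‖y i‖ = 1) {k : ℝ → ℝ} (hk : IsBoundedProfile k) :
    MemLp (zonalSum w y k) 2 σ := by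
  refine memLp_finsetSum _ fun i _ => ?_
  obtain ⟨K, hK0, hK⟩ := hk.bounded
  refine MemLp.const_mul ?_ _
  refine MemLp.of_bound (hk.measurable.comp (measurable_inner_left _)).aestronglyMeasurable K ?_
  filter_upwards [hσsupp] with z hz using hK _ (inner_mem_Icc (hy i) hz)

/-- The class in `L²` of the zonal sum of a polynomial, as a linear map. -/
noncomputable def zonalSumLp (hσsupp : ∀ᵐ z ∂σ, ‖z‖ = 1) (w : ι → ℝ) {y : ι → E}
    (hy : ∀ i, ‖y i‖ = 1) : ℝ[X] →ₗ[ℝ] Lp ℝ 2 σ where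
  toFun r := (memLp_zonalSum hσsupp w hy r.continuous.isBoundedProfile).toLp _
  map_add' r q := by
    rw [← MemLp.toLp_add]
    refine MemLp.toLp_congr _ _ (Filter.Eventually.of_forall fun z => ?_)
    simp [zonalSum, mul_add, Finset.sum_add_distrib]
  map_smul' c r := by
    rw [RingHom.id_apply, ← MemLp.toLp_const_smul]
    refine MemLp.toLp_congr _ _ (Filter.Eventually.of_forall fun z => ?_)
    simp only [zonalSum, eval_smul, smul_eq_mul, Pi.smul_apply, Finset.mul_sum]
    exact Finset.sum_congr rfl fun i _ => by ring

lemma zonalSumLp_eq_zero (hσsupp : ∀ᵐ z ∂σ, ‖z‖ = 1) (w : ι → ℝ) {y : ι → E}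
    (hy : ∀ i, ‖y i‖ = 1) {r : ℝ[X]}
    (hr : ∀ z, ‖z‖ = 1 → ∑ i, w i * r.eval (inner ℝ (y i) z) = 0) :
    zonalSumLp hσsupp w hy r = 0 := by
  rw [← MemLp.toLp_zero (MemLp.zero' (p := 2) (μ := σ) (ε := ℝ))]
  refine MemLp.toLp_congr (memLp_zonalSum hσsupp w hy r.continuous.isBoundedProfile) _ ?_
  filter_upwards [hσsupp] with z hz using hr z hz

lemma inner_toLp_zonalSumLp (hσsupp : ∀ᵐ z ∂σ, ‖z‖ = 1) (w : ι → ℝ) {y : ι → E}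
    (hy : ∀ i, ‖y i‖ = 1) {k : ℝ → ℝ} (hk : IsBoundedProfile k) (r : ℝ[X]) :
    inner ℝ ((memLp_zonalSum hσsupp w hy hk).toLp _) (zonalSumLp hσsupp w hy r) =
      ∑ i, ∑ j, w i * w j * ∫ z, k (inner ℝ (y i) z) * r.eval (inner ℝ (y j) z) ∂σ :=
  (inner_toLp_toLp (memLp_zonalSum hσsupp w hy hk)
    (memLp_zonalSum hσsupp w hy r.continuous.isBoundedProfile)).trans
    (integral_zonalSum_mul hσsupp w hy hk r.continuous.isBoundedProfile)

lemma toLp_zonalSum_mem_closure (hσsupp : ∀ᵐ z ∂σ, ‖z‖ = 1) {w : ι → ℝ} (hw : ∀ i, 0 ≤ w i)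
    (hw1 : ∑ i, w i = 1) {y : ι → E} (hy : ∀ i, ‖y i‖ = 1) {k : ℝ → ℝ} (hk : Continuous k) :
    (memLp_zonalSum hσsupp w hy hk.isBoundedProfile).toLp _ ∈
      closure (Set.range (zonalSumLp hσsupp w hy)) := by
  refine Metric.mem_closure_iff.2 fun ε hε => ?_
  obtain ⟨r, hr⟩ := exists_polynomial_near_of_continuousOn (-1) 1 k hk.continuousOn (ε / 2)
    (by positivity)
  refine ⟨_, ⟨r, rfl⟩, ?_⟩
  rw [dist_eq_norm]
  refine lt_of_le_of_lt (Lp.norm_le_of_ae_bound (C := ε / 2) (by positivity) ?_)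
    (by simpa [measureUnivNNReal] using half_lt_self hε)
  filter_upwards [hσsupp, Lp.coeFn_sub ((memLp_zonalSum hσsupp w hy hk.isBoundedProfile).toLp _)
    (zonalSumLp hσsupp w hy r), (memLp_zonalSum hσsupp w hy hk.isBoundedProfile).coeFn_toLp,
    (memLp_zonalSum hσsupp w hy r.continuous.isBoundedProfile).coeFn_toLp] with z hz h1 h2 h3
  rw [h1, Pi.sub_apply, h2]
  change ‖_ - ((memLp_zonalSum hσsupp w hy r.continuous.isBoundedProfile).toLp _ : E → ℝ) z‖ ≤ _
  rw [h3, zonalSum, zonalSum, ← Finset.sum_sub_distrib]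
  refine (norm_sum_le _ _).trans ?_
  calc ∑ i, ‖w i * k (inner ℝ (y i) z) - w i * r.eval (inner ℝ (y i) z)‖
      ≤ ∑ i, w i * (ε / 2) := by
        refine Finset.sum_le_sum fun i _ => ?_
        rw [← mul_sub, norm_mul, Real.norm_of_nonneg (hw i), norm_sub_rev]
        exact mul_le_mul_of_nonneg_left (hr _ (inner_mem_Icc (hy i) hz)).le (hw i)
    _ = ε / 2 := by rw [← Finset.sum_mul, hw1, one_mul]

lemma toLp_zonalSum_mem_closure_span (hσsupp : ∀ᵐ z ∂σ, ‖z‖ = 1) {w : ι → ℝ} (hw : ∀ i, 0 ≤ w i)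
    (hw1 : ∑ i, w i = 1) {y : ι → E} (hy : ∀ i, ‖y i‖ = 1) {k : ℝ → ℝ} (hk : Continuous k)
    {P : ℕ → ℝ[X]} (hP : ∀ k, (P k).Monic) (hPdeg : ∀ k, (P k).natDegree = k) :
    (memLp_zonalSum hσsupp w hy hk.isBoundedProfile).toLp _ ∈
      closure (Submodule.span ℝ (Set.range fun k => zonalSumLp hσsupp w hy (P k)) :
        Set (Lp ℝ 2 σ)) := by
  let S : Polynomial.Sequence ℝ :=
    ⟨P, fun k => by rw [degree_eq_natDegree (hP k).ne_zero, hPdeg]⟩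
  have hS : Submodule.span ℝ (Set.range P) = ⊤ := S.span fun k => by
    rw [show S k = P k from rfl, (hP k).leadingCoeff]; exact isUnit_one
  refine closure_mono ?_ (toLp_zonalSum_mem_closure hσsupp hw hw1 hy hk)
  rintro _ ⟨r, rfl⟩
  have hr : r ∈ Submodule.span ℝ (Set.range P) := hS ▸ Submodule.mem_top
  have h := Submodule.mem_map_of_mem (f := zonalSumLp hσsupp w hy) hr
  rw [Submodule.map_span, ← Set.range_comp] at h
  exact h

end Core

section TruncatedProfile

lemma isZonalProfile_eval_max {μ : Measure ℝ} (r : ℝ[X]) {η : ℝ} (hμ : μ {η} = 0) :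
    IsZonalProfile μ (fun s => r.eval (max s η))
      ((Set.Ioi η).indicator fun s => r.derivative.eval s) where
  continuous := r.continuous.comp (continuous_id.max continuous_const)
  lipschitz := by
    obtain ⟨C, hC⟩ := (isCompact_Icc (a := (-1 : ℝ)) (b := max 1 η)).exists_bound_of_continuousOn
      r.derivative.continuous.continuousOn
    have hC0 : 0 ≤ C := (norm_nonneg _).trans (hC (-1) ⟨le_rfl, by simp⟩)
    refine ⟨C, fun s hs t ht => ?_⟩
    have hmem : ∀ s ∈ Set.Icc (-1 : ℝ) 1, max s η ∈ Set.Icc (-1 : ℝ) (max 1 η) := fun s hs =>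
      ⟨hs.1.trans (le_max_left _ _), max_le_max_right η hs.2⟩
    have h := (convex_Icc (-1 : ℝ) (max 1 η)).norm_image_sub_le_of_norm_hasDerivWithin_le
      (fun s _ => (r.hasDerivAt s).hasDerivWithinAt) hC (hmem t ht) (hmem s hs)
    refine h.trans (mul_le_mul_of_nonneg_left ?_ hC0)
    exact abs_max_sub_max_le_abs s t η
  measurable := r.derivative.continuous.measurable.indicator measurableSet_Ioi
  hasDerivAt := by
    have hne : ∀ᵐ s ∂μ, s ≠ η := measure_eq_zero_iff_ae_notMem.1 hμ
    filter_upwards [hne] with s hs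
    rcases lt_or_gt_of_ne hs with h | h
    · rw [Set.indicator_of_notMem (by simpa using h.le)]
      refine (hasDerivAt_const s (r.eval η)).congr_of_eventuallyEq ?_
      filter_upwards [Iio_mem_nhds h] with t ht
      rw [max_eq_right (le_of_lt ht)]
    · rw [Set.indicator_of_mem (Set.mem_Ioi.2 h)]
      refine (r.hasDerivAt s).congr_of_eventuallyEq ?_
      filter_upwards [Ioi_mem_nhds h] with t ht
      rw [max_eq_left (le_of_lt ht)]

lemma isZonalProfile_eval_max_of_root {μ : Measure ℝ} (r : ℝ[X]) {η : ℝ} (hμ : μ {η} = 0)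
    (hr : r.derivative.eval η = 0) :
    IsZonalProfile μ (fun s => r.eval (max s η)) (fun s => r.derivative.eval (max s η)) := by
  convert isZonalProfile_eval_max r hμ using 1
  ext s
  rcases le_or_gt s η with h | h
  · rw [Set.indicator_of_notMem (by simpa using h), max_eq_right h, hr]
  · rw [Set.indicator_of_mem (by exact h), max_eq_left h.le]

end TruncatedProfile

section DesignBound

variable {E : Type*} [NormedAddCommGroup E] [InnerProductSpace ℝ E] [FiniteDimensional ℝ E]
  [MeasurableSpace E] [BorelSpace E] {σ : Measure E} [IsProbabilityMeasure σ]

lemma integral_zonal_eigen_symm (hσsupp : ∀ᵐ z ∂σ, ‖z‖ = 1)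
    (hσinv : ∀ g : E ≃ₗᵢ[ℝ] E, Measure.map g σ = σ) {a b : E} (ha : ‖a‖ = 1) (hb : ‖b‖ = 1)
    {q r : ℝ[X]} {κ τ : ℝ} (hq : gegenbauerOp ((Module.finrank ℝ E : ℝ) - 1) q = -C κ * q)
    (hr : gegenbauerOp ((Module.finrank ℝ E : ℝ) - 1) r = -C τ * r) :
    κ * ∫ z, q.eval (inner ℝ a z) * r.eval (inner ℝ b z) ∂σ =
      τ * ∫ z, q.eval (inner ℝ a z) * r.eval (inner ℝ b z) ∂σ := by
  have h := integral_zonal_symm hσsupp hσinv ha hb (isZonalProfile_eval _ q)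
    (isZonalProfile_eval _ (derivative q))
    (gegenbauerOp ((Module.finrank ℝ E : ℝ) - 1) q).continuous.isBoundedProfile
    (Filter.Eventually.of_forall fun s => eval_gegenbauerOp _ q s) r
  rw [← neg_inj, ← neg_mul, ← neg_mul, ← integral_const_mul, ← integral_const_mul]
  refine Eq.trans (congrArg _ (funext fun z => ?_)) (h.trans (congrArg _ (funext fun z => ?_)))
  · simp only [hq, eval_mul, eval_neg, eval_C]
    ring
  · simp only [hr, eval_mul, eval_neg, eval_C]
    ring

lemma integral_zonal_eigen_eq_zero (hσsupp : ∀ᵐ z ∂σ, ‖z‖ = 1)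
    (hσinv : ∀ g : E ≃ₗᵢ[ℝ] E, Measure.map g σ = σ) {a : E} (ha : ‖a‖ = 1)
    {q : ℝ[X]} {κ : ℝ} (hκ : κ ≠ 0)
    (hq : gegenbauerOp ((Module.finrank ℝ E : ℝ) - 1) q = -C κ * q) :
    ∫ z, q.eval (inner ℝ a z) ∂σ = 0 := by
  have h := integral_zonal_eigen_symm hσsupp hσinv ha ha (τ := 0) hq
    (r := 1) (by simp [gegenbauerOp])
  simpa [hκ] using h

/-- The indicator of a cap and the truncation of `P` at the height of this cap are related by
the Gegenbauer operator. -/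
lemma integral_cap_zonal (hσsupp : ∀ᵐ z ∂σ, ‖z‖ = 1)
    (hσinv : ∀ g : E ≃ₗᵢ[ℝ] E, Measure.map g σ = σ) {a b : E} (ha : ‖a‖ = 1) (hb : ‖b‖ = 1)
    {η : ℝ} (h0 : σ.map (inner ℝ a) {η} = 0) {P : ℝ[X]} {c κ : ℝ} (hPη : P.eval η = 0)
    (hP'η : P.derivative.eval η = 0)
    (hP : gegenbauerOp ((Module.finrank ℝ E : ℝ) - 1) P + C κ * P = C c) {r : ℝ[X]} {τ : ℝ}
    (hr : gegenbauerOp ((Module.finrank ℝ E : ℝ) - 1) r = -C τ * r) :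
    c * ∫ z, (Set.Ioi η).indicator (fun _ => 1) (inner ℝ a z) * r.eval (inner ℝ b z) ∂σ =
      (κ - τ) * ∫ z, P.eval (max (inner ℝ a z) η) * r.eval (inner ℝ b z) ∂σ := by
  set χ : ℝ → ℝ := (Set.Ioi η).indicator fun _ => 1 with hχ
  set u : ℝ → ℝ := fun s => P.eval (max s η) with hu
  have huB : IsBoundedProfile u :=
    (P.continuous.comp (continuous_id.max continuous_const)).isBoundedProfile
  have hχB : IsBoundedProfile χ := isBoundedProfile_indicator_Ioi η
  have h := integral_zonal_symm hσsupp hσinv ha hb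
    (isZonalProfile_eval_max_of_root P h0 hP'η) (isZonalProfile_eval_max P.derivative h0)
    (hχB.combination huB c κ) (Filter.Eventually.of_forall fun s => by
      have hPs := congrArg (eval s) hP
      rw [eval_add, eval_gegenbauerOp, eval_mul, eval_C, eval_C] at hPs
      rcases le_or_gt s η with h | h
      · simp [hχ, hu, h.not_gt, max_eq_right h, hP'η, hPη]
      · simp only [hχ, hu, Set.mem_Ioi, h, Set.indicator_of_mem, max_eq_left h.le, mul_one]
        linarith) r
  have hiχ := integrable_zonal_mul hσsupp ha hb hχB r.continuous.isBoundedProfile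
  have hiu := integrable_zonal_mul hσsupp ha hb huB r.continuous.isBoundedProfile
  have e1 : ∫ z, (c * χ (inner ℝ a z) - κ * u (inner ℝ a z)) * r.eval (inner ℝ b z) ∂σ =
      c * ∫ z, χ (inner ℝ a z) * r.eval (inner ℝ b z) ∂σ
        - κ * ∫ z, u (inner ℝ a z) * r.eval (inner ℝ b z) ∂σ := by
    rw [← integral_const_mul, ← integral_const_mul,
      ← integral_sub (hiχ.const_mul _) (hiu.const_mul _)]
    exact congrArg _ (funext fun z => by ring)
  have e2 : ∫ z, u (inner ℝ a z) *
      (gegenbauerOp ((Module.finrank ℝ E : ℝ) - 1) r).eval (inner ℝ b z) ∂σ =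
      -τ * ∫ z, u (inner ℝ a z) * r.eval (inner ℝ b z) ∂σ := by
    rw [← integral_const_mul]
    refine congrArg _ (funext fun z => ?_)
    simp only [hr, eval_mul, eval_neg, eval_C]
    ring
  have h' := e1.symm.trans (h.trans e2)
  linarith

variable {ι : Type*} [Fintype ι]

/-- A weighted spherical design whose strength exceeds the degree of `P'` cannot have large
weights: their squares sum to at most the measure of the cap of height `η`. -/
lemma sum_sq_le_of_design (hσsupp : ∀ᵐ z ∂σ, ‖z‖ = 1)
    (hσinv : ∀ g : E ≃ₗᵢ[ℝ] E, Measure.map g σ = σ) (hE : 2 ≤ Module.finrank ℝ E)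
    {w : ι → ℝ} (hw : ∀ i, 0 ≤ w i) {y : ι → E} (hy : ∀ i, ‖y i‖ = 1) {ν : Measure ℝ}
    (hν : ∀ a : E, ‖a‖ = 1 → σ.map (inner ℝ a) = ν) {η : ℝ} (hν0 : ν {η} = 0)
    (hνpos : 0 < ν.real (Set.Ioi η)) {p : ℕ}
    (hdesign : ∀ r : ℝ[X], r.natDegree ≤ p + 1 → ∀ z : E, ‖z‖ = 1 →
      ∑ i, w i * r.eval (inner ℝ (y i) z) = ∫ s, r.eval s ∂ν)
    {P : ℝ[X]} {c : ℝ} (hPη : P.eval η = 0) (hP'η : P.derivative.eval η = 0)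
    (hP'pos : ∀ s > η, 0 < P.derivative.eval s)
    (hP : gegenbauerOp ((Module.finrank ℝ E : ℝ) - 1) P +
      C (((p + 2 : ℕ) : ℝ) * ((p + 2 : ℕ) + ((Module.finrank ℝ E : ℝ) - 1) - 1)) * P = C c) :
    ∑ i, w i ^ 2 ≤ ν.real (Set.Ioi η) := by
  set d : ℝ := (Module.finrank ℝ E : ℝ) - 1 with hd
  have hd1 : 1 ≤ d := by
    have : (2 : ℝ) ≤ (Module.finrank ℝ E : ℝ) := by exact_mod_cast hE
    linarith
  set ev : ℕ → ℝ := fun k => (k : ℝ) * (k + d - 1) with hev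
  have hevmono : StrictMono ev := fun j k hjk =>
    gegenbauer_eigenvalue_strictMono (by linarith) hjk
  have hev0 : ev 0 = 0 := by simp [hev]
  set χ : ℝ → ℝ := (Set.Ioi η).indicator fun _ => 1 with hχ
  set u : ℝ → ℝ := fun s => P.eval (max s η) with hu
  have hucont : Continuous u := P.continuous.comp (continuous_id.max continuous_const)
  have huB : IsBoundedProfile u := hucont.isBoundedProfile
  have hχB : IsBoundedProfile χ := isBoundedProfile_indicator_Ioi η
  have humono : StrictMonoOn (fun s => P.eval s) (Set.Ici η) := by
    refine strictMonoOn_of_deriv_pos (convex_Ici η) P.continuous.continuousOn fun s hs => ?_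
    rw [interior_Ici] at hs
    rw [Polynomial.deriv]
    exact hP'pos s hs
  have hupos : ∀ s > η, 0 < u s := fun s hs => by
    have h := humono Set.self_mem_Ici (Set.mem_Ici.2 hs.le) hs
    simpa [hu, max_eq_left hs.le, hPη] using h
  have huzero : ∀ s ≤ η, u s = 0 := fun s hs => by simp [hu, max_eq_right hs, hPη]
  have hunn : ∀ s, 0 ≤ u s := fun s =>
    (le_or_gt s η).elim (fun h => (huzero s h).ge) fun h => (hupos s h).le
  have hχnn : ∀ s, 0 ≤ χ s := fun s => Set.indicator_nonneg (fun _ _ => zero_le_one) s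
  have huχ : ∀ s, u s * χ s = u s := fun s => by
    rcases le_or_gt s η with h | h
    · simp [huzero s h]
    · simp [hχ, h]
  have hkernel : ∀ a b : E, ‖a‖ = 1 → ‖b‖ = 1 → ∀ (r : ℝ[X]) (τ : ℝ),
      gegenbauerOp d r = -C τ * r →
      c * ∫ z, χ (inner ℝ a z) * r.eval (inner ℝ b z) ∂σ =
        (ev (p + 2) - τ) * ∫ z, u (inner ℝ a z) * r.eval (inner ℝ b z) ∂σ :=
    fun a b ha hb r τ hr => integral_cap_zonal hσsupp hσinv ha hb (hν a ha ▸ hν0) hPη hP'η hP hr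
  -- means of the profiles
  set u₀ := ∫ s, u s ∂ν with hu₀
  have hmean : ∀ (f : ℝ → ℝ), Measurable f → ∀ a : E, ‖a‖ = 1 →
      ∫ z, f (inner ℝ a z) ∂σ = ∫ s, f s ∂ν := by
    intro f hf a ha
    rw [← hν a ha, integral_map (measurable_inner_left a).aemeasurable hf.aestronglyMeasurable]
  have hχ₀ : ∫ s, χ s ∂ν = ν.real (Set.Ioi η) := by
    exact integral_indicator_one measurableSet_Ioi
  have : Nontrivial E := Module.nontrivial_of_finrank_pos (R := ℝ) (by omega)
  obtain ⟨a, ha⟩ := exists_norm_eq E zero_le_one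
  have : IsProbabilityMeasure ν := hν a ha ▸
    Measure.isProbabilityMeasure_map (measurable_inner_left a).aemeasurable
  have hw1 : ∑ i, w i = 1 := by simpa using hdesign 1 (by simp) a ha
  have hu₀pos : 0 < u₀ := by
    have hint : Integrable u ν := by
      rw [← hν a ha]
      exact (integrable_map_measure hucont.measurable.aestronglyMeasurable
        (measurable_inner_left a).aemeasurable).2 (integrable_zonal hσsupp ha huB)
    rw [hu₀, integral_pos_iff_support_of_nonneg hunn hint]
    have hsupp : Function.support u = Set.Ioi η := by
      ext s
      rcases le_or_gt s η with h | h
      · simp [huzero s h, h]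
      · simp [(hupos s h).ne', h]
    rw [hsupp]
    exact (ENNReal.toReal_pos_iff.1 hνpos).1
  have hc : 0 < c := by
    have h := hkernel a a ha ha 1 0 (by simp [gegenbauerOp])
    simp only [eval_one, mul_one, sub_zero] at h
    rw [hmean χ hχB.measurable a ha, hmean u huB.measurable a ha, hχ₀] at h
    have hev2 : 0 < ev (p + 2) := hev0 ▸ hevmono (by omega : 0 < p + 2)
    exact pos_of_mul_pos_left (h ▸ mul_pos hev2 hu₀pos) hνpos.le
  -- expansion along the Gegenbauer polynomials
  choose G hGmonic hGdeg hG using fun k : ℕ => exists_gegenbauer (by linarith : 0 < d) k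
  set v : ℕ → Lp ℝ 2 σ := fun k => zonalSumLp hσsupp w hy (G k) with hv
  set U := (memLp_zonalSum hσsupp w hy huB).toLp _ with hU
  set V := (memLp_zonalSum hσsupp w hy hχB).toLp _ with hV
  have hG0 : G 0 = 1 := (hGmonic 0).natDegree_eq_zero.1 (hGdeg 0)
  have hww : ∑ i, ∑ j, w i * w j = 1 := by rw [← Finset.sum_mul_sum, hw1, one_mul]
  have hinner0 : ∀ (k : ℝ → ℝ) (hk : IsBoundedProfile k),
      inner ℝ ((memLp_zonalSum hσsupp w hy hk).toLp _) (v 0) = ∫ s, k s ∂ν := by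
    intro k hk
    rw [hv, inner_toLp_zonalSumLp hσsupp w hy hk, hG0]
    simp only [eval_one, mul_one, hmean k hk.measurable _ (hy _)]
    simp only [← Finset.sum_mul]
    rw [hww, one_mul]
  have hvv : ∀ j k, inner ℝ (v j) (v k) = ∑ i, ∑ l, w i * w l *
      ∫ z, (G j).eval (inner ℝ (y i) z) * (G k).eval (inner ℝ (y l) z) ∂σ := fun j k =>
    inner_toLp_zonalSumLp hσsupp w hy (G j).continuous.isBoundedProfile (G k)
  have horth : ∀ j k, j ≠ k → inner ℝ (v j) (v k) = 0 := by
    intro j k hjk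
    rw [hvv]
    refine Finset.sum_eq_zero fun i _ => Finset.sum_eq_zero fun l _ => ?_
    have h := integral_zonal_eigen_symm hσsupp hσinv (hy i) (hy l) (hG j) (hG k)
    have h2 : (ev j - ev k) * ∫ z, (G j).eval (inner ℝ (y i) z) *
        (G k).eval (inner ℝ (y l) z) ∂σ = 0 := by rw [sub_mul]; exact sub_eq_zero.2 h
    rw [(mul_eq_zero.1 h2).resolve_left (sub_ne_zero.2 (hevmono.injective.ne hjk)), mul_zero]
  have hnorm : ‖v 0‖ = 1 := by
    have h : ‖v 0‖ ^ 2 = 1 := by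
      rw [← real_inner_self_eq_norm_sq, hvv, hG0]
      simpa using hww
    nlinarith [norm_nonneg (v 0)]
  have hvzero : ∀ k, 1 ≤ k → k ≤ p + 1 → v k = 0 := by
    intro k hk1 hkp
    have hκ : ev k ≠ 0 := (hev0 ▸ hevmono (by omega : 0 < k)).ne'
    have h0 := integral_zonal_eigen_eq_zero hσsupp hσinv ha hκ (hG k)
    rw [hmean _ (G k).continuous.measurable a ha] at h0
    refine zonalSumLp_eq_zero hσsupp w hy fun z hz => ?_
    rw [hdesign (G k) ((hGdeg k).trans_le hkp) z hz, h0]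
  have hUV : ∀ k, k ≠ 0 → inner ℝ U (v k) * inner ℝ V (v k) ≤ 0 := by
    intro k hk
    rcases le_or_gt k (p + 1) with hkp | hkp
    · rw [hvzero k (by omega) hkp]; simp
    · have hrel : c * inner ℝ V (v k) = (ev (p + 2) - ev k) * inner ℝ U (v k) := by
        rw [hV, hU, hv, inner_toLp_zonalSumLp hσsupp w hy hχB,
          inner_toLp_zonalSumLp hσsupp w hy huB, Finset.mul_sum, Finset.mul_sum]
        refine Finset.sum_congr rfl fun i _ => ?_
        rw [Finset.mul_sum, Finset.mul_sum]
        refine Finset.sum_congr rfl fun j _ => ?_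
        rw [mul_left_comm, hkernel (y i) (y j) (hy i) (hy j) (G k) (ev k) (hG k)]
        ring
      have hle : ev (p + 2) ≤ ev k := hevmono.monotone hkp
      refine nonpos_of_mul_nonpos_right (a := c) ?_ hc
      rw [mul_left_comm, hrel]
      nlinarith [sq_nonneg (inner ℝ U (v k))]
  have hupper : inner ℝ U V ≤ u₀ * ν.real (Set.Ioi η) := by
    have h := inner_le_of_orthogonal_sequence horth hnorm
      (toLp_zonalSum_mem_closure_span hσsupp hw hw1 hy hucont hGmonic hGdeg) hUV
    rwa [hinner0 u huB, hV, hinner0 χ hχB, hχ₀] at h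
  have hlower : u₀ * ∑ i, w i ^ 2 ≤ inner ℝ U V := by
    rw [hU, hV, inner_toLp_toLp, integral_zonalSum_mul hσsupp w hy huB hχB, Finset.mul_sum]
    refine Finset.sum_le_sum fun i _ => ?_
    have h := Finset.single_le_sum (s := Finset.univ) (f := fun j => w i * w j *
      ∫ z, u (inner ℝ (y i) z) * χ (inner ℝ (y j) z) ∂σ) (fun j _ =>
        mul_nonneg (mul_nonneg (hw i) (hw j))
          (integral_nonneg fun z => mul_nonneg (hunn _) (hχnn _))) (Finset.mem_univ i)
    refine le_trans (le_of_eq ?_) h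
    simp only [huχ]
    rw [hmean u huB.measurable _ (hy i)]
    ring
  exact le_of_mul_le_mul_left (hlower.trans hupper) hu₀pos

end DesignBound

section GegenbauerLaw

lemma gegenbauerMeasure_real_Ioi {α η : ℝ} (hη : -1 ≤ η) (hη1 : η ≤ 1) :
    (gegenbauerMeasure α).real (Set.Ioi η) = ∫ s in η..1, (1 - s ^ 2) ^ α := by
  rw [← integral_indicator_one measurableSet_Ioi, integral_gegenbauerMeasure,
    intervalIntegral.integral_of_le (by norm_num), intervalIntegral.integral_of_le hη1]
  have e : (fun s : ℝ => (Set.Ioi η).indicator 1 s * (1 - s ^ 2) ^ α) =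
      (Set.Ioi η).indicator fun s => (1 - s ^ 2) ^ α := by
    ext s
    by_cases h : s ∈ Set.Ioi η <;> simp [h]
  rw [e, setIntegral_indicator measurableSet_Ioi, Set.Ioc_inter_Ioi, max_eq_right hη]

lemma gegenbauerMeasure_real_univ {α : ℝ} (hα : -(1 / 2) ≤ α) :
    (gegenbauerMeasure α).real Set.univ = 2 * ∫ s in (0 : ℝ)..1, (1 - s ^ 2) ^ α := by
  have hint : IntervalIntegrable (fun s : ℝ => (1 - s ^ 2) ^ α) volume (-1) 1 := by
    simpa using intervalIntegrable_eval_mul_one_sub_sq_rpow hα 1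
  have hneg : ∫ s in (-1 : ℝ)..0, (1 - s ^ 2) ^ α = ∫ s in (0 : ℝ)..1, (1 - s ^ 2) ^ α := by
    have h := intervalIntegral.integral_comp_neg (a := 0) (b := 1)
      fun s : ℝ => (1 - s ^ (2 : ℕ)) ^ α
    simp only [neg_sq, neg_zero] at h
    exact h.symm
  have h := integral_gegenbauerMeasure α fun _ => 1
  simp only [one_mul] at h
  rw [integral_const, smul_eq_mul, mul_one] at h
  rw [h, ← intervalIntegral.integral_add_adjacent_intervals (b := 0)
    (hint.mono_set (Set.uIcc_subset_uIcc_left (by norm_num [Set.mem_uIcc])))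
    (hint.mono_set (Set.uIcc_subset_uIcc_right (by norm_num [Set.mem_uIcc]))), hneg, two_mul]

lemma integral_one_sub_sq_rpow_pos {α η : ℝ} (hα : -(1 / 2) ≤ α) (hη : -1 ≤ η) (hη1 : η < 1) :
    0 < ∫ s in η..1, (1 - s ^ 2) ^ α := by
  have hint : IntervalIntegrable (fun s : ℝ => (1 - s ^ 2) ^ α) volume (-1) 1 := by
    simpa using intervalIntegrable_eval_mul_one_sub_sq_rpow hα 1
  refine intervalIntegral.intervalIntegral_pos_of_pos_on
    (hint.mono_set (Set.uIcc_subset_uIcc_right (Set.mem_uIcc.2 (Or.inl ⟨hη, hη1.le⟩))))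
    (fun s hs => Real.rpow_pos_of_pos ?_ α) hη1
  nlinarith [hs.1, hs.2]

end GegenbauerLaw

section Cubature

lemma exists_smul_pos_of_forall_root_le {Q : ℝ[X]} {η : ℝ}
    (hηmax : ∀ s : ℝ, Q.eval s = 0 → s ≤ η) :
    ∃ c : ℝ, c ≠ 0 ∧ ∀ s > η, 0 < (C c * Q).eval s := by
  have hne : ∀ s > η, Q.eval s ≠ 0 := fun s hs h0 => (hηmax s h0).not_gt hs
  refine ⟨Q.eval (η + 1), hne _ (by simp), fun s hs => ?_⟩
  rw [eval_mul, eval_C]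
  by_contra hle
  have hmem : (0 : ℝ) ∈ Set.uIcc (Q.eval (η + 1)) (Q.eval s) := by
    rw [Set.mem_uIcc]
    rcases mul_nonpos_iff.1 (not_lt.1 hle) with h | h
    · exact Or.inr h.symm
    · exact Or.inl h
  obtain ⟨t, ht, ht0⟩ := intermediate_value_uIcc Q.continuous.continuousOn hmem
  refine hne t ?_ ht0
  exact lt_of_lt_of_le (lt_min (by simp) hs) ht.1

variable {m p n : ℕ} {σ : Measure (EuclideanSpace ℝ (Fin m))}
  {x : Fin n → EuclideanSpace ℝ (Fin m)} {ρ : Fin n → ℝ}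

lemma integral_inner_pow_of_cubature (hσsupp : ∀ᵐ z ∂σ, ‖z‖ = 1) (hx : ∀ i, ‖x i‖ = 1)
    (hcub : ∀ ψ : MvPolynomial (Fin m) ℝ, ψ.IsHomogeneous p →
      ∫ z, MvPolynomial.eval (fun k => z k) ψ ∂σ
        = ∑ i, ρ i * MvPolynomial.eval (fun k => x i k) ψ)
    (a : EuclideanSpace ℝ (Fin m)) (j l : ℕ) (hjl : j + 2 * l = p) :
    ∫ z, inner ℝ a z ^ j ∂σ = ∑ i, ρ i * inner ℝ a (x i) ^ j := by
  set ψ : MvPolynomial (Fin m) ℝ := (∑ k, MvPolynomial.C (a k) * MvPolynomial.X k) ^ j *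
    (∑ k, MvPolynomial.X k ^ 2) ^ l with hψ
  have hhom : ψ.IsHomogeneous p := by
    have h1 : (∑ k, MvPolynomial.C (a k) * MvPolynomial.X k :
        MvPolynomial (Fin m) ℝ).IsHomogeneous 1 :=
      MvPolynomial.IsHomogeneous.sum _ _ _ fun k _ => MvPolynomial.isHomogeneous_C_mul_X _ _
    have h2 : (∑ k, MvPolynomial.X k ^ 2 : MvPolynomial (Fin m) ℝ).IsHomogeneous 2 :=
      MvPolynomial.IsHomogeneous.sum _ _ _ fun k _ => MvPolynomial.isHomogeneous_X_pow _ _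
    have h := (h1.pow j).mul (h2.pow l)
    rwa [one_mul, hjl] at h
  have heval : ∀ z : EuclideanSpace ℝ (Fin m), ‖z‖ = 1 →
      MvPolynomial.eval (fun k => z k) ψ = inner ℝ a z ^ j := by
    intro z hz
    have h1 : ∑ k, a k * z k = inner ℝ a z := by
      simp [PiLp.inner_apply, mul_comm]
    have h2 : ∑ k, z k ^ 2 = 1 := by
      rw [← EuclideanSpace.real_norm_sq_eq, hz, one_pow]
    simp [hψ, h1, h2]
  have h := hcub ψ hhom
  simp only [heval _ (hx _)] at h
  rw [← h]
  refine integral_congr_ae ?_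
  filter_upwards [hσsupp] with z hz using (heval z hz).symm

lemma integral_inner_pow_of_odd
    (hσinv : ∀ g : EuclideanSpace ℝ (Fin m) ≃ₗᵢ[ℝ] EuclideanSpace ℝ (Fin m),
      Measure.map g σ = σ) (a : EuclideanSpace ℝ (Fin m)) {j : ℕ} (hj : Odd j) :
    ∫ z, inner ℝ a z ^ j ∂σ = 0 := by
  have h : ∫ z, inner ℝ a z ^ j ∂σ = -∫ z, inner ℝ a z ^ j ∂σ := by
    conv_lhs => rw [← hσinv (LinearIsometryEquiv.neg ℝ)]
    rw [integral_map (LinearIsometryEquiv.neg ℝ).continuous.aemeasurable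
      ((measurable_inner_left a).pow_const j).aestronglyMeasurable, ← integral_neg]
    simp [inner_neg_right, hj.neg_pow]
  linarith

/-- The points of a projective cubature formula and their antipodes. -/
def antipodalPoints {ι V : Type*} [Neg V] (x : ι → V) (i : ι × Bool) : V :=
  if i.2 then x i.1 else -x i.1

lemma sum_antipodal_eval_of_cubature [IsProbabilityMeasure σ] (hpe : Even p)
    (hσsupp : ∀ᵐ z ∂σ, ‖z‖ = 1)
    (hσinv : ∀ g : EuclideanSpace ℝ (Fin m) ≃ₗᵢ[ℝ] EuclideanSpace ℝ (Fin m),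
      Measure.map g σ = σ) (hx : ∀ i, ‖x i‖ = 1)
    (hcub : ∀ ψ : MvPolynomial (Fin m) ℝ, ψ.IsHomogeneous p →
      ∫ z, MvPolynomial.eval (fun k => z k) ψ ∂σ
        = ∑ i, ρ i * MvPolynomial.eval (fun k => x i k) ψ)
    {r : ℝ[X]} (hr : r.natDegree ≤ p + 1) {a : EuclideanSpace ℝ (Fin m)} (ha : ‖a‖ = 1) :
    ∑ i : Fin n × Bool, ρ i.1 / 2 * r.eval (inner ℝ (antipodalPoints x i) a) =
      ∫ z, r.eval (inner ℝ a z) ∂σ := by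
  have hmono : ∀ j ∈ Finset.range (p + 2),
      ∑ i : Fin n × Bool, ρ i.1 / 2 * inner ℝ (antipodalPoints x i) a ^ j =
        ∫ z, inner ℝ a z ^ j ∂σ := by
    intro j hj
    have hj' := Finset.mem_range.1 hj
    rw [Fintype.sum_prod_type]
    simp only [Fintype.sum_bool, antipodalPoints, if_true, Bool.false_eq_true, if_false,
      real_inner_comm a, inner_neg_right]
    rcases Nat.even_or_odd j with he | ho
    · obtain ⟨q, hq⟩ := hpe
      obtain ⟨t, ht⟩ := he
      rw [integral_inner_pow_of_cubature hσsupp hx hcub a j (q - t) (by omega)]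
      refine Finset.sum_congr rfl fun i _ => ?_
      rw [Even.neg_pow ⟨t, ht⟩]
      ring
    · rw [integral_inner_pow_of_odd hσinv a ho]
      refine Finset.sum_eq_zero fun i _ => ?_
      rw [ho.neg_pow]
      ring
  have hev : ∀ s, r.eval s = ∑ j ∈ Finset.range (p + 2), r.coeff j * s ^ j :=
    fun s => eval_eq_sum_range' (by omega) s
  simp only [hev, Finset.mul_sum]
  rw [Finset.sum_comm, integral_finsetSum _ fun j _ => (integrable_zonal hσsupp ha
    (continuous_pow j).isBoundedProfile).const_mul _]
  refine Finset.sum_congr rfl fun j hj => ?_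
  rw [integral_const_mul, ← hmono j hj, Finset.mul_sum]
  exact Finset.sum_congr rfl fun i _ => by ring

end Cubature

/-- **Yudin-type lower bound for real projective cubature formulas.**
If `x_1, …, x_n` on the unit sphere `S^{m-1} ⊂ ℝ^m` are pairwise projectively distinct
and `ρ_i > 0` give a cubature formula of index `p` (exact for all homogeneous polynomials
of degree `p`) with respect to the rotation-invariant probability measure `σ`, and `Q` is a
nonzero polynomial of degree `p+1` orthogonal to all powers `s^j`, `j ≤ p`, for the weight
`(1-s²)^{(m-1)/2}`, with largest real root `η`, then
`n ≥ (∫_0^1 (1-s²)^{(m-3)/2} ds) / (∫_η^1 (1-s²)^{(m-3)/2} ds)`. -/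
theorem yudin_bound_real_cubature
    (m : ℕ) (hm : 2 ≤ m) (p : ℕ) (hp : 0 < p) (hpe : Even p)
    (σ : Measure (EuclideanSpace ℝ (Fin m))) [IsProbabilityMeasure σ]
    (hσsupp : ∀ᵐ z ∂σ, ‖z‖ = 1)
    (hσinv : ∀ g : EuclideanSpace ℝ (Fin m) ≃ₗᵢ[ℝ] EuclideanSpace ℝ (Fin m),
      Measure.map g σ = σ)
    (n : ℕ) (x : Fin n → EuclideanSpace ℝ (Fin m)) (ρ : Fin n → ℝ)
    (hx : ∀ i, ‖x i‖ = 1) (hρ : ∀ i, 0 < ρ i)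
    (hdist : ∀ i j, i ≠ j → x i ≠ x j ∧ x i ≠ -x j)
    (hcub : ∀ ψ : MvPolynomial (Fin m) ℝ, ψ.IsHomogeneous p →
      ∫ z, MvPolynomial.eval (fun k => z k) ψ ∂σ
        = ∑ i, ρ i * MvPolynomial.eval (fun k => x i k) ψ)
    (Q : Polynomial ℝ) (hQ : Q ≠ 0) (hQdeg : Q.natDegree = p + 1)
    (hQorth : ∀ j : ℕ, j ≤ p →
      ∫ s in (-1:ℝ)..1, Q.eval s * s ^ j * (1 - s ^ 2) ^ (((m:ℝ) - 1) / 2) = 0)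
    (η : ℝ) (hη : Q.eval η = 0) (hηmax : ∀ s : ℝ, Q.eval s = 0 → s ≤ η) :
    (∫ s in (0:ℝ)..1, (1 - s ^ 2) ^ (((m:ℝ) - 3) / 2)) /
      (∫ s in η..1, (1 - s ^ 2) ^ (((m:ℝ) - 3) / 2)) ≤ (n : ℝ) := by
  have hm2 : (2 : ℝ) ≤ m := by exact_mod_cast hm
  have hα : -(1 / 2) ≤ ((m : ℝ) - 3) / 2 := by linarith
  have hα' : -(1 / 2) ≤ ((m : ℝ) - 1) / 2 := by linarith
  have hfin : Module.finrank ℝ (EuclideanSpace ℝ (Fin m)) = m := by simp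
  obtain ⟨hη1, hη2⟩ := root_mem_Ioo_of_orthogonal hα' hQ hQdeg hQorth hη
  obtain ⟨b, hb, hbpos⟩ := exists_smul_pos_of_forall_root_le hηmax
  have hCQ : gegenbauerOp ((m : ℝ) - 1 + 2) (C b * Q) =
      -C (((p : ℝ) + 1) * (p + 1 + m)) * (C b * Q) := by
    have h := gegenbauerOp_eq_of_orthogonal (Q := C b * Q) (p := p) hα'
      (by rw [natDegree_C_mul hb, hQdeg]) fun j hj => by
        simp only [eval_mul, eval_C, mul_assoc, intervalIntegral.integral_const_mul]
        simp only [← mul_assoc, hQorth j hj, mul_zero]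
    rw [show 2 * (((m : ℝ) - 1) / 2 + 1) = (m : ℝ) - 1 + 2 by ring] at h
    rw [h]
    congr 3
    push_cast
    ring
  obtain ⟨P, c, hP', hPη, hP⟩ := exists_gegenbauer_antiderivative (by
    have : 0 ≤ ((p : ℝ) + 1) * (p + 1 + m) := by positivity
    linarith) hCQ η
  set A := ∫ s in (0 : ℝ)..1, (1 - s ^ 2) ^ (((m : ℝ) - 3) / 2) with hA
  set B := ∫ s in η..1, (1 - s ^ 2) ^ (((m : ℝ) - 3) / 2) with hB
  have hApos : 0 < A := integral_one_sub_sq_rpow_pos hα (by norm_num) (by norm_num)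
  have hBpos : 0 < B := integral_one_sub_sq_rpow_pos hα hη1.le hη2
  set γ := gegenbauerMeasure (((m : ℝ) - 3) / 2) with hγ
  have : IsFiniteMeasure γ := isFiniteMeasure_gegenbauerMeasure hα
  have hmass : γ.real Set.univ = 2 * A := gegenbauerMeasure_real_univ hα
  have hmass0 : γ Set.univ ≠ 0 := fun h => by simp [Measure.real, h] at hmass; linarith
  set ν := (γ Set.univ)⁻¹ • γ with hν
  have hlaw : ∀ a : EuclideanSpace ℝ (Fin m), ‖a‖ = 1 → σ.map (inner ℝ a) = ν := by
    intro a ha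
    have h := map_inner_eq_gegenbauerMeasure hσsupp hσinv (by rwa [hfin]) ha
    rw [hfin] at h
    rw [hν]
    nth_rewrite 2 [hγ]
    rw [h, smul_smul, ENNReal.inv_mul_cancel hmass0 (measure_ne_top _ _), one_smul]
  have hνcap : ν.real (Set.Ioi η) = B / (2 * A) := by
    rw [hν, measureReal_ennreal_smul_apply, ENNReal.toReal_inv, ← hmass, hB,
      ← gegenbauerMeasure_real_Ioi hη1.le hη2.le, Measure.real, Measure.real]
    field_simp
  have hν0 : ν {η} = 0 := by
    have h : γ {η} = 0 := gegenbauerMeasure_absolutelyContinuous _ (by simp)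
    rw [hν, Measure.smul_apply, h, smul_zero]
  have hbound := sum_sq_le_of_design (w := fun i : Fin n × Bool => ρ i.1 / 2)
    (y := antipodalPoints x) (p := p) (P := P) (c := c) hσsupp hσinv (by rwa [hfin])
    (fun i => (half_pos (hρ _)).le) (fun i => by
      rw [antipodalPoints]; split_ifs <;> simp [hx]) hlaw hν0
    (by rw [hνcap]; positivity) (fun r hr z hz => by
      rw [sum_antipodal_eval_of_cubature hpe hσsupp hσinv hx hcub hr hz, ← hlaw z hz,
        integral_map (measurable_inner_left z).aemeasurable
          r.continuous.measurable.aestronglyMeasurable]) hPη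
    (by rw [hP', eval_mul, hη, mul_zero]) (by rwa [hP']) (by
      rw [hfin, ← hP]
      congr 3
      push_cast
      ring)
  have hsum : ∑ i, ρ i = 1 := by
    obtain ⟨q, hq⟩ := hpe
    have h := integral_inner_pow_of_cubature hσsupp hx hcub 0 0 q (by omega)
    simpa using h.symm
  rw [hνcap, Fintype.sum_prod_type] at hbound
  have hsq : ∑ i, ρ i ^ 2 ≤ B / A := by
    have e : ∑ i, ∑ _ : Bool, (ρ i / 2) ^ 2 = (∑ i, ρ i ^ 2) / 2 := by
      rw [Finset.sum_div]
      exact Finset.sum_congr rfl fun i _ => by simp; ring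
    rw [e] at hbound
    have e2 : B / A = 2 * (B / (2 * A)) := by field_simp
    linarith
  have hcs := sq_sum_le_card_mul_sum_sq (s := Finset.univ) (f := ρ)
  rw [hsum, one_pow, Finset.card_univ, Fintype.card_fin] at hcs
  rw [div_le_iff₀ hBpos]
  have h : (1 : ℝ) ≤ n * (B / A) := hcs.trans (mul_le_mul_of_nonneg_left hsq (Nat.cast_nonneg n))
  rwa [← mul_div_assoc, le_div_iff₀ hApos, one_mul] at h
end

section
/- Let m ≥ 2, let p be a positive even integer, and set α = (m-3)/2, β = -1/2. Suppose x_1, …, x_n ∈ S^{m-1} ⊂ ℝ^m are pairwise projectively distinct (x_i ≠ ±x_j for i ≠ j) and ρ_1, …, ρ_n > 0 satisfy ∫_{S^{m-1}} ψ dσ = Σ_{i=1}^n ρ_i ψ(x_i) for every homogeneous polynomial ψ of degree p in m real variables. Let f : [-1,1] → ℝ be continuous, with f(t) ≥ 0 for all t and f not identically zero, and assume: for every integer k ≥ p/2 + 1 and every real polynomial Q of degree exactly k with Q(1) > 0 and ∫_{-1}^{1} Q(t) t^j (1-t)^α (1+t)^β dt = 0 for all 0 ≤ j < k, one has ∫_{-1}^{1}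 f(t) Q(t) (1-t)^α (1+t)^β dt ≤ 0. Then n ≥ (∫_{-1}^{1} (1-t)^α (1+t)^β dt) · f(1) / (∫_{-1}^{1} f(t) (1-t)^α (1+t)^β dt). -/
open MeasureTheory Polynomial

section Sphere

variable {E : Type*} [NormedAddCommGroup E] [InnerProductSpace ℝ E]

/-- The squared inner product, the invariant of a pair of lines spanned by unit vectors. -/
noncomputable def sqInner (x y : E) : ℝ := (inner ℝ x y) ^ 2

lemma sqInner_comm (x y : E) : sqInner x y = sqInner y x := by
  simp only [sqInner, real_inner_comm]

lemma sqInner_self {x : E} (hx : ‖x‖ = 1) : sqInner x x = 1 := by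
  simp [sqInner, hx]

lemma sqInner_nonneg (x y : E) : 0 ≤ sqInner x y := sq_nonneg _

lemma sqInner_le_one {x y : E} (hx : ‖x‖ = 1) (hy : ‖y‖ = 1) : sqInner x y ≤ 1 := by
  have h := abs_real_inner_le_norm x y
  rw [hx, hy, one_mul] at h
  exact (sq_le_one_iff_abs_le_one _).2 h

@[fun_prop]
lemma Continuous.sqInner {T : Type*} [TopologicalSpace T] {f g : T → E} (hf : Continuous f)
    (hg : Continuous g) : Continuous fun t => sqInner (f t) (g t) := by
  unfold _root_.sqInner
  fun_prop

lemma sq_sqInner_sub_le {x u v : E} (hx : ‖x‖ = 1) (hu : ‖u‖ = 1) (hv : ‖v‖ = 1) :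
    (sqInner u v - sqInner x v) ^ 2 ≤ 4 * (1 - sqInner x u) := by
  have h1 : sqInner u v - sqInner x v = inner ℝ (u - x) v * inner ℝ (u + x) v := by
    simp only [sqInner, inner_sub_left, inner_add_left]; ring
  have h2 := real_inner_mul_inner_self_le (u - x) v
  have h3 := real_inner_mul_inner_self_le (u + x) v
  rw [real_inner_self_eq_norm_sq v, hv] at h2 h3
  have h4 : inner ℝ (u - x) (u - x) = 2 - 2 * inner ℝ x u := by
    simp only [inner_sub_left, inner_sub_right, real_inner_self_eq_norm_sq, hx, hu,
      real_inner_comm x u]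
    ring
  have h5 : inner ℝ (u + x) (u + x) = 2 + 2 * inner ℝ x u := by
    simp only [inner_add_left, inner_add_right, real_inner_self_eq_norm_sq, hx, hu,
      real_inner_comm x u]
    ring
  rw [h4] at h2
  rw [h5] at h3
  rw [h1]
  calc _ = (inner ℝ (u - x) v * inner ℝ (u - x) v) * (inner ℝ (u + x) v * inner ℝ (u + x) v) := by
        ring
    _ ≤ ((2 - 2 * inner ℝ x u) * 1 ^ 2) * ((2 + 2 * inner ℝ x u) * 1 ^ 2) :=
        mul_le_mul h2 h3 (mul_self_nonneg _) ((mul_self_nonneg _).trans h2)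
    _ = _ := by simp only [sqInner]; ring

lemma sq_sqInner_sub_sqInner_le {x y u v : E} (hx : ‖x‖ = 1) (hy : ‖y‖ = 1) (hu : ‖u‖ = 1)
    (hv : ‖v‖ = 1) :
    (sqInner x y - sqInner u v) ^ 2 ≤ 8 * (1 - sqInner x u) + 8 * (1 - sqInner y v) := by
  have h1 := sq_sqInner_sub_le hx hu hv
  have h2 := sq_sqInner_sub_le hy hv hx
  rw [sqInner_comm v x, sqInner_comm y x] at h2
  nlinarith [sq_nonneg ((sqInner u v - sqInner x v) - (sqInner x v - sqInner x y))]

lemma exists_linearIsometryEquiv_pair {x y x' y' : E} (hx : ‖x‖ = 1) (hy : ‖y‖ = 1)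
    (hx' : ‖x'‖ = 1) (hy' : ‖y'‖ = 1) (h : (inner ℝ x y : ℝ) = inner ℝ x' y') :
    ∃ g : E ≃ₗᵢ[ℝ] E, g x = x' ∧ g y = y' := by
  let g₁ := (ℝ ∙ (x - x'))ᗮ.reflection
  have h₁ : g₁ x = x' := Submodule.reflection_sub (hx.trans hx'.symm)
  let g₂ := (ℝ ∙ (g₁ y - y'))ᗮ.reflection
  have h₂ : g₂ (g₁ y) = y' := Submodule.reflection_sub (by simp [hy, hy'])
  refine ⟨g₁.trans g₂, ?_, h₂⟩
  simp only [LinearIsometryEquiv.trans_apply, h₁]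
  apply Submodule.reflection_mem_subspace_eq_self
  rw [Submodule.mem_orthogonal_singleton_iff_inner_right, inner_sub_left, sub_eq_zero,
    real_inner_comm x' y', ← h, ← h₁, LinearIsometryEquiv.inner_map_map, real_inner_comm]

variable [MeasurableSpace E] [BorelSpace E] [FiniteDimensional ℝ E]

/-- A rotation invariant probability measure carried by the unit sphere. -/
structure IsUniformOnSphere (σ : Measure E) : Prop where
  isProbabilityMeasure : IsProbabilityMeasure σ
  norm_eq_one : ∀ᵐ z ∂σ, ‖z‖ = 1
  map_eq : ∀ g : E ≃ₗᵢ[ℝ] E, Measure.map g σ = σ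

namespace IsUniformOnSphere

variable {σ : Measure E} (hσ : IsUniformOnSphere σ)
include hσ

lemma integrable {g : E → ℝ} (hg : Continuous g) : Integrable g σ := by
  have := hσ.isProbabilityMeasure
  obtain ⟨C, hC⟩ := (isCompact_sphere (0 : E) 1).exists_bound_of_continuousOn hg.continuousOn
  refine Integrable.of_bound hg.aestronglyMeasurable C ?_
  filter_upwards [hσ.norm_eq_one] with z hz using hC z (by simp [hz])

omit [BorelSpace E] [FiniteDimensional ℝ E] in
lemma ae_prod : ∀ᵐ z ∂(σ.prod σ), ‖z.1‖ = 1 ∧ ‖z.2‖ = 1 := by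
  have := hσ.isProbabilityMeasure
  exact (Measure.quasiMeasurePreserving_fst.ae hσ.norm_eq_one).and
    (Measure.quasiMeasurePreserving_snd.ae hσ.norm_eq_one)

lemma integrable_prod {g : E × E → ℝ} (hg : Continuous g) : Integrable g (σ.prod σ) := by
  have := hσ.isProbabilityMeasure
  obtain ⟨C, hC⟩ := ((isCompact_sphere (0 : E) 1).prod
    (isCompact_sphere (0 : E) 1)).exists_bound_of_continuousOn hg.continuousOn
  refine Integrable.of_bound hg.aestronglyMeasurable C ?_
  filter_upwards [hσ.ae_prod] with z hz using hC z (by simp [hz.1, hz.2])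

omit [FiniteDimensional ℝ E] in
lemma integral_comp (g : E ≃ₗᵢ[ℝ] E) (F : E → ℝ) : ∫ z, F (g z) ∂σ = ∫ z, F z ∂σ := by
  conv_rhs => rw [← hσ.map_eq g]
  exact (integral_map_equiv g.toHomeomorph.toMeasurableEquiv F).symm

omit [FiniteDimensional ℝ E] in
lemma integral_inner_pair (F : ℝ → ℝ → ℝ) {x y x' y' : E} (hx : ‖x‖ = 1) (hy : ‖y‖ = 1)
    (hx' : ‖x'‖ = 1) (hy' : ‖y'‖ = 1) (h : (inner ℝ x y : ℝ) = inner ℝ x' y') :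
    ∫ z, F (inner ℝ x z) (inner ℝ y z) ∂σ = ∫ z, F (inner ℝ x' z) (inner ℝ y' z) ∂σ := by
  obtain ⟨g, rfl, rfl⟩ := exists_linearIsometryEquiv_pair hx hy hx' hy' h
  rw [← hσ.integral_comp g fun z => F (inner ℝ (g x) z) (inner ℝ (g y) z)]
  simp only [LinearIsometryEquiv.inner_map_map]

omit [FiniteDimensional ℝ E] in
lemma integral_inner_eq (F : ℝ → ℝ) {x x' : E} (hx : ‖x‖ = 1) (hx' : ‖x'‖ = 1) :
    ∫ z, F (inner ℝ x z) ∂σ = ∫ z, F (inner ℝ x' z) ∂σ :=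
  hσ.integral_inner_pair (fun a _ => F a) hx hx hx' hx' (by
    simp [hx, hx'])

omit [FiniteDimensional ℝ E] in
lemma integral_sqInner_eq (F : ℝ → ℝ) {x x' : E} (hx : ‖x‖ = 1) (hx' : ‖x'‖ = 1) :
    ∫ z, F (sqInner x z) ∂σ = ∫ z, F (sqInner x' z) ∂σ :=
  hσ.integral_inner_eq (fun a => F (a ^ 2)) hx hx'

/-- Mixed moments of two orthogonal coordinates. -/
lemma integral_sqInner_pow_mul {x u : E} (hx : ‖x‖ = 1) (hu : ‖u‖ = 1)
    (hxu : (inner ℝ x u : ℝ) = 0) (k : ℕ) :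
    (2 * k + 1) * ∫ z, sqInner x z ^ k * sqInner u z ∂σ = ∫ z, sqInner x z ^ (k + 1) ∂σ := by
  set M := ∫ z, sqInner x z ^ (k + 1) ∂σ with hM
  let I : ℕ → ℝ := fun i => ∫ z, (inner ℝ x z : ℝ) ^ (2 * k + 2 - i) * (inner ℝ u z : ℝ) ^ i ∂σ
  have key : (∑ i ∈ Finset.range (2 * k + 3), C (((2 * k + 2).choose i : ℝ) * I i) * X ^ i : ℝ[X])
      = C M * expand ℝ 2 ((1 + X) ^ (k + 1)) := by
    refine Polynomial.funext fun t => ?_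
    have ht : 0 < 1 + t ^ 2 := by positivity
    have hnorm : ‖x + t • u‖ ^ 2 = 1 + t ^ 2 := by
      rw [norm_add_sq_real, norm_smul, hx, hu, inner_smul_right, hxu]
      simp
    have hne : ‖x + t • u‖ ≠ 0 := by
      intro h0
      rw [h0] at hnorm
      simp at hnorm
      linarith
    have hunit : ‖(‖x + t • u‖⁻¹ : ℝ) • (x + t • u)‖ = 1 := by
      rw [norm_smul, norm_inv, norm_norm, inv_mul_cancel₀ hne]
    have h1 := hσ.integral_sqInner_eq (fun s => s ^ (k + 1)) hunit hx
    simp only [sqInner, inner_smul_left, inner_add_left] at h1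
    have h2 : ∀ z : E, ((((starRingEnd ℝ) ‖x + t • u‖⁻¹ : ℝ) * (inner ℝ x z
        + (starRingEnd ℝ) t * inner ℝ u z)) ^ 2) ^ (k + 1)
        = ((1 + t ^ 2) ^ (k + 1))⁻¹ * (inner ℝ x z + t * inner ℝ u z) ^ (2 * k + 2) := by
      intro z
      simp only [conj_trivial]
      rw [mul_pow, mul_pow, inv_pow, hnorm, inv_pow, ← pow_mul]
      congr 2
    simp only [h2] at h1
    rw [integral_const_mul, inv_mul_eq_iff_eq_mul₀ (by positivity)] at h1
    have h3 : ∫ z, (inner ℝ x z + t * inner ℝ u z : ℝ) ^ (2 * k + 2) ∂σ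
        = ∑ i ∈ Finset.range (2 * k + 3), ((2 * k + 2).choose i : ℝ) * I i * t ^ i := by
      simp only [add_comm (inner ℝ x _ : ℝ), add_pow]
      rw [integral_finsetSum _ fun i _ => hσ.integrable (by fun_prop)]
      refine Finset.sum_congr rfl fun i _ => ?_
      rw [mul_assoc, mul_comm (I i), ← mul_assoc, ← integral_const_mul]
      refine integral_congr_ae (Filter.Eventually.of_forall fun z => ?_)
      simp only [mul_pow]
      ring
    simp only [eval_finsetSum, eval_mul, eval_C, eval_pow, eval_X, expand_eval, eval_add, eval_one]
    rw [← h3, h1, mul_comm]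
    simp [hM, sqInner]
  have hc := congrArg (fun q => q.coeff 2) key
  simp only [finsetSum_coeff, coeff_C_mul, coeff_X_pow] at hc
  rw [coeff_expand (by norm_num), if_pos (by norm_num), add_comm 1 X, coeff_X_add_one_pow] at hc
  simp only [mul_ite, mul_one, mul_zero, Finset.sum_ite_eq, Finset.mem_range] at hc
  rw [if_pos (by omega)] at hc
  have hI : I 2 = ∫ z, sqInner x z ^ k * sqInner u z ∂σ := by
    simp only [I, sqInner, Nat.add_sub_cancel, pow_mul]
  rw [hI] at hc
  have hch : ((2 * k + 2).choose 2 : ℝ) = (k + 1) * (2 * k + 1) := by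
    rw [Nat.cast_choose_two]; push_cast; ring
  rw [hch] at hc
  simp at hc
  have hk : (k + 1 : ℝ) ≠ 0 := by positivity
  apply mul_left_cancel₀ hk
  linarith

lemma integral_sqInner_pow_succ {x : E} (hx : ‖x‖ = 1) (k : ℕ) :
    (Module.finrank ℝ E + 2 * k : ℝ) * ∫ z, sqInner x z ^ (k + 1) ∂σ
      = (2 * k + 1) * ∫ z, sqInner x z ^ k ∂σ := by
  have := hσ.isProbabilityMeasure
  let b := stdOrthonormalBasis ℝ E
  have hpos : 0 < Module.finrank ℝ E := by
    have : Nontrivial E := ⟨x, 0, by rintro rfl; simp at hx⟩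
    exact Module.finrank_pos
  let i₀ : Fin (Module.finrank ℝ E) := ⟨0, hpos⟩
  have hb : ∀ i, ‖b i‖ = 1 := fun i => b.orthonormal.1 i
  rw [hσ.integral_sqInner_eq (· ^ (k + 1)) hx (hb i₀), hσ.integral_sqInner_eq (· ^ k) hx (hb i₀)]
  set M := ∫ z, sqInner (b i₀) z ^ (k + 1) ∂σ
  have h1 : ∫ z, sqInner (b i₀) z ^ k ∂σ = ∑ i, ∫ z, sqInner (b i₀) z ^ k * sqInner (b i) z ∂σ := by
    rw [← integral_finsetSum _ fun i _ => hσ.integrable (by fun_prop)]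
    refine integral_congr_ae ?_
    filter_upwards [hσ.norm_eq_one] with z hz
    rw [← Finset.mul_sum]
    have : ∑ i, sqInner (b i) z = 1 := by
      have := b.sum_sq_norm_inner_right z
      simpa [sqInner, hz] using this
    rw [this, mul_one]
  rw [h1, Finset.mul_sum, ← Finset.add_sum_erase _ _ (Finset.mem_univ i₀)]
  have h2 : ∀ i ∈ Finset.univ.erase i₀,
      (2 * k + 1 : ℝ) * ∫ z, sqInner (b i₀) z ^ k * sqInner (b i) z ∂σ = M := by
    intro i hi
    exact hσ.integral_sqInner_pow_mul (hb _) (hb _)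
      (b.orthonormal.2 (Finset.ne_of_mem_erase hi).symm) k
  rw [Finset.sum_congr rfl h2]
  simp only [← pow_succ]
  change _ = (2 * k + 1 : ℝ) * M + _
  rw [Finset.sum_const, Finset.card_erase_of_mem (Finset.mem_univ _), Finset.card_univ,
    Fintype.card_fin, nsmul_eq_mul, Nat.cast_sub hpos]
  push_cast
  ring

end IsUniformOnSphere

end Sphere

section JacobiWeight

/-- The Jacobi weight with parameters `(a, -1/2)`. -/
noncomputable def jacobiWeight (a t : ℝ) : ℝ := (1 - t) ^ a * (1 + t) ^ (-(1 / 2) : ℝ)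

variable {a : ℝ}

lemma jacobiWeight_pos {t : ℝ} (ht : t ∈ Set.Ioo (-1 : ℝ) 1) : 0 < jacobiWeight a t :=
  mul_pos (Real.rpow_pos_of_pos (by linarith [ht.2]) _) (Real.rpow_pos_of_pos (by linarith [ht.1]) _)

lemma jacobiWeight_nonneg {t : ℝ} (ht : t ∈ Set.Icc (-1 : ℝ) 1) : 0 ≤ jacobiWeight a t :=
  mul_nonneg (Real.rpow_nonneg (by linarith [ht.2]) _) (Real.rpow_nonneg (by linarith [ht.1]) _)

lemma intervalIntegrable_jacobiWeight (ha : -1 < a) :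
    IntervalIntegrable (jacobiWeight a) volume (-1) 1 := by
  have hl : IntervalIntegrable (jacobiWeight a) volume (-1) 0 := by
    have h : IntervalIntegrable (fun t : ℝ => (1 + t) ^ (-(1 / 2) : ℝ)) volume (-1) 0 := by
      have := (intervalIntegral.intervalIntegrable_rpow' (a := 0) (b := 1)
        (r := (-(1 / 2) : ℝ)) (by norm_num)).comp_add_left 1
      simpa using this
    refine h.continuousOn_mul ?_
    rw [Set.uIcc_of_le (by norm_num)]
    intro t ht
    exact (ContinuousAt.rpow_const (by fun_prop)
      (Or.inl (by linarith [ht.2]))).continuousWithinAt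
  have hr : IntervalIntegrable (jacobiWeight a) volume 0 1 := by
    have h : IntervalIntegrable (fun t : ℝ => (1 - t) ^ a) volume 0 1 := by
      have := (intervalIntegral.intervalIntegrable_rpow' (a := 1) (b := 0)
        (r := a) ha).comp_sub_left 1
      simpa using this
    refine h.mul_continuousOn ?_
    rw [Set.uIcc_of_le (by norm_num)]
    intro t ht
    exact (ContinuousAt.rpow_const (by fun_prop)
      (Or.inl (by linarith [ht.1]))).continuousWithinAt
  exact hl.trans hr

lemma intervalIntegrable_mul_jacobiWeight (ha : -1 < a) {f : ℝ → ℝ}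
    (hf : ContinuousOn f (Set.Icc (-1) 1)) :
    IntervalIntegrable (fun t => f t * jacobiWeight a t) volume (-1) 1 :=
  (intervalIntegrable_jacobiWeight ha).continuousOn_mul (by
    rwa [Set.uIcc_of_le (by norm_num)])

lemma eqOn_zero_of_integral_mul_jacobiWeight_eq_zero (ha : -1 < a) {f : ℝ → ℝ}
    (hf : ContinuousOn f (Set.Icc (-1) 1)) (h0 : ∀ t ∈ Set.Icc (-1 : ℝ) 1, 0 ≤ f t)
    (hz : ∫ t in (-1 : ℝ)..1, f t * jacobiWeight a t = 0) :
    ∀ t ∈ Set.Ioo (-1 : ℝ) 1, f t = 0 := by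
  rw [intervalIntegral.integral_of_le (by norm_num), integral_Ioc_eq_integral_Ioo] at hz
  have hint : IntegrableOn (fun t => f t * jacobiWeight a t) (Set.Ioo (-1) 1) :=
    (intervalIntegrable_iff_integrableOn_Ioo_of_le (by norm_num)).1
      (intervalIntegrable_mul_jacobiWeight ha hf)
  rw [setIntegral_eq_zero_iff_of_nonneg_ae] at hz
  · have hae : f =ᵐ[volume.restrict (Set.Ioo (-1) 1)] (fun _ => (0 : ℝ)) := by
      filter_upwards [hz, ae_restrict_mem measurableSet_Ioo] with t ht hmem
      exact (mul_eq_zero.1 ht).resolve_right (jacobiWeight_pos hmem).ne'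
    exact Measure.eqOn_open_of_ae_eq hae isOpen_Ioo (hf.mono Set.Ioo_subset_Icc_self)
      continuousOn_const
  · filter_upwards [ae_restrict_mem measurableSet_Ioo] with t hmem
    exact mul_nonneg (h0 t (Set.Ioo_subset_Icc_self hmem)) (jacobiWeight_pos hmem).le
  · exact hint

lemma integral_jacobiWeight_pos (ha : -1 < a) : 0 < ∫ t in (-1 : ℝ)..1, jacobiWeight a t :=
  intervalIntegral.intervalIntegral_pos_of_pos_on (intervalIntegrable_jacobiWeight ha)
    (fun _ ht => jacobiWeight_pos ht) (by norm_num)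

lemma integral_pow_succ_mul_jacobiWeight (ha : -1 < a) (k : ℕ) :
    (2 * a + 3 + 2 * k) * ∫ t in (-1 : ℝ)..1, ((1 + t) / 2) ^ (k + 1) * jacobiWeight a t
      = (2 * k + 1) * ∫ t in (-1 : ℝ)..1, ((1 + t) / 2) ^ k * jacobiWeight a t := by
  let F : ℝ → ℝ := fun t => (1 - t) ^ (a + 1) * (1 + t) ^ (k + 1 / 2 : ℝ)
  let F' : ℝ → ℝ := fun t =>
    ((k + 1 / 2) * (1 + t) ^ k * (1 - t) - (a + 1) * (1 + t) ^ (k + 1)) * jacobiWeight a t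
  have hcont : ContinuousOn F (Set.Icc (-1) 1) := by
    apply Continuous.continuousOn
    exact (Continuous.rpow_const (by fun_prop) fun _ => Or.inr (by linarith)).mul
      (Continuous.rpow_const (by fun_prop) fun _ => Or.inr (by positivity))
  have hderiv : ∀ t ∈ Set.Ioo (-1 : ℝ) 1, HasDerivAt F (F' t) t := by
    intro t ht
    have h1 : 0 < 1 - t := by linarith [ht.2]
    have h2 : 0 < 1 + t := by linarith [ht.1]
    have d1 : HasDerivAt (fun t : ℝ => (1 - t) ^ (a + 1)) (-1 * (a + 1) * (1 - t) ^ (a + 1 - 1)) t :=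
      ((hasDerivAt_id t).const_sub 1).rpow_const (Or.inl h1.ne')
    have d2 : HasDerivAt (fun t : ℝ => (1 + t) ^ (k + 1 / 2 : ℝ))
        (1 * (k + 1 / 2) * (1 + t) ^ (k + 1 / 2 - 1 : ℝ)) t :=
      ((hasDerivAt_id t).const_add 1).rpow_const (Or.inl h2.ne')
    refine (d1.mul d2).congr_deriv (Eq.symm ?_)
    have e1 : (1 - t) ^ (a + 1) = (1 - t) ^ a * (1 - t) := by rw [Real.rpow_add_one h1.ne']
    have e2 : (1 + t) ^ (k + 1 / 2 : ℝ) = (1 + t) ^ (k + 1) * (1 + t) ^ (-(1 / 2) : ℝ) := by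
      rw [← Real.rpow_natCast, ← Real.rpow_add h2]; congr 1; push_cast; ring
    have e3 : (1 + t) ^ (k + 1 / 2 - 1 : ℝ) = (1 + t) ^ k * (1 + t) ^ (-(1 / 2) : ℝ) := by
      rw [← Real.rpow_natCast, ← Real.rpow_add h2]; congr 1; ring
    rw [e1, e2, e3, add_sub_cancel_right]
    simp only [F', jacobiWeight]
    ring
  have hint : ∀ {f : ℝ → ℝ}, Continuous f →
      IntervalIntegrable (fun t => f t * jacobiWeight a t) volume (-1) 1 := fun hf =>
    intervalIntegrable_mul_jacobiWeight ha hf.continuousOn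
  have h := intervalIntegral.integral_eq_sub_of_hasDerivAt_of_le (by norm_num) hcont hderiv
    (hint (by fun_prop))
  have hF1 : F 1 = 0 := by
    simp only [F, sub_self]; rw [Real.zero_rpow (by linarith), zero_mul]
  have hF2 : F (-1) = 0 := by
    simp only [F, add_neg_cancel]; rw [Real.zero_rpow (by positivity), mul_zero]
  rw [hF1, hF2, sub_zero] at h
  have hsplit : ∫ t in (-1 : ℝ)..1, F' t
      = 2 ^ k * ((2 * k + 1) * ∫ t in (-1 : ℝ)..1, ((1 + t) / 2) ^ k * jacobiWeight a t)
      - 2 ^ k * ((2 * a + 3 + 2 * k) *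
        ∫ t in (-1 : ℝ)..1, ((1 + t) / 2) ^ (k + 1) * jacobiWeight a t) := by
    simp only [← intervalIntegral.integral_const_mul]
    rw [← intervalIntegral.integral_sub
      (((hint (by fun_prop)).const_mul _).const_mul _)
      (((hint (by fun_prop)).const_mul _).const_mul _)]
    congr 1
    ext t
    simp only [F', div_pow, pow_succ]
    field_simp
    ring
  rw [hsplit] at h
  have : (2 : ℝ) ^ k ≠ 0 := by positivity
  apply mul_left_cancel₀ this
  linarith

end JacobiWeight

section Zonal

variable {E : Type*} [NormedAddCommGroup E] [InnerProductSpace ℝ E]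
  [MeasurableSpace E] [BorelSpace E] [FiniteDimensional ℝ E]

namespace IsUniformOnSphere

variable {σ : Measure E} (hσ : IsUniformOnSphere σ)
include hσ

lemma integral_sqInner_pow_mul_integral_jacobiWeight {a : ℝ} (ha : -1 < a)
    (hdim : (Module.finrank ℝ E : ℝ) = 2 * a + 3) {x : E} (hx : ‖x‖ = 1) (k : ℕ) :
    (∫ z, sqInner x z ^ k ∂σ) * ∫ t in (-1 : ℝ)..1, jacobiWeight a t
      = ∫ t in (-1 : ℝ)..1, ((1 + t) / 2) ^ k * jacobiWeight a t := by
  have := hσ.isProbabilityMeasure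
  induction k with
  | zero => simp
  | succ k ih =>
    have h1 := hσ.integral_sqInner_pow_succ hx k
    have h2 := integral_pow_succ_mul_jacobiWeight ha k
    rw [hdim] at h1
    have hne : 2 * a + 3 + 2 * k ≠ 0 := by
      have : (0 : ℝ) ≤ k := k.cast_nonneg
      linarith
    apply mul_left_cancel₀ hne
    rw [h2, ← mul_assoc, h1, ← ih, mul_assoc]

lemma integral_eval_sqInner_mul_integral_jacobiWeight {a : ℝ} (ha : -1 < a)
    (hdim : (Module.finrank ℝ E : ℝ) = 2 * a + 3) {x : E} (hx : ‖x‖ = 1) (q : ℝ[X]) :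
    (∫ z, q.eval (sqInner x z) ∂σ) * ∫ t in (-1 : ℝ)..1, jacobiWeight a t
      = ∫ t in (-1 : ℝ)..1, q.eval ((1 + t) / 2) * jacobiWeight a t := by
  simp only [eval_eq_sum_range, Finset.sum_mul]
  rw [integral_finsetSum _ fun i _ => hσ.integrable (by fun_prop),
    intervalIntegral.integral_finsetSum fun i _ =>
      intervalIntegrable_mul_jacobiWeight ha (by fun_prop), Finset.sum_mul]
  refine Finset.sum_congr rfl fun i _ => ?_
  simp only [mul_assoc, intervalIntegral.integral_const_mul, integral_const_mul]
  rw [hσ.integral_sqInner_pow_mul_integral_jacobiWeight ha hdim hx]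

/-- The distribution of `2 ⟪x, z⟫² - 1` under the uniform measure is the normalized Jacobi
weight. -/
lemma integral_sqInner_mul_integral_jacobiWeight {a : ℝ} (ha : -1 < a)
    (hdim : (Module.finrank ℝ E : ℝ) = 2 * a + 3) {x : E} (hx : ‖x‖ = 1) {f : ℝ → ℝ}
    (hf : Continuous f) :
    (∫ z, f (sqInner x z) ∂σ) * ∫ t in (-1 : ℝ)..1, jacobiWeight a t
      = ∫ t in (-1 : ℝ)..1, f ((1 + t) / 2) * jacobiWeight a t := by
  have := hσ.isProbabilityMeasure
  set W := ∫ t in (-1 : ℝ)..1, jacobiWeight a t with hW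
  have hWpos : 0 < W := integral_jacobiWeight_pos ha
  refine eq_of_abs_sub_le_all fun ε hε => ?_
  obtain ⟨q, hq⟩ := exists_polynomial_near_of_continuousOn 0 1 f hf.continuousOn (ε / (2 * W))
    (by positivity)
  have h1 : |∫ z, f (sqInner x z) ∂σ - ∫ z, q.eval (sqInner x z) ∂σ| ≤ ε / (2 * W) := by
    rw [← integral_sub (hσ.integrable (by fun_prop)) (hσ.integrable (by fun_prop))]
    have := norm_integral_le_of_norm_le_const (μ := σ) (C := ε / (2 * W))
      (f := fun z => f (sqInner x z) - q.eval (sqInner x z)) (by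
        filter_upwards [hσ.norm_eq_one] with z hz
        rw [Real.norm_eq_abs, abs_sub_comm]
        exact (hq _ ⟨sqInner_nonneg _ _, sqInner_le_one hx hz⟩).le)
    simpa using this
  have h2 : |(∫ t in (-1 : ℝ)..1, f ((1 + t) / 2) * jacobiWeight a t)
      - ∫ t in (-1 : ℝ)..1, q.eval ((1 + t) / 2) * jacobiWeight a t| ≤ ε / (2 * W) * W := by
    rw [← intervalIntegral.integral_sub (intervalIntegrable_mul_jacobiWeight ha (by fun_prop))
      (intervalIntegrable_mul_jacobiWeight ha (by fun_prop)), hW,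
      ← intervalIntegral.integral_const_mul, ← Real.norm_eq_abs]
    refine intervalIntegral.norm_integral_le_of_norm_le (by norm_num)
      (Filter.Eventually.of_forall fun t ht => ?_)
      ((intervalIntegrable_jacobiWeight ha).const_mul _)
    have hw : 0 ≤ jacobiWeight a t := jacobiWeight_nonneg ⟨ht.1.le, ht.2⟩
    rw [← sub_mul, norm_mul, Real.norm_of_nonneg hw, Real.norm_eq_abs, abs_sub_comm]
    exact mul_le_mul_of_nonneg_right
      (hq _ ⟨by linarith [ht.1], by linarith [ht.2]⟩).le hw
  rw [← hσ.integral_eval_sqInner_mul_integral_jacobiWeight ha hdim hx] at h2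
  have h3 : |(∫ z, f (sqInner x z) ∂σ) * W - (∫ z, q.eval (sqInner x z) ∂σ) * W|
      ≤ ε / (2 * W) * W := by
    rw [← sub_mul, abs_mul, abs_of_pos hWpos]
    exact mul_le_mul_of_nonneg_right h1 hWpos.le
  have h4 : ε / (2 * W) * W = ε / 2 := by field_simp
  rw [h4] at h2 h3
  rw [abs_le] at h2 h3 ⊢
  constructor <;> linarith [h2.1, h2.2, h3.1, h3.2]

lemma eq_zero_of_integral_sq_eq_zero {a : ℝ} (ha : -1 < a)
    (hdim : (Module.finrank ℝ E : ℝ) = 2 * a + 3) {x : E} (hx : ‖x‖ = 1) {q : ℝ[X]}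
    (hq : ∫ z, q.eval (sqInner x z) * q.eval (sqInner x z) ∂σ = 0) : q = 0 := by
  have h := hσ.integral_sqInner_mul_integral_jacobiWeight ha hdim hx
    (f := fun s => q.eval s * q.eval s) (by fun_prop)
  simp only [hq, zero_mul] at h
  have h0 := eqOn_zero_of_integral_mul_jacobiWeight_eq_zero ha (by fun_prop)
    (fun t _ => mul_self_nonneg (q.eval ((1 + t) / 2))) h.symm
  refine eq_zero_of_infinite_isRoot q (((Set.Ioo_infinite (zero_lt_one' ℝ))).mono ?_)
  intro s hs
  have := h0 (2 * s - 1) ⟨by linarith [hs.1], by linarith [hs.2]⟩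
  have h1 : (1 + (2 * s - 1)) / 2 = s := by ring
  rw [h1] at this
  exact mul_self_eq_zero.1 this

/-- Averaging an even power of a linear form against a zonal function gives a zonal polynomial. -/
lemma exists_integral_mul_sqInner_pow_eq_eval (hE : 2 ≤ Module.finrank ℝ E) {f : ℝ → ℝ}
    (hf : Continuous f) (b : ℕ) :
    ∃ h : ℝ[X], h.natDegree ≤ b ∧ ∀ x y : E, ‖x‖ = 1 → ‖y‖ = 1 →
      ∫ z, f (sqInner x z) * sqInner z y ^ b ∂σ = h.eval (sqInner x y) := by
  obtain ⟨u, v, hu, hv, huv⟩ : ∃ u v : E, ‖u‖ = 1 ∧ ‖v‖ = 1 ∧ (inner ℝ u v : ℝ) = 0 := by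
    let B := stdOrthonormalBasis ℝ E
    refine ⟨B ⟨0, by omega⟩, B ⟨1, by omega⟩, B.orthonormal.1 _, B.orthonormal.1 _,
      B.orthonormal.2 ?_⟩
    simp
  let I : ℕ → ℝ := fun i =>
    ∫ z, f (sqInner u z) * ((inner ℝ u z : ℝ) ^ i * (inner ℝ v z : ℝ) ^ (2 * b - i)) ∂σ
  have hterm : ∀ i ∈ Finset.range (2 * b + 1), ∃ t : ℝ[X], t.natDegree ≤ b ∧
      ∀ α γ : ℝ, α ^ 2 + γ ^ 2 = 1 →
        α ^ i * γ ^ (2 * b - i) * ((2 * b).choose i : ℝ) * I i = t.eval (α ^ 2) := by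
    intro i hi
    have hi : i ≤ 2 * b := by simpa [Nat.lt_succ_iff] using hi
    rcases Nat.even_or_odd' i with ⟨j, rfl | rfl⟩
    · refine ⟨C (((2 * b).choose (2 * j) : ℝ) * I (2 * j)) * (X ^ j * (1 - X) ^ (b - j)), ?_, ?_⟩
      · refine (natDegree_C_mul_le _ _).trans (natDegree_mul_le.trans ?_)
        have h1 : ((1 - X : ℝ[X]) ^ (b - j)).natDegree ≤ (b - j) * 1 :=
          natDegree_pow_le_of_le _ (natDegree_sub_le_of_le (natDegree_one.le.trans zero_le_one) natDegree_X_le)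
        have h2 : ((X : ℝ[X]) ^ j).natDegree ≤ j := natDegree_X_pow_le _
        omega
      · intro α γ h
        simp only [eval_mul, eval_C, eval_pow, eval_X, eval_sub, eval_one]
        have hγ : 1 - α ^ 2 = γ ^ 2 := by linarith
        rw [hγ, ← pow_mul, ← pow_mul, Nat.mul_sub]
        ring
    · refine ⟨0, by simp, fun α γ _ => ?_⟩
      have hodd : Odd (2 * b - (2 * j + 1)) := by
        rw [Nat.odd_sub hi]; simp
      have hI : I (2 * j + 1) = 0 := by
        have := hσ.integral_inner_pair
          (fun p q => f (p ^ 2) * (p ^ (2 * j + 1) * q ^ (2 * b - (2 * j + 1))))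
          hu hv hu (y' := -v) (by simpa using hv) (by simp [huv])
        simp only [inner_neg_left, hodd.neg_pow, mul_neg, integral_neg] at this
        simp only [I, sqInner]
        linarith
      simp [hI]
  choose! t htdeg hteval using hterm
  refine ⟨∑ i ∈ Finset.range (2 * b + 1), t i,
    natDegree_sum_le_of_forall_le _ _ fun i hi => htdeg i hi, ?_⟩
  intro x y hx hy
  have hle : (inner ℝ x y : ℝ) ^ 2 ≤ 1 := sqInner_le_one hx hy
  set α : ℝ := inner ℝ x y with hα
  set γ : ℝ := √(1 - α ^ 2) with hγ
  have hαγ : α ^ 2 + γ ^ 2 = 1 := by rw [hγ, Real.sq_sqrt (by linarith)]; ring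
  have hn : ‖α • u + γ • v‖ = 1 := by
    rw [← sq_eq_sq₀ (norm_nonneg _) zero_le_one, norm_add_sq_real, norm_smul, norm_smul, hu, hv,
      inner_smul_left, inner_smul_right, huv]
    simp [hαγ]
  have hin : (inner ℝ x y : ℝ) = inner ℝ u (α • u + γ • v) := by
    rw [inner_add_right, inner_smul_right, inner_smul_right, huv, real_inner_self_eq_norm_sq, hu]
    simp [hα]
  have h := hσ.integral_inner_pair (fun p q => f (p ^ 2) * q ^ (2 * b)) hx hy hu hn hin
  have h' : ∫ z, f (sqInner x z) * sqInner z y ^ b ∂σ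
      = ∫ z, f ((inner ℝ x z : ℝ) ^ 2) * (inner ℝ y z : ℝ) ^ (2 * b) ∂σ := by
    simp only [sqInner, pow_mul, real_inner_comm]
  rw [h', h, eval_finsetSum]
  simp only [inner_add_left, inner_smul_left, conj_trivial, add_pow, Finset.mul_sum]
  rw [integral_finsetSum _ fun i _ => hσ.integrable (by fun_prop)]
  refine Finset.sum_congr rfl fun i hi => ?_
  change _ = (t i).eval (α ^ 2)
  rw [← hteval i hi α γ hαγ, ← integral_const_mul]
  congr 1
  ext z
  simp only [sqInner]
  ring

lemma exists_integral_mul_eval_eq_eval (hE : 2 ≤ Module.finrank ℝ E) {f : ℝ → ℝ}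
    (hf : Continuous f) (r : ℝ[X]) :
    ∃ h : ℝ[X], h.natDegree ≤ r.natDegree ∧ ∀ x y : E, ‖x‖ = 1 → ‖y‖ = 1 →
      ∫ z, f (sqInner x z) * r.eval (sqInner z y) ∂σ = h.eval (sqInner x y) := by
  choose h hdeg heval using fun b => hσ.exists_integral_mul_sqInner_pow_eq_eval hE hf b
  refine ⟨∑ i ∈ Finset.range (r.natDegree + 1), C (r.coeff i) * h i,
    natDegree_sum_le_of_forall_le _ _ fun i hi => ?_, fun x y hx hy => ?_⟩
  · exact (natDegree_C_mul_le _ _).trans ((hdeg i).trans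
      (Nat.lt_succ_iff.1 (Finset.mem_range.1 hi)))
  · simp only [eval_eq_sum_range (p := r), eval_finsetSum, Finset.mul_sum, eval_mul, eval_C]
    rw [integral_finsetSum _ fun i _ => hσ.integrable (by fun_prop)]
    refine Finset.sum_congr rfl fun i _ => ?_
    rw [← heval i x y hx hy, ← integral_const_mul]
    congr 1
    ext z
    ring

end IsUniformOnSphere

end Zonal

section ZonalOrthogonal

variable {E : Type*} [NormedAddCommGroup E] [InnerProductSpace ℝ E]
  [MeasurableSpace E] [BorelSpace E] [FiniteDimensional ℝ E]

/-- `Q` has degree `k` and is orthogonal to all polynomials of lower degree with respect to the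
distribution of `⟪x, z⟫²` under `σ`, for every unit vector `x`. -/
structure IsZonalOrthogonal (σ : Measure E) (k : ℕ) (Q : ℝ[X]) : Prop where
  natDegree_eq : Q.natDegree = k
  ne_zero : Q ≠ 0
  integral_eq_zero : ∀ x : E, ‖x‖ = 1 → ∀ r : ℝ[X], r.degree < k →
    ∫ z, Q.eval (sqInner x z) * r.eval (sqInner x z) ∂σ = 0

namespace IsUniformOnSphere

variable {σ : Measure E} (hσ : IsUniformOnSphere σ)
include hσ

lemma exists_isZonalOrthogonal {e : E} (he : ‖e‖ = 1)
    (hdef : ∀ q : ℝ[X], ∫ z, q.eval (sqInner e z) * q.eval (sqInner e z) ∂σ = 0 → q = 0) (k : ℕ) :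
    ∃ Q, IsZonalOrthogonal σ k Q := by
  let B : ℝ[X] →ₗ[ℝ] ℝ[X] →ₗ[ℝ] ℝ := LinearMap.mk₂ ℝ
    (fun q r => ∫ z, q.eval (sqInner e z) * r.eval (sqInner e z) ∂σ)
    (fun q₁ q₂ r => by
      simp only [eval_add, add_mul]
      exact integral_add (hσ.integrable (by fun_prop)) (hσ.integrable (by fun_prop)))
    (fun c q r => by
      simp only [eval_smul, smul_eq_mul, mul_assoc, integral_const_mul])
    (fun q r₁ r₂ => by
      simp only [eval_add, mul_add]
      exact integral_add (hσ.integrable (by fun_prop)) (hσ.integrable (by fun_prop)))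
    (fun c q r => by
      simp only [eval_smul, smul_eq_mul, mul_left_comm _ c, integral_const_mul])
  let V := degreeLT ℝ k
  have : FiniteDimensional ℝ V := (degreeLTEquiv ℝ k).symm.finiteDimensional
  let T : V →ₗ[ℝ] Module.Dual ℝ V := (B.domRestrict₁₂ V V)
  have hinj : Function.Injective T := by
    rw [← LinearMap.ker_eq_bot, LinearMap.ker_eq_bot']
    intro r hr
    have := congrArg (fun φ => φ r) hr
    exact Subtype.ext (hdef r this)
  have hsurj : Function.Surjective T :=
    (LinearMap.injective_iff_surjective_of_finrank_eq_finrank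
      (Subspace.dual_finrank_eq (K := ℝ) (V := V)).symm).1 hinj
  obtain ⟨r, hr⟩ := hsurj ((B (X ^ k)).domRestrict V)
  have hrdeg : (r : ℝ[X]).degree < ((X : ℝ[X]) ^ k).degree := by
    rw [degree_X_pow]; exact mem_degreeLT.1 r.2
  have hdeg : ((X : ℝ[X]) ^ k - (r : ℝ[X])).degree = (k : WithBot ℕ) := by
    rw [degree_sub_eq_left_of_degree_lt hrdeg, degree_X_pow]
  refine ⟨(X : ℝ[X]) ^ k - (r : ℝ[X]), natDegree_eq_of_degree_eq_some hdeg, fun h => ?_, fun x hx s hs => ?_⟩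
  · rw [h, degree_zero] at hdeg
    exact absurd hdeg (by simp)
  · have h1 := congrArg (fun φ => φ ⟨s, mem_degreeLT.2 hs⟩) hr
    have h2 : B (r : ℝ[X]) s = B (X ^ k) s := h1
    rw [hσ.integral_sqInner_eq (fun t => ((X : ℝ[X]) ^ k - (r : ℝ[X])).eval t * s.eval t) hx he]
    change B (X ^ k - (r : ℝ[X])) s = 0
    rw [map_sub, LinearMap.sub_apply, h2, sub_self]

end IsUniformOnSphere

namespace IsZonalOrthogonal

variable {σ : Measure E} {k : ℕ} {Q : ℝ[X]} (hQ : IsZonalOrthogonal σ k Q)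
  (hσ : IsUniformOnSphere σ) {e : E} (he : ‖e‖ = 1)
  (hdef : ∀ q : ℝ[X], ∫ z, q.eval (sqInner e z) * q.eval (sqInner e z) ∂σ = 0 → q = 0)

omit [BorelSpace E] [FiniteDimensional ℝ E] in
include hQ in
lemma smul {c : ℝ} (hc : c ≠ 0) : IsZonalOrthogonal σ k (C c * Q) where
  natDegree_eq := by rw [natDegree_C_mul hc, hQ.natDegree_eq]
  ne_zero := mul_ne_zero (C_ne_zero.2 hc) hQ.ne_zero
  integral_eq_zero x hx r hr := by
    simp only [eval_mul, eval_C, mul_assoc, integral_const_mul]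
    rw [hQ.integral_eq_zero x hx r hr, mul_zero]

include hQ hσ he hdef

lemma eq_C_mul {h : ℝ[X]} (hdeg : h.natDegree ≤ k)
    (horth : ∀ r : ℝ[X], r.degree < k →
      ∫ z, h.eval (sqInner e z) * r.eval (sqInner e z) ∂σ = 0) : ∃ c, h = C c * Q := by
  have hlead : Q.coeff k ≠ 0 := by
    rw [← hQ.natDegree_eq]; exact leadingCoeff_ne_zero.2 hQ.ne_zero
  refine ⟨h.coeff k / Q.coeff k, sub_eq_zero.1 ?_⟩
  set c := h.coeff k / Q.coeff k with hc
  have hlt : (h - C c * Q).degree < k := by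
    refine (degree_lt_iff_coeff_zero _ _).2 fun j hj => ?_
    rcases hj.eq_or_lt with rfl | hj
    · simp [hc, hlead]
    · rw [coeff_sub, coeff_C_mul, coeff_eq_zero_of_natDegree_lt (hdeg.trans_lt hj),
        coeff_eq_zero_of_natDegree_lt (hQ.natDegree_eq.trans_lt hj), mul_zero, sub_zero]
  apply hdef
  have h1 := horth _ hlt
  have h2 := (hQ.integral_eq_zero e he _ hlt)
  calc _ = ∫ z, (h.eval (sqInner e z) * (h - C c * Q).eval (sqInner e z)
        - c * (Q.eval (sqInner e z) * (h - C c * Q).eval (sqInner e z))) ∂σ := by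
        congr 1; ext z; simp only [eval_sub, eval_mul, eval_C]; ring
    _ = 0 := by
        rw [integral_sub (hσ.integrable (by fun_prop)) (hσ.integrable (by fun_prop)),
          integral_const_mul, h1, h2, mul_zero, sub_zero]

/-- **Funk–Hecke formula** for even zonal kernels. -/
lemma exists_integral_mul_eval_eq (hE : 2 ≤ Module.finrank ℝ E) {f : ℝ → ℝ} (hf : Continuous f) :
    ∃ c : ℝ, ∀ x y : E, ‖x‖ = 1 → ‖y‖ = 1 →
      ∫ z, f (sqInner x z) * Q.eval (sqInner z y) ∂σ = c * Q.eval (sqInner x y) := by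
  have := hσ.isProbabilityMeasure
  obtain ⟨h, hdeg, heval⟩ := hσ.exists_integral_mul_eval_eq_eval hE hf Q
  obtain ⟨c, rfl⟩ := hQ.eq_C_mul hσ he hdef (hdeg.trans hQ.natDegree_eq.le) (by
    intro r hr
    obtain ⟨r', hr'deg, hr'eval⟩ := hσ.exists_integral_mul_eval_eq_eval hE hf r
    have hr'lt : r'.degree < k := by
      by_cases hr0 : r = 0
      · have : r' = 0 := by
          refine hdef _ ?_
          calc _ = ∫ z, (0 : ℝ) ∂σ := by
                refine integral_congr_ae ?_
                filter_upwards [hσ.norm_eq_one] with z hz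
                rw [← hr'eval e z he hz]
                simp [hr0]
            _ = 0 := by simp
        rw [this, degree_zero]
        exact WithBot.bot_lt_coe k
      · have h1 := (natDegree_lt_iff_degree_lt hr0).2 hr
        exact (degree_le_natDegree).trans_lt (by exact_mod_cast hr'deg.trans_lt h1)
    calc ∫ v, h.eval (sqInner e v) * r.eval (sqInner e v) ∂σ
        = ∫ v, ∫ u, f (sqInner v u) * Q.eval (sqInner u e) * r.eval (sqInner v e) ∂σ ∂σ := by
          refine integral_congr_ae ?_
          filter_upwards [hσ.norm_eq_one] with v hv
          rw [integral_mul_const, heval v e hv he, sqInner_comm v e]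
      _ = ∫ u, ∫ v, f (sqInner v u) * Q.eval (sqInner u e) * r.eval (sqInner v e) ∂σ ∂σ :=
          integral_integral_swap (hσ.integrable_prod (by
            simp only [Function.uncurry_def]; fun_prop))
      _ = ∫ u, Q.eval (sqInner e u) * r'.eval (sqInner e u) ∂σ := by
          refine integral_congr_ae ?_
          filter_upwards [hσ.norm_eq_one] with u hu
          rw [sqInner_comm e u, ← hr'eval u e hu he, ← integral_const_mul]
          congr 1
          ext v
          rw [sqInner_comm v u]
          ring
      _ = 0 := hQ.integral_eq_zero e he _ hr'lt)
  refine ⟨c, fun x y hx hy => ?_⟩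
  rw [heval x y hx hy, eval_mul, eval_C]

lemma eval_one_ne_zero (hE : 2 ≤ Module.finrank ℝ E) : Q.eval 1 ≠ 0 := by
  obtain ⟨c, hc⟩ := hQ.exists_integral_mul_eval_eq hσ he hdef hE (f := fun t => Q.eval t)
    (by fun_prop)
  intro h0
  have h1 := hc e e he he
  simp only [sqInner_comm _ e] at h1
  rw [sqInner_self he, h0, mul_zero] at h1
  exact hQ.ne_zero (hdef _ h1)

/-- The Funk–Hecke formula with the eigenvalue made explicit. -/
lemma integral_mul_eval_eq (hE : 2 ≤ Module.finrank ℝ E) (h1 : Q.eval 1 = 1) {f : ℝ → ℝ}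
    (hf : Continuous f) {x y : E} (hx : ‖x‖ = 1) (hy : ‖y‖ = 1) :
    ∫ z, f (sqInner x z) * Q.eval (sqInner z y) ∂σ
      = (∫ z, f (sqInner e z) * Q.eval (sqInner e z) ∂σ) * Q.eval (sqInner x y) := by
  obtain ⟨c, hc⟩ := hQ.exists_integral_mul_eval_eq hσ he hdef hE hf
  have h2 := hc e e he he
  simp only [sqInner_comm _ e] at h2
  rw [sqInner_self he, h1, mul_one] at h2
  rw [hc x y hx hy, h2]

end IsZonalOrthogonal

end ZonalOrthogonal

lemma Polynomial.exists_eq_sum_C_mul {Q : ℕ → ℝ[X]} (hdeg : ∀ k, (Q k).natDegree = k)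
    (hne : ∀ k, Q k ≠ 0) (g : ℝ[X]) :
    ∃ (s : Finset ℕ) (b : ℕ → ℝ), 0 ∈ s ∧ g = ∑ k ∈ s, C (b k) * Q k := by
  let S : Polynomial.Sequence ℝ := ⟨Q, fun k => by rw [degree_eq_natDegree (hne k), hdeg k]⟩
  let B := S.basis fun i => (leadingCoeff_ne_zero.2 (S.ne_zero i)).isUnit
  refine ⟨insert 0 (B.repr g).support, B.repr g, Finset.mem_insert_self _ _, ?_⟩
  conv_lhs => rw [← B.linearCombination_repr g, Finsupp.linearCombination_apply]
  rw [Finsupp.sum_of_support_subset _ (Finset.subset_insert 0 _) _ (by simp)]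
  refine Finset.sum_congr rfl fun k _ => ?_
  rw [smul_eq_C_mul, S.basis_eq_self]

lemma exists_sub_mul_sq_le {f : ℝ → ℝ} (hf : Continuous f) {ε : ℝ} (hε : 0 < ε) :
    ∃ K : ℝ, 0 ≤ K ∧ ∀ s ∈ Set.Icc (0 : ℝ) 1, ∀ t ∈ Set.Icc (0 : ℝ) 1,
      f s - ε - K * (s - t) ^ 2 ≤ f t := by
  have huc := isCompact_Icc.uniformContinuousOn_of_continuous
    (hf.continuousOn (s := Set.Icc (0 : ℝ) 1))
  obtain ⟨δ, hδ, hfδ⟩ := Metric.uniformContinuousOn_iff.1 huc ε hε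
  obtain ⟨B, hB⟩ := isCompact_Icc.exists_bound_of_continuousOn
    (hf.continuousOn (s := Set.Icc (0 : ℝ) 1))
  have hB0 : 0 ≤ B := (norm_nonneg _).trans (hB 0 (by simp))
  refine ⟨2 * B / δ ^ 2, by positivity, fun s hs t ht => ?_⟩
  rcases lt_or_ge (dist s t) δ with h | h
  · have h1 := hfδ s hs t ht h
    rw [Real.dist_eq] at h1
    have h2 : 0 ≤ 2 * B / δ ^ 2 * (s - t) ^ 2 := by positivity
    linarith [(abs_lt.1 h1).2]
  · have h1 : δ ^ 2 ≤ (s - t) ^ 2 := by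
      rw [← sq_abs (s - t), ← Real.dist_eq]
      exact pow_le_pow_left₀ hδ.le h 2
    have h2 : 2 * B ≤ 2 * B / δ ^ 2 * (s - t) ^ 2 := by
      rw [div_mul_eq_mul_div, le_div_iff₀ (by positivity)]
      exact mul_le_mul_of_nonneg_left h1 (by positivity)
    have h3 := (abs_le.1 (hB s hs)).2
    have h4 := (abs_le.1 (hB t ht)).1
    linarith

section Energy

variable {E : Type*} [NormedAddCommGroup E] [InnerProductSpace ℝ E]
  [MeasurableSpace E] [BorelSpace E] [FiniteDimensional ℝ E] {σ : Measure E}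
  (hσ : IsUniformOnSphere σ) {e : E} (he : ‖e‖ = 1)
include hσ

section PeakKernel

include he

lemma IsUniformOnSphere.integral_sqInner_pow_pos (N : ℕ) : 0 < ∫ z, sqInner e z ^ N ∂σ := by
  have := hσ.isProbabilityMeasure
  induction N with
  | zero => simp
  | succ N ih =>
    have h := hσ.integral_sqInner_pow_succ he N
    have h1 : 0 < (Module.finrank ℝ E + 2 * N : ℝ) * ∫ z, sqInner e z ^ (N + 1) ∂σ := by
      rw [h]; positivity
    exact pos_of_mul_pos_right h1 (by positivity)

lemma IsUniformOnSphere.integral_sqInner_pow_mul_one_sub (N : ℕ) :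
    ∫ z, sqInner e z ^ N * (1 - sqInner e z) ∂σ
      = (Module.finrank ℝ E - 1 : ℝ) / (Module.finrank ℝ E + 2 * N)
        * ∫ z, sqInner e z ^ N ∂σ := by
  have : Nontrivial E := ⟨e, 0, by rintro rfl; simp at he⟩
  have hpos : (0 : ℝ) < Module.finrank ℝ E := by exact_mod_cast Module.finrank_pos
  have h := hσ.integral_sqInner_pow_succ he N
  have h1 : ∫ z, sqInner e z ^ N * (1 - sqInner e z) ∂σ
      = ∫ z, sqInner e z ^ N ∂σ - ∫ z, sqInner e z ^ (N + 1) ∂σ := by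
    rw [← integral_sub (hσ.integrable (by fun_prop)) (hσ.integrable (by fun_prop))]
    congr 1
    ext z
    ring
  rw [h1, div_mul_eq_mul_div, eq_div_iff (by positivity)]
  linarith

end PeakKernel

/-- The peaked kernels `⟪x, z⟫ ^ (2 N)` reproduce a zonal kernel from below, up to a small error. -/
lemma IsUniformOnSphere.le_integral_prod {f : ℝ → ℝ} (hf : Continuous f) {ε K : ℝ} (hK : 0 ≤ K)
    (hfK : ∀ s ∈ Set.Icc (0 : ℝ) 1, ∀ t ∈ Set.Icc (0 : ℝ) 1, f s - ε - K * (s - t) ^ 2 ≤ f t)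
    {g : ℝ → ℝ} (hg : Continuous g) (hg0 : ∀ s, 0 ≤ s → 0 ≤ g s) {δ : ℝ}
    (hg1 : ∀ x : E, ‖x‖ = 1 → ∫ z, g (sqInner x z) ∂σ = 1)
    (hgδ : ∀ x : E, ‖x‖ = 1 → ∫ z, g (sqInner x z) * (1 - sqInner x z) ∂σ = δ)
    {x y : E} (hx : ‖x‖ = 1) (hy : ‖y‖ = 1) :
    f (sqInner x y) - ε - 16 * K * δ
      ≤ ∫ z, f (sqInner z.1 z.2) * (g (sqInner x z.1) * g (sqInner y z.2)) ∂(σ.prod σ) := by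
  have := hσ.isProbabilityMeasure
  have hprod : ∫ z, ((f (sqInner x y) - ε) * (g (sqInner x z.1) * g (sqInner y z.2))
      - 8 * K * ((g (sqInner x z.1) * (1 - sqInner x z.1)) * g (sqInner y z.2)
        + g (sqInner x z.1) * (g (sqInner y z.2) * (1 - sqInner y z.2)))) ∂(σ.prod σ)
      = f (sqInner x y) - ε - 16 * K * δ := by
    rw [integral_sub (hσ.integrable_prod (by fun_prop)) (hσ.integrable_prod (by fun_prop)),
      integral_const_mul, integral_const_mul,
      integral_add (hσ.integrable_prod (by fun_prop)) (hσ.integrable_prod (by fun_prop)),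
      integral_prod_mul (fun u => g (sqInner x u)) (fun v => g (sqInner y v)),
      integral_prod_mul (fun u => g (sqInner x u) * (1 - sqInner x u)) (fun v => g (sqInner y v)),
      integral_prod_mul (fun u => g (sqInner x u)) (fun v => g (sqInner y v) * (1 - sqInner y v)),
      hg1 x hx, hg1 y hy, hgδ x hx, hgδ y hy]
    ring
  rw [← hprod]
  refine integral_mono_ae (hσ.integrable_prod (by fun_prop)) (hσ.integrable_prod (by fun_prop)) ?_
  filter_upwards [hσ.ae_prod] with z hz
  have h1 := hfK (sqInner x y) ⟨sqInner_nonneg _ _, sqInner_le_one hx hy⟩ (sqInner z.1 z.2)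
    ⟨sqInner_nonneg _ _, sqInner_le_one hz.1 hz.2⟩
  have h2 := mul_le_mul_of_nonneg_left (sq_sqInner_sub_sqInner_le hx hy hz.1 hz.2) hK
  have h3 : 0 ≤ g (sqInner x z.1) * g (sqInner y z.2) :=
    mul_nonneg (hg0 _ (sqInner_nonneg _ _)) (hg0 _ (sqInner_nonneg _ _))
  have h4 : f (sqInner x y) - ε - K * (8 * (1 - sqInner x z.1) + 8 * (1 - sqInner y z.2))
      ≤ f (sqInner z.1 z.2) := by linarith
  have h5 := mul_le_mul_of_nonneg_right h4 h3
  refine le_trans (le_of_eq ?_) h5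
  ring

variable {n : ℕ} {x : Fin n → E} {ρ : Fin n → ℝ} (hx : ∀ i, ‖x i‖ = 1)
  (hdef : ∀ q : ℝ[X], ∫ z, q.eval (sqInner e z) * q.eval (sqInner e z) ∂σ = 0 → q = 0)
  (hE : 2 ≤ Module.finrank ℝ E)
include hx he hdef hE

/-- Smoothed energy of a cubature formula: only the constant harmonic and the harmonics of order
beyond the index of the formula contribute, the latter with a nonpositive sign. -/
lemma integral_prod_energy_le {Q : ℕ → ℝ[X]} (hQ : ∀ k, IsZonalOrthogonal σ k (Q k))
    (hQ1 : ∀ k, (Q k).eval 1 = 1) {d : ℕ}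
    (hcub : ∀ r : ℝ[X], r.natDegree ≤ d → ∀ v : E, ‖v‖ = 1 →
      ∑ i, ρ i * r.eval (sqInner (x i) v) = ∫ z, r.eval (sqInner e z) ∂σ)
    {f : ℝ → ℝ} (hf : Continuous f)
    (hneg : ∀ k, d < k → ∫ z, f (sqInner e z) * (Q k).eval (sqInner e z) ∂σ ≤ 0)
    {g : ℝ[X]} (hg : ∫ z, g.eval (sqInner e z) ∂σ = 1) :
    ∫ z, f (sqInner z.1 z.2) * ((∑ i, ρ i * g.eval (sqInner (x i) z.1))
      * ∑ i, ρ i * g.eval (sqInner (x i) z.2)) ∂(σ.prod σ) ≤ ∫ z, f (sqInner e z) ∂σ := by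
  have := hσ.isProbabilityMeasure
  obtain ⟨s, b, h0s, rfl⟩ := exists_eq_sum_C_mul (fun k => (hQ k).natDegree_eq)
    (fun k => (hQ k).ne_zero) g
  let φ : ℕ → E → ℝ := fun k v => ∑ i, ρ i * (Q k).eval (sqInner (x i) v)
  have hφc : ∀ k, Continuous (φ k) := fun k => by fun_prop
  let c : ℕ → ℝ := fun k => ∫ z, f (sqInner e z) * (Q k).eval (sqInner e z) ∂σ
  have hQ0 : Q 0 = 1 := by
    have h := eq_C_of_natDegree_eq_zero (hQ 0).natDegree_eq
    have h1 := hQ1 0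
    rw [h, eval_C] at h1
    rw [h, h1, C_1]
  have hQint : ∀ k, 0 < k → ∫ z, (Q k).eval (sqInner e z) ∂σ = 0 := fun k hk => by
    simpa using (hQ k).integral_eq_zero e he 1 (by rw [degree_one]; exact_mod_cast hk)
  have hφ0 : ∀ v, ‖v‖ = 1 → φ 0 v = 1 := fun v hv => by
    have := hcub (Q 0) ((hQ 0).natDegree_eq.le.trans d.zero_le) v hv
    simp only [φ]
    rw [this, hQ0]
    simp
  have hφd : ∀ k, 0 < k → k ≤ d → ∀ v, ‖v‖ = 1 → φ k v = 0 := fun k hk hkd v hv =>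
    (hcub (Q k) ((hQ k).natDegree_eq.le.trans hkd) v hv).trans (hQint k hk)
  have hb0 : b 0 = 1 := by
    simp only [eval_finsetSum, eval_mul, eval_C] at hg
    rw [integral_finsetSum _ fun i _ => hσ.integrable (by fun_prop),
      Finset.sum_eq_single_of_mem 0 h0s fun k _ hk => by
        rw [integral_const_mul, hQint k (Nat.pos_of_ne_zero hk), mul_zero]] at hg
    simpa [hQ0] using hg
  have hsum : ∀ v, ∑ i, ρ i * (∑ k ∈ s, C (b k) * Q k).eval (sqInner (x i) v)
      = ∑ k ∈ s, b k * φ k v := by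
    intro v
    simp only [φ, eval_finsetSum, eval_mul, eval_C, Finset.mul_sum]
    rw [Finset.sum_comm]
    refine Finset.sum_congr rfl fun k _ => Finset.sum_congr rfl fun i _ => ?_
    ring
  have heig : ∀ {F : ℝ → ℝ}, Continuous F → ∀ k v, ‖v‖ = 1 →
      ∫ u, F (sqInner v u) * φ k u ∂σ
        = (∫ z, F (sqInner e z) * (Q k).eval (sqInner e z) ∂σ) * φ k v := by
    intro F hF k v hv
    simp only [φ, Finset.mul_sum]
    rw [integral_finsetSum _ fun i _ => hσ.integrable (by fun_prop)]
    refine Finset.sum_congr rfl fun i _ => ?_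
    rw [sqInner_comm (x i) v, mul_left_comm,
      ← (hQ k).integral_mul_eval_eq hσ he hdef hE (hQ1 k) hF hv (hx i), ← integral_const_mul]
    congr 1
    ext u
    rw [sqInner_comm (x i) u]
    ring
  have hQorth : ∀ k l, k ≠ l → ∫ z, (Q k).eval (sqInner e z) * (Q l).eval (sqInner e z) ∂σ = 0 := by
    intro k l hkl
    have hdeg : ∀ j, (Q j).degree = (j : WithBot ℕ) := fun j => by
      rw [degree_eq_natDegree (hQ j).ne_zero, (hQ j).natDegree_eq]
    rcases hkl.lt_or_gt with h | h
    · simp only [mul_comm ((Q k).eval _)]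
      exact (hQ l).integral_eq_zero e he _ (by rw [hdeg]; exact_mod_cast h)
    · exact (hQ k).integral_eq_zero e he _ (by rw [hdeg]; exact_mod_cast h)
  have hφorth : ∀ k l, k ≠ l → ∫ v, φ k v * φ l v ∂σ = 0 := by
    intro k l hkl
    have h : ∀ v, φ k v * φ l v = ∑ i, ρ i * ((Q k).eval (sqInner (x i) v) * φ l v) := by
      intro v
      simp only [φ, Finset.sum_mul, mul_assoc]
    simp only [h]
    rw [integral_finsetSum _ fun i _ => hσ.integrable (by fun_prop)]
    refine Finset.sum_eq_zero fun i _ => ?_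
    rw [integral_const_mul, heig (F := fun t => (Q k).eval t) (by fun_prop) l (x i) (hx i),
      hQorth k l hkl, zero_mul, mul_zero]
  simp only [hsum]
  calc ∫ z, f (sqInner z.1 z.2) * ((∑ k ∈ s, b k * φ k z.1) * ∑ k ∈ s, b k * φ k z.2) ∂(σ.prod σ)
      = ∫ v, ∫ u, f (sqInner v u) * ((∑ k ∈ s, b k * φ k v) * ∑ k ∈ s, b k * φ k u) ∂σ ∂σ :=
        integral_prod _ (hσ.integrable_prod (by fun_prop))
    _ = ∫ v, ∑ k ∈ s, ∑ l ∈ s, b k * b l * c l * (φ k v * φ l v) ∂σ := by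
        refine integral_congr_ae ?_
        filter_upwards [hσ.norm_eq_one] with v hv
        simp only [Finset.sum_mul_sum]
        simp only [Finset.mul_sum]
        rw [integral_finsetSum _ fun i _ => hσ.integrable (by fun_prop)]
        refine Finset.sum_congr rfl fun k _ => ?_
        rw [integral_finsetSum _ fun i _ => hσ.integrable (by fun_prop)]
        refine Finset.sum_congr rfl fun l _ => ?_
        have h := heig hf l v hv
        calc _ = ∫ u, (b k * b l * φ k v) * (f (sqInner v u) * φ l u) ∂σ := by
              congr 1; ext u; ring
          _ = _ := by rw [integral_const_mul, h]; simp only [c]; ring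
    _ = ∑ k ∈ s, b k * b k * c k * ∫ v, φ k v * φ k v ∂σ := by
        rw [integral_finsetSum _ fun i _ => hσ.integrable (by fun_prop)]
        refine Finset.sum_congr rfl fun k hk => ?_
        rw [integral_finsetSum _ fun i _ => hσ.integrable (by fun_prop),
          Finset.sum_eq_single_of_mem k hk fun l _ hl => by
            rw [integral_const_mul, hφorth k l hl.symm, mul_zero], integral_const_mul]
    _ ≤ ∑ k ∈ s, if k = 0 then ∫ z, f (sqInner e z) ∂σ else 0 := by
        refine Finset.sum_le_sum fun k _ => ?_
        split_ifs with hk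
        · subst hk
          have h1 : ∫ v, φ 0 v * φ 0 v ∂σ = 1 := by
            calc _ = ∫ _, (1 : ℝ) ∂σ := by
                  refine integral_congr_ae ?_
                  filter_upwards [hσ.norm_eq_one] with v hv
                  rw [hφ0 v hv, mul_one]
              _ = 1 := by simp
          rw [h1, hb0]
          simp [c, hQ0]
        · rcases le_or_gt k d with hkd | hkd
          · have h1 : ∫ v, φ k v * φ k v ∂σ = 0 := by
              calc _ = ∫ _, (0 : ℝ) ∂σ := by
                    refine integral_congr_ae ?_
                    filter_upwards [hσ.norm_eq_one] with v hv
                    rw [hφd k (Nat.pos_of_ne_zero hk) hkd v hv, mul_zero]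
                _ = 0 := by simp
            rw [h1, mul_zero]
          · exact mul_nonpos_of_nonpos_of_nonneg
              (mul_nonpos_of_nonneg_of_nonpos (mul_self_nonneg _) (hneg k hkd))
              (integral_nonneg fun v => mul_self_nonneg _)
    _ = ∫ z, f (sqInner e z) ∂σ := by
        rw [Finset.sum_ite_eq', if_pos h0s]

lemma sum_energy_le {Q : ℕ → ℝ[X]} (hQ : ∀ k, IsZonalOrthogonal σ k (Q k))
    (hQ1 : ∀ k, (Q k).eval 1 = 1) (hρ : ∀ i, 0 < ρ i) {d : ℕ}
    (hcub : ∀ r : ℝ[X], r.natDegree ≤ d → ∀ v : E, ‖v‖ = 1 →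
      ∑ i, ρ i * r.eval (sqInner (x i) v) = ∫ z, r.eval (sqInner e z) ∂σ)
    {f : ℝ → ℝ} (hf : Continuous f)
    (hneg : ∀ k, d < k → ∫ z, f (sqInner e z) * (Q k).eval (sqInner e z) ∂σ ≤ 0) :
    ∑ i, ∑ j, ρ i * ρ j * f (sqInner (x i) (x j)) ≤ ∫ z, f (sqInner e z) ∂σ := by
  have := hσ.isProbabilityMeasure
  have hρ1 : ∑ i, ρ i = 1 := by
    simpa using hcub 1 (by simp) e he
  refine le_of_forall_pos_le_add fun ε hε => ?_
  obtain ⟨K, hK, hfK⟩ := exists_sub_mul_sq_le hf hε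
  let δ : ℕ → ℝ := fun N => (Module.finrank ℝ E - 1 : ℝ) / (Module.finrank ℝ E + 2 * N)
  have hδ : Filter.Tendsto δ Filter.atTop (nhds 0) := by
    refine Filter.Tendsto.div_atTop tendsto_const_nhds ?_
    exact Filter.tendsto_atTop_add_const_left _ _
      (tendsto_natCast_atTop_atTop.const_mul_atTop (by norm_num))
  have hbound : ∀ N, ∑ i, ∑ j, ρ i * ρ j * f (sqInner (x i) (x j)) - ε - 16 * K * δ N
      ≤ ∫ z, f (sqInner e z) ∂σ := by
    intro N
    have hM := hσ.integral_sqInner_pow_pos he N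
    set M := ∫ z, sqInner e z ^ N ∂σ with hMdef
    let g : ℝ[X] := C M⁻¹ * X ^ N
    have hg : ∀ t, g.eval t = M⁻¹ * t ^ N := fun t => by simp [g]
    have hg1 : ∀ y : E, ‖y‖ = 1 → ∫ z, g.eval (sqInner y z) ∂σ = 1 := by
      intro y hy
      rw [hσ.integral_sqInner_eq (fun t => g.eval t) hy he]
      simp only [hg, integral_const_mul]
      exact inv_mul_cancel₀ hM.ne'
    have hgδ : ∀ y : E, ‖y‖ = 1 →
        ∫ z, g.eval (sqInner y z) * (1 - sqInner y z) ∂σ = δ N := by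
      intro y hy
      rw [hσ.integral_sqInner_eq (fun t => g.eval t * (1 - t)) hy he]
      simp only [hg, mul_assoc, integral_const_mul]
      rw [hσ.integral_sqInner_pow_mul_one_sub he, ← hMdef, mul_left_comm, inv_mul_cancel₀ hM.ne',
        mul_one]
    have hup := integral_prod_energy_le hσ he hx hdef hE hQ hQ1 hcub hf hneg (hg1 e he)
    have hexp : ∫ z, f (sqInner z.1 z.2) * ((∑ i, ρ i * g.eval (sqInner (x i) z.1))
        * ∑ i, ρ i * g.eval (sqInner (x i) z.2)) ∂(σ.prod σ)
        = ∑ i, ∑ j, ρ i * ρ j * ∫ z, f (sqInner z.1 z.2)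
          * (g.eval (sqInner (x i) z.1) * g.eval (sqInner (x j) z.2)) ∂(σ.prod σ) := by
      simp only [Finset.sum_mul_sum]
      simp only [Finset.mul_sum]
      rw [integral_finsetSum _ fun i _ => hσ.integrable_prod (by fun_prop)]
      refine Finset.sum_congr rfl fun i _ => ?_
      rw [integral_finsetSum _ fun i _ => hσ.integrable_prod (by fun_prop)]
      refine Finset.sum_congr rfl fun j _ => ?_
      rw [← integral_const_mul]
      congr 1
      ext z
      ring
    rw [hexp] at hup
    refine le_trans ?_ hup
    have hone : ∑ i, ∑ j, ρ i * ρ j = 1 := by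
      rw [← Finset.sum_mul_sum, hρ1, mul_one]
    calc ∑ i, ∑ j, ρ i * ρ j * f (sqInner (x i) (x j)) - ε - 16 * K * δ N
        = ∑ i, ∑ j, ρ i * ρ j * f (sqInner (x i) (x j))
          - (∑ i, ∑ j, ρ i * ρ j) * (ε + 16 * K * δ N) := by rw [hone]; ring
      _ = ∑ i, ∑ j, ρ i * ρ j * (f (sqInner (x i) (x j)) - ε - 16 * K * δ N) := by
          simp only [Finset.sum_mul, ← Finset.sum_sub_distrib]
          refine Finset.sum_congr rfl fun i _ => Finset.sum_congr rfl fun j _ => ?_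
          ring
      _ ≤ _ := by
          refine Finset.sum_le_sum fun i _ => Finset.sum_le_sum fun j _ => ?_
          refine mul_le_mul_of_nonneg_left ?_ (mul_pos (hρ i) (hρ j)).le
          exact hσ.le_integral_prod hf hK hfK (g := fun t => g.eval t) (by fun_prop)
            (fun t ht => by rw [hg]; positivity) hg1 hgδ (hx i) (hx j)
  have hlim := ge_of_tendsto' (hδ.const_mul (16 * K)) fun N =>
    (sub_le_comm.1 (hbound N))
  linarith

lemma apply_one_le_card_mul {Q : ℕ → ℝ[X]} (hQ : ∀ k, IsZonalOrthogonal σ k (Q k))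
    (hQ1 : ∀ k, (Q k).eval 1 = 1) (hρ : ∀ i, 0 < ρ i) {d : ℕ}
    (hcub : ∀ r : ℝ[X], r.natDegree ≤ d → ∀ v : E, ‖v‖ = 1 →
      ∑ i, ρ i * r.eval (sqInner (x i) v) = ∫ z, r.eval (sqInner e z) ∂σ)
    {f : ℝ → ℝ} (hf : Continuous f) (hf0 : ∀ t ∈ Set.Icc (0 : ℝ) 1, 0 ≤ f t)
    (hneg : ∀ k, d < k → ∫ z, f (sqInner e z) * (Q k).eval (sqInner e z) ∂σ ≤ 0) :
    f 1 ≤ n * ∫ z, f (sqInner e z) ∂σ := by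
  have := hσ.isProbabilityMeasure
  have hρ1 : ∑ i, ρ i = 1 := by
    simpa using hcub 1 (by simp) e he
  have h1 := sum_energy_le hσ he hx hdef hE hQ hQ1 hρ hcub hf hneg
  have hf1 : 0 ≤ f 1 := hf0 1 (by simp)
  have h2 : (∑ i, ρ i ^ 2) * f 1 ≤ ∑ i, ∑ j, ρ i * ρ j * f (sqInner (x i) (x j)) := by
    rw [Finset.sum_mul]
    refine Finset.sum_le_sum fun i _ => ?_
    have h := Finset.single_le_sum (f := fun j => ρ i * ρ j * f (sqInner (x i) (x j)))
      (fun j _ => mul_nonneg (mul_pos (hρ i) (hρ j)).le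
        (hf0 _ ⟨sqInner_nonneg _ _, sqInner_le_one (hx i) (hx j)⟩)) (Finset.mem_univ i)
    simp only [sqInner_self (hx i)] at h
    rwa [sq]
  have h3 := sq_sum_le_card_mul_sum_sq (s := Finset.univ) (f := ρ)
  rw [hρ1, one_pow, Finset.card_univ, Fintype.card_fin] at h3
  calc f 1 = 1 * f 1 := (one_mul _).symm
    _ ≤ (n * ∑ i, ρ i ^ 2) * f 1 := mul_le_mul_of_nonneg_right h3 hf1
    _ = n * ((∑ i, ρ i ^ 2) * f 1) := mul_assoc _ _ _
    _ ≤ _ := mul_le_mul_of_nonneg_left (h2.trans h1) n.cast_nonneg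

end Energy

/-- A cubature formula for homogeneous polynomials of degree `2 * d` integrates the zonal
polynomials of degree at most `d`. -/
lemma sum_mul_eval_sqInner_eq {m d n : ℕ} {σ : Measure (EuclideanSpace ℝ (Fin m))}
    (hσ : IsUniformOnSphere σ) {x : Fin n → EuclideanSpace ℝ (Fin m)} {ρ : Fin n → ℝ}
    (hx : ∀ i, ‖x i‖ = 1)
    (hcub : ∀ ψ : MvPolynomial (Fin m) ℝ, ψ.IsHomogeneous (2 * d) →
      ∫ z, MvPolynomial.eval (fun k => z k) ψ ∂σ
        = ∑ i, ρ i * MvPolynomial.eval (fun k => x i k) ψ)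
    {r : ℝ[X]} (hr : r.natDegree ≤ d) {e v : EuclideanSpace ℝ (Fin m)} (he : ‖e‖ = 1)
    (hv : ‖v‖ = 1) :
    ∑ i, ρ i * r.eval (sqInner (x i) v) = ∫ z, r.eval (sqInner e z) ∂σ := by
  let ℓ : MvPolynomial (Fin m) ℝ := ∑ k, MvPolynomial.C (v k) * MvPolynomial.X k
  let N : MvPolynomial (Fin m) ℝ := ∑ k, MvPolynomial.X k ^ 2
  have hℓ : ℓ.IsHomogeneous 1 := MvPolynomial.IsHomogeneous.sum _ _ _ fun k _ => by
    simpa using (MvPolynomial.isHomogeneous_C (Fin m) (v k)).mul (MvPolynomial.isHomogeneous_X ℝ k)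
  have hN : N.IsHomogeneous 2 := MvPolynomial.IsHomogeneous.sum _ _ _ fun k _ => by
    simpa using (MvPolynomial.isHomogeneous_X ℝ k).pow 2
  let ψ : MvPolynomial (Fin m) ℝ :=
    ∑ j ∈ Finset.range (d + 1), MvPolynomial.C (r.coeff j) * (ℓ ^ (2 * j) * N ^ (d - j))
  have hψ : ψ.IsHomogeneous (2 * d) := MvPolynomial.IsHomogeneous.sum _ _ _ fun j hj => by
    have hj' : j ≤ d := Nat.lt_succ_iff.1 (Finset.mem_range.1 hj)
    have h := (MvPolynomial.isHomogeneous_C (Fin m) (r.coeff j)).mul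
      ((hℓ.pow (2 * j)).mul (hN.pow (d - j)))
    convert h using 1
    omega
  have hψeval : ∀ z : EuclideanSpace ℝ (Fin m), ‖z‖ = 1 →
      MvPolynomial.eval (fun k => z k) ψ = r.eval (sqInner v z) := by
    intro z hz
    have h1 : MvPolynomial.eval (fun k => z k) ℓ = inner ℝ v z := by
      simp [ℓ, PiLp.inner_apply, mul_comm]
    have h2 : MvPolynomial.eval (fun k => z k) N = 1 := by
      have := EuclideanSpace.real_norm_sq_eq z
      rw [hz] at this
      simpa [N] using this.symm
    rw [eval_eq_sum_range' (Nat.lt_succ_iff.2 hr)]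
    simp only [ψ, map_sum, map_mul, map_pow, h1, h2, MvPolynomial.eval_C, one_pow, mul_one, pow_mul,
      sqInner]
  have h := hcub ψ hψ
  rw [hσ.integral_sqInner_eq (fun t => r.eval t) he hv]
  calc _ = ∑ i, ρ i * MvPolynomial.eval (fun k => x i k) ψ := by
        refine Finset.sum_congr rfl fun i _ => ?_
        rw [hψeval _ (hx i), sqInner_comm]
    _ = ∫ z, MvPolynomial.eval (fun k => z k) ψ ∂σ := h.symm
    _ = _ := by
        refine integral_congr_ae ?_
        filter_upwards [hσ.norm_eq_one] with z hz using hψeval z hz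

/-- **Linear programming bound over the class `K_{p/2,∞}`: real case.**
For a real projective cubature formula of index `p` on `S^{m-1}` and a nonzero nonnegative
continuous function `f` on `[-1,1]` all of whose Jacobi–Fourier coefficients of order
`k ≥ p/2+1` (for the weight `(1-t)^{(m-3)/2}(1+t)^{-1/2}`) are nonpositive, one has
`n ≥ (∫ (1-t)^α (1+t)^β dt) · f(1) / ∫ f(t)(1-t)^α(1+t)^β dt`. -/
theorem lp_bound_Kinfty_real_cubature
    (m : ℕ) (hm : 2 ≤ m) (p : ℕ) (hp : 0 < p) (hpe : Even p)
    (σ : Measure (EuclideanSpace ℝ (Fin m))) [IsProbabilityMeasure σ]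
    (hσsupp : ∀ᵐ z ∂σ, ‖z‖ = 1)
    (hσinv : ∀ g : EuclideanSpace ℝ (Fin m) ≃ₗᵢ[ℝ] EuclideanSpace ℝ (Fin m),
      Measure.map g σ = σ)
    (n : ℕ) (x : Fin n → EuclideanSpace ℝ (Fin m)) (ρ : Fin n → ℝ)
    (hx : ∀ i, ‖x i‖ = 1) (hρ : ∀ i, 0 < ρ i)
    (hdist : ∀ i j, i ≠ j → x i ≠ x j ∧ x i ≠ -x j)
    (hcub : ∀ ψ : MvPolynomial (Fin m) ℝ, ψ.IsHomogeneous p →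
      ∫ z, MvPolynomial.eval (fun k => z k) ψ ∂σ
        = ∑ i, ρ i * MvPolynomial.eval (fun k => x i k) ψ)
    (f : ℝ → ℝ) (hfc : ContinuousOn f (Set.Icc (-1) 1))
    (hf0 : ∀ t ∈ Set.Icc (-1:ℝ) 1, 0 ≤ f t)
    (hfne : ∃ t ∈ Set.Icc (-1:ℝ) 1, f t ≠ 0)
    (hK : ∀ k : ℕ, p / 2 + 1 ≤ k → ∀ Q : Polynomial ℝ, Q.natDegree = k → 0 < Q.eval 1 →
      (∀ j : ℕ, j < k →
        ∫ t in (-1:ℝ)..1, Q.eval t * t ^ j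
          * (1 - t) ^ (((m:ℝ) - 3) / 2) * (1 + t) ^ (-(1/2) : ℝ) = 0) →
      ∫ t in (-1:ℝ)..1, f t * Q.eval t
        * (1 - t) ^ (((m:ℝ) - 3) / 2) * (1 + t) ^ (-(1/2) : ℝ) ≤ 0) :
    (∫ t in (-1:ℝ)..1, (1 - t) ^ (((m:ℝ) - 3) / 2) * (1 + t) ^ (-(1/2) : ℝ)) * f 1 /
      (∫ t in (-1:ℝ)..1, f t * (1 - t) ^ (((m:ℝ) - 3) / 2) * (1 + t) ^ (-(1/2) : ℝ))
      ≤ (n : ℝ) := by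
  set a : ℝ := ((m : ℝ) - 3) / 2 with ha_def
  have hm' : (2 : ℝ) ≤ m := by exact_mod_cast hm
  have ha : -1 < a := by rw [ha_def]; linarith
  have hfin : Module.finrank ℝ (EuclideanSpace ℝ (Fin m)) = m := finrank_euclideanSpace_fin
  have hdim : (Module.finrank ℝ (EuclideanSpace ℝ (Fin m)) : ℝ) = 2 * a + 3 := by
    rw [hfin, ha_def]; ring
  have hE : 2 ≤ Module.finrank ℝ (EuclideanSpace ℝ (Fin m)) := by omega
  have hσ : IsUniformOnSphere σ := ⟨inferInstance, hσsupp, hσinv⟩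
  obtain ⟨e, he⟩ : ∃ e : EuclideanSpace ℝ (Fin m), ‖e‖ = 1 :=
    ⟨EuclideanSpace.single ⟨0, by omega⟩ 1, by simp⟩
  have hdef : ∀ q : ℝ[X], ∫ z, q.eval (sqInner e z) * q.eval (sqInner e z) ∂σ = 0 → q = 0 :=
    fun q => hσ.eq_zero_of_integral_sq_eq_zero ha hdim he
  have hQex : ∀ k, ∃ Q, IsZonalOrthogonal σ k Q ∧ Q.eval 1 = 1 := by
    intro k
    obtain ⟨Q, hQ⟩ := hσ.exists_isZonalOrthogonal he hdef k
    have h1 := hQ.eval_one_ne_zero hσ he hdef hE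
    exact ⟨C (Q.eval 1)⁻¹ * Q, hQ.smul (inv_ne_zero h1), by simp [h1]⟩
  choose Q hQ hQ1 using hQex
  let F : ℝ → ℝ := fun s =>
    Set.IccExtend (by norm_num : (-1 : ℝ) ≤ 1) ((Set.Icc (-1 : ℝ) 1).domRestrict f) (2 * s - 1)
  have hF : Continuous F :=
    (continuousOn_iff_continuous_domRestrict.1 hfc).Icc_extend'.comp (by fun_prop)
  have hFf : ∀ t ∈ Set.Icc (-1 : ℝ) 1, F ((1 + t) / 2) = f t := by
    intro t ht
    have h : 2 * ((1 + t) / 2) - 1 = t := by ring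
    simp only [F, h]
    rw [Set.IccExtend_of_mem _ _ ht, Set.domRestrict_apply]
  have hF0 : ∀ s ∈ Set.Icc (0 : ℝ) 1, 0 ≤ F s := by
    intro s hs
    have hmem : 2 * s - 1 ∈ Set.Icc (-1 : ℝ) 1 := ⟨by linarith [hs.1], by linarith [hs.2]⟩
    have h := hFf (2 * s - 1) hmem
    have h' : (1 + (2 * s - 1)) / 2 = s := by ring
    rw [h'] at h
    rw [h]
    exact hf0 _ hmem
  have hF1 : F 1 = f 1 := by
    have h := hFf 1 (by simp)
    norm_num at h
    exact h
  have hW := integral_jacobiWeight_pos ha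
  have hcub' : ∀ r : ℝ[X], r.natDegree ≤ p / 2 → ∀ v : EuclideanSpace ℝ (Fin m), ‖v‖ = 1 →
      ∑ i, ρ i * r.eval (sqInner (x i) v) = ∫ z, r.eval (sqInner e z) ∂σ := fun r hr v hv =>
    sum_mul_eval_sqInner_eq hσ hx (by rwa [Nat.two_mul_div_two_of_even hpe]) hr he hv
  have hneg : ∀ k, p / 2 < k →
      ∫ z, F (sqInner e z) * (Q k).eval (sqInner e z) ∂σ ≤ 0 := by
    intro k hk
    have heval : ∀ t, ((Q k).comp (C (1 / 2) * X + C (1 / 2))).eval t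
        = (Q k).eval ((1 + t) / 2) := by
      intro t
      rw [eval_comp]
      congr 1
      simp only [eval_add, eval_mul, eval_C, eval_X]
      ring
    have h := hK k hk ((Q k).comp (C (1 / 2) * X + C (1 / 2)))
      (by rw [natDegree_comp, natDegree_linear (by norm_num), mul_one, (hQ k).natDegree_eq])
      (by rw [heval]; norm_num [hQ1]) (by
        intro j hj
        have h1 := hσ.integral_sqInner_mul_integral_jacobiWeight ha hdim he
          (f := fun s => (Q k).eval s * ((C 2 * X + C (-1)) ^ j : ℝ[X]).eval s) (by fun_prop)
        rw [(hQ k).integral_eq_zero e he _ (by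
          refine degree_le_natDegree.trans_lt ?_
          rw [natDegree_pow, natDegree_linear (by norm_num), mul_one]
          exact_mod_cast hj), zero_mul] at h1
        rw [h1]
        congr 1
        ext t
        simp only [heval, jacobiWeight, eval_pow, eval_add, eval_mul, eval_C, eval_X]
        ring)
    have h1 := hσ.integral_sqInner_mul_integral_jacobiWeight ha hdim he
      (f := fun s => F s * (Q k).eval s) (by fun_prop)
    refine nonpos_of_mul_nonpos_left (h1.trans_le (le_of_eq_of_le ?_ h)) hW
    refine intervalIntegral.integral_congr fun t ht => ?_
    rw [Set.uIcc_of_le (by norm_num)] at ht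
    simp only [hFf t ht, heval, jacobiWeight]
    ring
  have hmain := apply_one_le_card_mul hσ he hx hdef hE hQ hQ1 hρ hcub' hF hF0 hneg
  rw [hF1] at hmain
  have hD : (∫ z, F (sqInner e z) ∂σ) * ∫ t in (-1 : ℝ)..1, jacobiWeight a t
      = ∫ t in (-1 : ℝ)..1, f t * (1 - t) ^ a * (1 + t) ^ (-(1 / 2) : ℝ) := by
    rw [hσ.integral_sqInner_mul_integral_jacobiWeight ha hdim he hF]
    refine intervalIntegral.integral_congr fun t ht => ?_
    rw [Set.uIcc_of_le (by norm_num)] at ht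
    simp only [hFf t ht, jacobiWeight, mul_assoc]
  have hI : 0 ≤ ∫ z, F (sqInner e z) ∂σ := by
    refine integral_nonneg_of_ae ?_
    filter_upwards [hσ.norm_eq_one] with z hz
      using hF0 _ ⟨sqInner_nonneg _ _, sqInner_le_one he hz⟩
  rw [← hD]
  change (∫ t in (-1 : ℝ)..1, jacobiWeight a t) * f 1 / _ ≤ _
  refine div_le_of_le_mul₀ (mul_nonneg hI hW.le) n.cast_nonneg ?_
  rw [← mul_assoc, mul_comm]
  exact mul_le_mul_of_nonneg_right hmain hW.le
end
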